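/- arXiv:math/0605642 — 5 statements merged into one kernel-verified Lean document; each statement's English description precedes it below -/
import Mathlib

section
/- Consider the random graph G(n, m) with m = m(n) edges, where λ_n := 2m/n → λ for some λ > 0, and for k ≥ 0 let N_k be the number of vertices of degree k. Then for all j, k ≥ 0, as n → ∞, n^{-1/2} E[N_k − n π_{λ_n}(k)] → 0 and n^{-1} Cov(N_j, N_k) → π_λ(j) π_λ(k) (−(j−λ)(k−λ)/λ − 1) + π_λ(k) δ_{jk}. -/
open MeasureTheory ProbabilityTheory Filter Topology

noncomputable section

/-- Convergence in distribution (weak convergence of laws): integrals of every bounded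
continuous function converge. -/
def TendstoInDistribution {E : Type*} [MeasurableSpace E] [TopologicalSpace E]
    (μs : ℕ → Measure E) (μ : Measure E) : Prop :=
  ∀ f : BoundedContinuousFunction E ℝ,
    Tendsto (fun n => ∫ x, f x ∂(μs n)) atTop (𝓝 (∫ x, f x ∂μ))

/-- `κ` is a version of the conditional distribution of the first coordinate given the
second coordinate, for the joint law `μ`: it is a Markov kernel which disintegrates `μ`. -/
def IsCondLaw {E F : Type*} [MeasurableSpace E] [MeasurableSpace F]
    (μ : Measure (E × F)) (κ : Kernel F E) : Prop :=
  IsMarkovKernel κ ∧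
  ∀ s : Set E, ∀ t : Set F, MeasurableSet s → MeasurableSet t →
    μ (s ×ˢ t) = ∫⁻ z in t, κ z s ∂(μ.map Prod.snd)

/-- A family of measures `κ z` (conditional distributions) is stochastically increasing:
`P(X ≤ x | Y = z)` is weakly decreasing in `z`. -/
def StochIncrFam {E F : Type*} [MeasurableSpace E] [Preorder E] [Preorder F]
    (κ : F → Measure E) : Prop :=
  ∀ z₁ z₂ : F, z₁ ≤ z₂ → ∀ x : E, κ z₂ {w | w ≤ x} ≤ κ z₁ {w | w ≤ x}

/-- A family of measures `κ z` is stochastically decreasing: `P(X ≥ x | Y = z)` is weakly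
decreasing in `z` (equivalently, `-X` is stochastically increasing). -/
def StochDecrFam {E F : Type*} [MeasurableSpace E] [Preorder E] [Preorder F]
    (κ : F → Measure E) : Prop :=
  ∀ z₁ z₂ : F, z₁ ≤ z₂ → ∀ x : E, κ z₂ {w | x ≤ w} ≤ κ z₁ {w | x ≤ w}

/-- Covariance of two real functionals under a measure. -/
def covFn {E : Type*} [MeasurableSpace E] (μ : Measure E) (f g : E → ℝ) : ℝ :=
  ∫ x, f x * g x ∂μ - (∫ x, f x ∂μ) * (∫ x, g x ∂μ)

/-- A measure on a real normed space is Gaussian (jointly normal, possibly degenerate) if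
every continuous linear functional pushes it forward to a one-dimensional Gaussian law. -/
def IsGaussianMeasure {E : Type*} [NormedAddCommGroup E] [NormedSpace ℝ E]
    [MeasurableSpace E] (μ : Measure E) : Prop :=
  ∀ L : E →L[ℝ] ℝ, ∃ m : ℝ, ∃ v : NNReal, μ.map (fun x => L x) = gaussianReal m v

open scoped ENNReal

/-- The index type for potential edges of a graph on `Fin n`: unordered pairs of distinct
vertices. -/
abbrev EdgeIdx (n : ℕ) := {e : Sym2 (Fin n) // ¬ e.IsDiag}

/-- The Erdős–Rényi measure `G(n,p)`: each potential edge is present independently with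
probability `p`; a graph is encoded as its edge indicator `S : EdgeIdx n → Bool`. -/
def gnpMeasure (n : ℕ) (p : ℝ) : Measure (EdgeIdx n → Bool) :=
  ∑ S : EdgeIdx n → Bool,
    (∏ e : EdgeIdx n, if S e then ENNReal.ofReal p else ENNReal.ofReal (1 - p)) •
      Measure.dirac S

/-- The number of edges of the graph `S`. -/
def edgeCount (n : ℕ) (S : EdgeIdx n → Bool) : ℕ :=
  (Finset.univ.filter fun e : EdgeIdx n => S e = true).card

/-- The uniform measure `G(n,m)` on graphs on `Fin n` with exactly `m` edges. -/
def gnmMeasure (n m : ℕ) : Measure (EdgeIdx n → Bool) :=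
  ∑ S : EdgeIdx n → Bool,
    (if edgeCount n S = m then
        ((Finset.univ.filter fun S' : EdgeIdx n → Bool => edgeCount n S' = m).card :
          ℝ≥0∞)⁻¹
      else 0) • Measure.dirac S

/-- The degree of the vertex `v` in the graph `S`. -/
def degree (n : ℕ) (S : EdgeIdx n → Bool) (v : Fin n) : ℕ :=
  (Finset.univ.filter fun e : EdgeIdx n => S e = true ∧ v ∈ (e : Sym2 (Fin n))).card

/-- The number of vertices of degree `k` in the graph `S`. -/
def degCount (n : ℕ) (k : ℕ) (S : EdgeIdx n → Bool) : ℕ :=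
  (Finset.univ.filter fun v : Fin n => degree n S v = k).card

/-- The Poisson point probabilities `π_λ(k) = e^{-λ} λ^k / k!`. -/
def poissonProb (lam : ℝ) (k : ℕ) : ℝ :=
  Real.exp (-lam) * lam ^ k / (k.factorial : ℝ)


lemma count_bool (F : Type*) [Fintype F] [DecidableEq F] (x : ℕ) :
    (Finset.univ.filter fun g : F → Bool =>
      (Finset.univ.filter fun e => g e = true).card = x).card = (Fintype.card F).choose x := by
  rw [← Finset.card_univ, ← Finset.card_powersetCard]
  refine Finset.card_nbij' (fun g => Finset.univ.filter fun e => g e = true)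
    (fun s e => decide (e ∈ s)) ?_ ?_ ?_ ?_
  · intro g hg
    simpa [Finset.mem_powersetCard] using hg
  · intro s hs
    simpa [Finset.mem_powersetCard] using hs
  · intro g hg
    ext e; simp
  · intro s hs
    ext e; simp

lemma count_color {E ι : Type*} [Fintype E] [DecidableEq E] [Fintype ι] [DecidableEq ι]
    (c : E → ι) (x : ι → ℕ) :
    (Finset.univ.filter fun S : E → Bool =>
      ∀ i, (Finset.univ.filter fun e => S e = true ∧ c e = i).card = x i).card
      = ∏ i, (Finset.univ.filter fun e => c e = i).card.choose (x i) := by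
  have h1 : ∀ i, (Finset.univ.filter fun e => c e = i).card.choose (x i) =
      (Finset.univ.filter fun g : {e // c e = i} → Bool =>
      (Finset.univ.filter fun e => g e = true).card = x i).card := by
    intro i
    rw [count_bool, Fintype.card_subtype]
  simp_rw [h1]
  rw [← Fintype.card_piFinset]
  have key : ∀ (S : E → Bool) i, (Finset.univ.filter fun e : {e // c e = i} => S e.1 = true).card
      = (Finset.univ.filter fun e => S e = true ∧ c e = i).card := by
    intro S i
    refine Finset.card_nbij (fun e => e.1) ?_ ?_ ?_
    · intro e he
      simp at he ⊢
      exact ⟨he, e.2⟩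
    · intro a _ b _ h
      exact Subtype.ext h
    · intro e he
      simp at he ⊢
      exact ⟨he.1, he.2⟩
  have key2 : ∀ (T : ∀ i, {e // c e = i} → Bool), (fun (i : ι) (e : {e // c e = i}) => T (c e.1) ⟨e.1, rfl⟩) = T := by
    intro T
    ext i ⟨e, he⟩
    subst he
    rfl
  refine Finset.card_nbij' (fun S i e => S e.1) (fun T e => T (c e) ⟨e, rfl⟩) ?_ ?_ ?_ ?_
  · intro S hS
    simp [Fintype.mem_piFinset, key] at hS ⊢
    exact hS
  · intro T hT
    simp [Fintype.mem_piFinset] at hT ⊢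
    intro i
    rw [← key]
    have := hT i
    conv at this => rw [← key2 T]
    exact this
  · intro S hS
    rfl
  · intro T hT
    exact key2 T

lemma count_color' {E ι : Type*} [Fintype E] [DecidableEq E] [Fintype ι] [DecidableEq ι]
    (c : E → ι) (x : ι → ℕ) (N : (E → Bool) → ι → ℕ) (D : ι → ℕ)
    (hN : ∀ S i, N S i = (Finset.univ.filter fun e => S e = true ∧ c e = i).card)
    (hD : ∀ i, D i = (Finset.univ.filter fun e => c e = i).card) :
    (Finset.univ.filter fun S : E → Bool => ∀ i, N S i = x i).card
      = ∏ i, (D i).choose (x i) := by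
  simp_rw [hN, hD]
  exact count_color c x

lemma card_edge (n : ℕ) : Fintype.card (EdgeIdx n) = n.choose 2 := by
  have := Sym2.card_subtype_not_diag (α := Fin n)
  rw [Fintype.card_fin] at this
  rw [← this]

lemma card_star (n : ℕ) (v : Fin n) :
    (Finset.univ.filter fun e : EdgeIdx n => v ∈ (e : Sym2 (Fin n))).card = n - 1 := by
  have : (Finset.univ.erase v).card = n - 1 := by simp
  rw [← this]
  symm
  refine Finset.card_bij (fun w hw => ⟨s(v, w), ?_⟩) ?_ ?_ ?_
  · simp at hw ⊢
    exact fun h => hw h.symm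
  · intro w hw
    simp
  · intro a ha b hb h
    simp at h
    rcases h with h | ⟨h1, h2⟩
    · exact h
    · exact h2.trans h1
  · rintro ⟨e, he⟩ h
    simp at h
    obtain ⟨w, rfl⟩ := h
    refine ⟨w, ?_, rfl⟩
    simp at he ⊢
    exact fun h => he h.symm

lemma card_both (n : ℕ) (v w : Fin n) (h : v ≠ w) :
    (Finset.univ.filter fun e : EdgeIdx n => v ∈ (e : Sym2 (Fin n)) ∧ w ∈ (e : Sym2 (Fin n))).card = 1 := by
  rw [Finset.card_eq_one]
  refine ⟨⟨s(v, w), by simpa using h⟩, ?_⟩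
  ext ⟨e, he⟩
  simp only [Finset.mem_filter, Finset.mem_univ, true_and, Finset.mem_singleton, Subtype.mk.injEq]
  exact Sym2.mem_and_mem_iff h

lemma count_edge (n m : ℕ) :
    (Finset.univ.filter fun S : EdgeIdx n → Bool => edgeCount n S = m).card
      = (n.choose 2).choose m := by
  unfold edgeCount
  rw [count_bool, card_edge]

lemma count_deg (n m k : ℕ) (v : Fin n) (hk : k ≤ m) :
    (Finset.univ.filter fun S : EdgeIdx n → Bool => edgeCount n S = m ∧ degree n S v = k).card
      = (n - 1).choose k * (n.choose 2 - (n - 1)).choose (m - k) := by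
  have hs : (Finset.univ.filter fun e : EdgeIdx n => ¬ v ∈ (e : Sym2 (Fin n))).card
      = n.choose 2 - (n - 1) := by
    have := Finset.card_filter_add_card_filter_not (s := (Finset.univ : Finset (EdgeIdx n)))
      (fun e => v ∈ (e : Sym2 (Fin n)))
    rw [card_star, Finset.card_univ, card_edge] at this
    omega
  have h := count_color' (fun e : EdgeIdx n => decide (v ∈ (e : Sym2 (Fin n))))
    (fun b => if b then k else m - k)
    (fun S b => if b then degree n S v else edgeCount n S - degree n S v)
    (fun b => if b then n - 1 else n.choose 2 - (n - 1))
    (by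
      rintro S (_ | _)
      · have := Finset.card_filter_add_card_filter_not
          (s := (Finset.univ.filter fun e : EdgeIdx n => S e = true))
          (fun e => v ∈ (e : Sym2 (Fin n)))
        rw [Finset.filter_filter, Finset.filter_filter] at this
        simp only [Bool.false_eq_true, if_false, degree, edgeCount, decide_eq_false_iff_not]
        rw [← this]
        simp only [Nat.add_sub_cancel_left]
      · simp only [if_true, degree, decide_eq_true_eq])
    (by
      rintro (_ | _)
      · simp only [Bool.false_eq_true, if_false, decide_eq_false_iff_not, ← hs]
      · simp only [if_true, decide_eq_true_eq, ← card_star n v])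
  simp only [Fintype.prod_bool, if_true, Bool.false_eq_true, if_false] at h
  rw [← h]
  congr 1
  ext S
  simp only [Finset.mem_filter, Finset.mem_univ, true_and, Bool.forall_bool, 
    if_true, Bool.false_eq_true, if_false]
  have : degree n S v ≤ edgeCount n S := by
    apply Finset.card_le_card
    intro e
    simp +contextual
  omega

lemma count_deg2_aux (n m j k x : ℕ) (v w : Fin n) (hvw : v ≠ w) (hk : j + k ≤ m)
    (hxj : x ≤ j) (hxk : x ≤ k) :
    (Finset.univ.filter fun S : EdgeIdx n → Bool =>
      (edgeCount n S = m ∧ degree n S v = j ∧ degree n S w = k) ∧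
      (Finset.univ.filter fun e : EdgeIdx n => S e = true ∧ v ∈ (e : Sym2 (Fin n)) ∧ w ∈ (e : Sym2 (Fin n))).card = x).card
      = Nat.choose 1 x * (n - 2).choose (j - x) * (n - 2).choose (k - x) *
        (n.choose 2 - (2 * n - 3)).choose (m + x - j - k) := by
  have h := count_color' (fun e : EdgeIdx n => (decide (v ∈ (e : Sym2 (Fin n))), decide (w ∈ (e : Sym2 (Fin n)))))
    (fun b => if b.1 then (if b.2 then x else j - x) else (if b.2 then k - x else m + x - j - k))
    (fun S b => if b.1 then (if b.2
      then (Finset.univ.filter fun e : EdgeIdx n => S e = true ∧ v ∈ (e : Sym2 (Fin n)) ∧ w ∈ (e : Sym2 (Fin n))).card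
      else (Finset.univ.filter fun e : EdgeIdx n => S e = true ∧ v ∈ (e : Sym2 (Fin n)) ∧ w ∉ (e : Sym2 (Fin n))).card)
      else (if b.2
      then (Finset.univ.filter fun e : EdgeIdx n => S e = true ∧ v ∉ (e : Sym2 (Fin n)) ∧ w ∈ (e : Sym2 (Fin n))).card
      else (Finset.univ.filter fun e : EdgeIdx n => S e = true ∧ v ∉ (e : Sym2 (Fin n)) ∧ w ∉ (e : Sym2 (Fin n))).card))
    (fun b => if b.1 then (if b.2
      then (Finset.univ.filter fun e : EdgeIdx n => v ∈ (e : Sym2 (Fin n)) ∧ w ∈ (e : Sym2 (Fin n))).card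
      else (Finset.univ.filter fun e : EdgeIdx n => v ∈ (e : Sym2 (Fin n)) ∧ w ∉ (e : Sym2 (Fin n))).card)
      else (if b.2
      then (Finset.univ.filter fun e : EdgeIdx n => v ∉ (e : Sym2 (Fin n)) ∧ w ∈ (e : Sym2 (Fin n))).card
      else (Finset.univ.filter fun e : EdgeIdx n => v ∉ (e : Sym2 (Fin n)) ∧ w ∉ (e : Sym2 (Fin n))).card))
    (by
      rintro S ⟨_ | _, _ | _⟩ <;>
      simp only [if_true, Bool.false_eq_true, if_false, decide_eq_false_iff_not, decide_eq_true_eq, Prod.mk.injEq])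
    (by
      rintro ⟨_ | _, _ | _⟩ <;>
      simp only [if_true, Bool.false_eq_true, if_false, decide_eq_false_iff_not, decide_eq_true_eq, Prod.mk.injEq])
  have split : ∀ (T : Finset (EdgeIdx n)),
      (T.filter fun e : EdgeIdx n => v ∈ (e : Sym2 (Fin n))).card =
        (T.filter fun e : EdgeIdx n => v ∈ (e : Sym2 (Fin n)) ∧ w ∈ (e : Sym2 (Fin n))).card +
        (T.filter fun e : EdgeIdx n => v ∈ (e : Sym2 (Fin n)) ∧ w ∉ (e : Sym2 (Fin n))).card ∧
      (T.filter fun e : EdgeIdx n => w ∈ (e : Sym2 (Fin n))).card =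
        (T.filter fun e : EdgeIdx n => v ∈ (e : Sym2 (Fin n)) ∧ w ∈ (e : Sym2 (Fin n))).card +
        (T.filter fun e : EdgeIdx n => v ∉ (e : Sym2 (Fin n)) ∧ w ∈ (e : Sym2 (Fin n))).card ∧
      T.card = (T.filter fun e : EdgeIdx n => v ∈ (e : Sym2 (Fin n))).card +
        (T.filter fun e : EdgeIdx n => v ∉ (e : Sym2 (Fin n)) ∧ w ∈ (e : Sym2 (Fin n))).card +
        (T.filter fun e : EdgeIdx n => v ∉ (e : Sym2 (Fin n)) ∧ w ∉ (e : Sym2 (Fin n))).card := by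
    intro T
    have h1 := Finset.card_filter_add_card_filter_not (s := T) (fun e : EdgeIdx n => v ∈ (e : Sym2 (Fin n)))
    have h2 := Finset.card_filter_add_card_filter_not
      (s := T.filter fun e : EdgeIdx n => v ∈ (e : Sym2 (Fin n))) (fun e : EdgeIdx n => w ∈ (e : Sym2 (Fin n)))
    have h3 := Finset.card_filter_add_card_filter_not
      (s := T.filter fun e : EdgeIdx n => v ∉ (e : Sym2 (Fin n))) (fun e : EdgeIdx n => w ∈ (e : Sym2 (Fin n)))
    have h4 := Finset.card_filter_add_card_filter_not
      (s := T.filter fun e : EdgeIdx n => w ∈ (e : Sym2 (Fin n))) (fun e : EdgeIdx n => v ∈ (e : Sym2 (Fin n)))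
    simp only [Finset.filter_filter] at h1 h2 h3 h4
    simp only [and_comm (a := w ∈ _)] at h4
    omega
  obtain ⟨u1, u2, u3⟩ := split Finset.univ
  rw [card_star, card_both n v w hvw] at u1 u2
  rw [card_star, Finset.card_univ, card_edge] at u3
  have hn : 2 ≤ n := by
    have := Fintype.one_lt_card_iff.2 ⟨v, w, hvw⟩
    simp at this
    omega
  have e1 : (Finset.univ.filter fun e : EdgeIdx n => v ∈ (e : Sym2 (Fin n)) ∧ w ∉ (e : Sym2 (Fin n))).card = n - 2 := by omega
  have e2 : (Finset.univ.filter fun e : EdgeIdx n => v ∉ (e : Sym2 (Fin n)) ∧ w ∈ (e : Sym2 (Fin n))).card = n - 2 := by omega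
  have e3 : (Finset.univ.filter fun e : EdgeIdx n => v ∉ (e : Sym2 (Fin n)) ∧ w ∉ (e : Sym2 (Fin n))).card = n.choose 2 - (2 * n - 3) := by omega
  simp only [Fintype.prod_prod_type, Fintype.prod_bool, Prod.mk.injEq, decide_eq_true_eq, decide_eq_false_iff_not,
    e1, e2, e3, card_both n v w hvw,
    if_true, Bool.false_eq_true, if_false, ← mul_assoc] at h
  rw [← h]
  congr 1
  ext S
  simp only [Finset.mem_filter, Finset.mem_univ, true_and, Prod.forall, Bool.forall_bool, Prod.mk.injEq, decide_eq_true_eq,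
    decide_eq_false_iff_not, if_true, Bool.false_eq_true, if_false]
  obtain ⟨w1, w2, w3⟩ := split (Finset.univ.filter fun e : EdgeIdx n => S e = true)
  simp only [Finset.filter_filter] at w1 w2 w3
  change degree n S v = _ at w1
  change degree n S w = _ at w2
  change edgeCount n S = degree n S v + _ + _ at w3
  omega

/-- number of graphs with two prescribed degrees -/
def cnt2 (n m j k : ℕ) : ℕ :=
  (n - 2).choose j * (n - 2).choose k * (n.choose 2 - (2 * n - 3)).choose (m - j - k) +
  (if 1 ≤ j ∧ 1 ≤ k then (n - 2).choose (j - 1) * (n - 2).choose (k - 1) *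
        (n.choose 2 - (2 * n - 3)).choose (m + 1 - j - k) else 0)

lemma count_deg2 (n m j k : ℕ) (v w : Fin n) (hvw : v ≠ w) (hk : j + k ≤ m) :
    (Finset.univ.filter fun S : EdgeIdx n → Bool =>
      (edgeCount n S = m ∧ degree n S v = j ∧ degree n S w = k)).card = cnt2 n m j k := by
  have le : ∀ S : EdgeIdx n → Bool, (Finset.univ.filter fun e : EdgeIdx n => S e = true ∧ v ∈ (e : Sym2 (Fin n)) ∧ w ∈ (e : Sym2 (Fin n))).card ≤ 1 := by
    intro S
    rw [← card_both n v w hvw]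
    apply Finset.card_le_card
    intro e
    simp
  have lev : ∀ S : EdgeIdx n → Bool, (Finset.univ.filter fun e : EdgeIdx n => S e = true ∧ v ∈ (e : Sym2 (Fin n)) ∧ w ∈ (e : Sym2 (Fin n))).card ≤ degree n S v := by
    intro S
    apply Finset.card_le_card
    intro e
    simp +contextual
  have lew : ∀ S : EdgeIdx n → Bool, (Finset.univ.filter fun e : EdgeIdx n => S e = true ∧ v ∈ (e : Sym2 (Fin n)) ∧ w ∈ (e : Sym2 (Fin n))).card ≤ degree n S w := by
    intro S
    apply Finset.card_le_card
    intro e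
    simp +contextual
  rw [← Finset.card_filter_add_card_filter_not (fun S : EdgeIdx n → Bool =>
    (Finset.univ.filter fun e : EdgeIdx n => S e = true ∧ v ∈ (e : Sym2 (Fin n)) ∧ w ∈ (e : Sym2 (Fin n))).card = 0),
    Finset.filter_filter, Finset.filter_filter, count_deg2_aux n m j k 0 v w hvw hk (by simp) (by simp)]
  unfold cnt2
  congr 1
  · simp
  · split_ifs with hjk
    · have := count_deg2_aux n m j k 1 v w hvw hk hjk.1 hjk.2
      simp only [Nat.choose_self, one_mul] at this
      rw [← this]
      congr 1
      ext S
      simp only [Finset.mem_filter, Finset.mem_univ, true_and]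
      have := le S
      omega
    · rw [Finset.card_eq_zero, Finset.filter_eq_empty_iff]
      rintro S - ⟨⟨h1, h2, h3⟩, h4⟩
      have := le S
      have := lev S
      have := lew S
      omega

lemma integral_gnm (n m : ℕ) (h : m ≤ n.choose 2) (f : (EdgeIdx n → Bool) → ℝ) :
    ∫ S, f S ∂(gnmMeasure n m) =
      (∑ S ∈ Finset.univ.filter (fun S : EdgeIdx n → Bool => edgeCount n S = m), f S) /
        ((n.choose 2).choose m : ℝ) := by
  unfold gnmMeasure
  rw [integral_finsetSum_measure, Finset.sum_div, Finset.sum_filter]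
  · refine Finset.sum_congr rfl fun S _ => ?_
    rw [integral_smul_measure, integral_dirac, count_edge]
    split_ifs
    · simp [div_eq_inv_mul]
    · simp
  · intro S _
    apply Integrable.smul_measure
    · exact integrable_dirac (by simp)
    · split_ifs
      · rw [count_edge]
        have : 0 < (n.choose 2).choose m := Nat.choose_pos h
        simp
        omega
      · simp

def pk (n m k : ℕ) : ℝ := ((n - 1).choose k * (n.choose 2 - (n - 1)).choose (m - k) : ℕ) /
        ((n.choose 2).choose m : ℝ)

def pjk (n m j k : ℕ) : ℝ := (cnt2 n m j k : ℝ) / ((n.choose 2).choose m : ℝ)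

lemma ite_mul_ite_one (p q : Prop) [Decidable p] [Decidable q] :
    (if p then (1 : ℝ) else 0) * (if q then (1 : ℝ) else 0) = if p ∧ q then 1 else 0 := by
  by_cases p <;> by_cases q <;> simp [*]

lemma degCount_eq (n k : ℕ) (S : EdgeIdx n → Bool) :
    (degCount n k S : ℝ) = ∑ v : Fin n, if degree n S v = k then 1 else 0 := by
  simp [degCount]

lemma mean_eq (n m k : ℕ) (h : m ≤ n.choose 2) (hk : k ≤ m) :
    ∫ S, (degCount n k S : ℝ) ∂(gnmMeasure n m) = n * pk n m k := by
  rw [integral_gnm n m h]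
  simp_rw [degCount_eq]
  rw [Finset.sum_comm]
  have : ∀ v : Fin n, (∑ S ∈ Finset.univ.filter (fun S : EdgeIdx n → Bool => edgeCount n S = m),
      if degree n S v = k then (1 : ℝ) else 0) = ((n - 1).choose k * (n.choose 2 - (n - 1)).choose (m - k) : ℕ) := by
    intro v
    rw [← Finset.sum_filter, Finset.filter_filter, Finset.sum_const, count_deg n m k v hk]
    simp
  simp_rw [this]
  simp [pk, mul_div_assoc]

lemma mean_sub_eq (n m k : ℕ) (c : ℝ) (h : m ≤ n.choose 2) (hk : k ≤ m) :
    ∫ S, ((degCount n k S : ℝ) - c) ∂(gnmMeasure n m) = n * pk n m k - c := by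
  rw [← mean_eq n m k h hk, integral_gnm n m h, integral_gnm n m h, Finset.sum_sub_distrib,
    sub_div, Finset.sum_const, count_edge]
  have : (0 : ℝ) < (n.choose 2).choose m := by exact_mod_cast Nat.choose_pos h
  simp
  field_simp

lemma cov_eq (n m j k : ℕ) (h : m ≤ n.choose 2) (hk : j + k ≤ m) :
    covFn (gnmMeasure n m) (fun S => (degCount n j S : ℝ)) (fun S => (degCount n k S : ℝ)) =
      n * (pk n m k * if j = k then 1 else 0) + n * (n - 1) * pjk n m j k
        - n * pk n m j * (n * pk n m k) := by
  unfold covFn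
  rw [mean_eq n m j h (by omega), mean_eq n m k h (by omega)]
  congr 1
  rw [integral_gnm n m h]
  simp_rw [degCount_eq, Finset.sum_mul_sum]
  rw [Finset.sum_comm]
  have : ∀ v : Fin n, (∑ S ∈ Finset.univ.filter (fun S : EdgeIdx n → Bool => edgeCount n S = m),
      ∑ w : Fin n, (if degree n S v = j then (1 : ℝ) else 0) * (if degree n S w = k then (1 : ℝ) else 0))
       = ((if j = k then 1 else 0) * ((n - 1).choose k * (n.choose 2 - (n - 1)).choose (m - k) : ℕ) + (n - 1) * cnt2 n m j k) := by
    intro v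
    rw [Finset.sum_comm, ← Finset.add_sum_erase _ _ (Finset.mem_univ v)]
    congr 1
    · simp_rw [ite_mul_ite_one, ← Finset.sum_filter, Finset.filter_filter]
      rw [Finset.sum_const]
      split_ifs with hjk
      · subst hjk
        simp only [and_self]
        rw [count_deg n m j v (by omega)]
        simp
      · rw [Finset.card_eq_zero.2]
        · simp
        · rw [Finset.filter_eq_empty_iff]
          rintro S - ⟨h1, h2, h3⟩
          omega
    · rw [Finset.sum_congr rfl (g := fun _ => (cnt2 n m j k : ℝ))]
      · have : 1 ≤ n := by have := v.2; omega
        simp [Nat.cast_sub this]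
      · intro w hw
        simp_rw [ite_mul_ite_one, ← Finset.sum_filter, Finset.filter_filter]
        rw [Finset.sum_const, count_deg2 n m j k v w (by simp at hw; exact fun h => hw h.symm) hk]
        simp
  simp_rw [this]
  simp only [Finset.sum_const, Finset.card_univ, Fintype.card_fin, nsmul_eq_mul, pk, pjk]
  ring
/-- `f = 1 + c / r + o(1 / r)` -/
def AsymOne (r f : ℕ → ℝ) (c : ℝ) : Prop :=
  Tendsto (fun n => r n * (f n - 1)) atTop (𝓝 c)

lemma AsymOne.tendsto {r f : ℕ → ℝ} {c : ℝ} (hr : Tendsto r atTop atTop) (h : AsymOne r f c) :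
    Tendsto f atTop (𝓝 1) := by
  have h1 := (h.mul hr.inv_tendsto_atTop).add_const 1
  simp only [mul_zero, zero_add] at h1
  refine h1.congr' ?_
  filter_upwards [hr.eventually_gt_atTop 0] with n hn
  simp only [Pi.inv_apply]
  field_simp
  ring

lemma AsymOne.mul {r f g : ℕ → ℝ} {c d : ℝ} (hr : Tendsto r atTop atTop) (h : AsymOne r f c)
    (h' : AsymOne r g d) : AsymOne r (fun n => f n * g n) (c + d) := by
  have h1 := (Tendsto.mul h (h'.tendsto hr)).add h'
  rw [mul_one] at h1
  refine h1.congr fun n => ?_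
  ring

lemma AsymOne.one {r : ℕ → ℝ} : AsymOne r (fun _ => 1) 0 := by
  simp [AsymOne]

lemma AsymOne.prod {r : ℕ → ℝ} {f : ℕ → ℕ → ℝ} {c : ℝ} (hr : Tendsto r atTop atTop) (k : ℕ)
    (h : ∀ i, AsymOne r (fun n => f n i) c) :
    AsymOne r (fun n => ∏ i ∈ Finset.range k, f n i) (k * c) := by
  induction k with
  | zero => simpa using AsymOne.one
  | succ k ih =>
    simp_rw [Finset.prod_range_succ]
    have := ih.mul hr (h k)
    convert this using 1
    push_cast
    ring

lemma prod_bound (ε : ℕ → ℝ) (e : ℝ) (h0 : 0 ≤ e) (N : ℕ) (he : ∀ i < N, |ε i| ≤ e)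
    (hN : N * e ≤ 1) :
    |∏ i ∈ Finset.range N, (1 + ε i) - 1 - ∑ i ∈ Finset.range N, ε i| ≤ (N * e) ^ 2 := by
  induction N with
  | zero => simp
  | succ N ih =>
    push_cast at hN ⊢
    have ih' := ih (fun i hi => he i (by omega)) (by linarith)
    rw [Finset.prod_range_succ, Finset.sum_range_succ]
    have hs : |∑ i ∈ Finset.range N, ε i| ≤ N * e := by
      refine (Finset.abs_sum_le_sum_abs _ _).trans ?_
      have := Finset.sum_le_sum (s := Finset.range N) (f := fun i => |ε i|) (g := fun _ => e)
        (fun i hi => he i (by simp at hi; omega))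
      simpa using this
    set P := ∏ i ∈ Finset.range N, (1 + ε i)
    set T := ∑ i ∈ Finset.range N, ε i
    have hNe : 0 ≤ N * e := by positivity
    have hP : |P - 1| ≤ 2 * (N * e) := by
      have : P - 1 = (P - 1 - T) + T := by ring
      rw [this]
      refine (abs_add_le _ _).trans ?_
      nlinarith
    have hEN := he N (by omega)
    have : P * (1 + ε N) - 1 - (T + ε N) = (P - 1 - T) + ε N * (P - 1) := by ring
    rw [this]
    refine (abs_add_le _ _).trans ?_
    rw [abs_mul]
    have : |ε N| * |P - 1| ≤ e * (2 * (N * e)) :=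
      mul_le_mul hEN hP (abs_nonneg _) h0
    nlinarith

lemma AsymOne.bigprod {r : ℕ → ℝ} (hr : Tendsto r atTop atTop) (ε : ℕ → ℕ → ℝ) (c : ℝ)
    (N : ℕ → ℕ) (hN : ∀ n, N n ≤ n) (hN' : Tendsto (fun n => (N n : ℝ) / n) atTop (𝓝 1))
    (h : ∀ s : ℕ → ℕ, (∀ n, s n ≤ n) → Tendsto (fun n => r n * n * ε n (s n)) atTop (𝓝 c)) :
    AsymOne r (fun n => ∏ i ∈ Finset.range (N n), (1 + ε n i)) c := by
  have hex : ∀ n : ℕ, ∃ s ≤ n, ∀ i ≤ n, |r n * n * ε n i - c| ≤ |r n * n * ε n s - c| := by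
    intro n
    obtain ⟨s, hs, hs'⟩ := Finset.exists_max_image (Finset.range (n + 1))
      (fun i => |r n * n * ε n i - c|) ⟨0, by simp⟩
    refine ⟨s, by simp at hs; omega, fun i hi => hs' i (by simp; omega)⟩
  choose s hs hmax using hex
  set δ : ℕ → ℝ := fun n => |r n * n * ε n (s n) - c| with hδ
  have hδ0 : Tendsto δ atTop (𝓝 0) := by
    have := ((h s hs).sub_const c).abs
    simpa using this
  have hbd : Tendsto (fun n => (|c| + δ n) ^ 2 * (r n)⁻¹ + δ n) atTop (𝓝 0) := by
    have := (((hδ0.const_add |c|).pow 2).mul hr.inv_tendsto_atTop).add hδ0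
    simpa using this
  have hbd1 : Tendsto (fun n => (|c| + δ n) * (r n)⁻¹) atTop (𝓝 0) := by
    have := ((hδ0.const_add |c|).mul hr.inv_tendsto_atTop)
    simpa using this
  have hmain : Tendsto (fun n => r n * (∏ i ∈ Finset.range (N n), (1 + ε n i) - 1) - (N n : ℝ) / n * c)
      atTop (𝓝 0) := by
    refine squeeze_zero_norm' ?_ hbd
    filter_upwards [hr.eventually_gt_atTop 0, eventually_gt_atTop 0,
      hbd1.eventually (gt_mem_nhds zero_lt_one)] with n hrn hn hlt
    have hn' : (0 : ℝ) < n := by exact_mod_cast hn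
    have hδn : 0 ≤ δ n := abs_nonneg _
    have hcδ : 0 ≤ |c| + δ n := by positivity
    have hNn : (N n : ℝ) ≤ n := by exact_mod_cast hN n
    have hi : ∀ i < N n, |ε n i| ≤ (|c| + δ n) / (r n * n) := by
      intro i hi
      have h1 := hmax n i (by have := hN n; omega)
      rw [le_div_iff₀ (by positivity)]
      have : |ε n i| * (r n * n) = |(r n * n * ε n i - c) + c| := by
        rw [sub_add_cancel, abs_mul, abs_of_pos (show 0 < r n * n by positivity)]
        ring
      rw [this]
      refine (abs_add_le _ _).trans ?_
      have : |r n * n * ε n i - c| ≤ δ n := h1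
      linarith
    have hNe : N n * ((|c| + δ n) / (r n * n)) ≤ (|c| + δ n) * (r n)⁻¹ := by
      have : n * ((|c| + δ n) / (r n * n)) = (|c| + δ n) * (r n)⁻¹ := by field_simp
      rw [← this]
      gcongr
    have hp := prod_bound (ε n) _ (by positivity) (N n) hi (by linarith)
    have hp2 := hp.trans (pow_le_pow_left₀ (by positivity) hNe 2)
    rw [Real.norm_eq_abs]
    have e1 : r n * (∏ i ∈ Finset.range (N n), (1 + ε n i) - 1) - (N n : ℝ) / n * c =
        r n * (∏ i ∈ Finset.range (N n), (1 + ε n i) - 1 - ∑ i ∈ Finset.range (N n), ε n i) +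
        (∑ i ∈ Finset.range (N n), (r n * n * ε n i - c)) / n := by
      rw [Finset.sum_sub_distrib, ← Finset.mul_sum, Finset.sum_const, Finset.card_range, nsmul_eq_mul]
      field_simp
      ring
    rw [e1]
    refine (abs_add_le _ _).trans (add_le_add ?_ ?_)
    · rw [abs_mul, abs_of_pos hrn]
      calc _ ≤ r n * ((|c| + δ n) * (r n)⁻¹) ^ 2 := by gcongr
        _ = _ := by field_simp
    · rw [abs_div, abs_of_pos hn', div_le_iff₀ hn']
      refine (Finset.abs_sum_le_sum_abs _ _).trans ?_
      have := Finset.sum_le_sum (s := Finset.range (N n)) (f := fun i => |r n * n * ε n i - c|)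
        (g := fun _ => δ n) (fun i hi => hmax n i (by have := hN n; simp at hi; omega))
      refine this.trans ?_
      simp only [Finset.sum_const, Finset.card_range, nsmul_eq_mul]
      rw [mul_comm]
      gcongr
  have := hmain.add (hN'.mul_const c)
  simpa [AsymOne] using this

/-- real falling factorial -/
def FF (x : ℝ) (a : ℕ) : ℝ := ∏ i ∈ Finset.range a, (x - i)

lemma FF_add (x : ℝ) (a b : ℕ) : FF x (a + b) = FF x a * FF (x - a) b := by
  unfold FF
  rw [Finset.prod_range_add]
  congr 1
  refine Finset.prod_congr rfl fun i _ => ?_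
  push_cast
  ring

lemma FF_pos {x : ℝ} {a : ℕ} (h : (a : ℝ) < x + 1) : 0 < FF x a := by
  unfold FF
  refine Finset.prod_pos fun i hi => ?_
  have : ((i + 1 : ℕ) : ℝ) ≤ a := by exact_mod_cast Finset.mem_range.1 hi
  push_cast at this
  linarith

lemma FF_nat (M a : ℕ) (h : a ≤ M) : (M.descFactorial a : ℝ) = FF M a := by
  rw [Nat.descFactorial_eq_prod_range, FF]
  push_cast
  refine Finset.prod_congr rfl fun i hi => ?_
  rw [Nat.cast_sub]
  have := Finset.mem_range.1 hi
  omega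

lemma choose_ratio (M a m j : ℕ) (h1 : j ≤ m) (h2 : j ≤ a) (h3 : m + a ≤ M) :
    ((M - a).choose (m - j) : ℝ) * FF M a = M.choose m * FF m j * FF ((M : ℝ) - m) (a - j) := by
  rw [← Nat.cast_sub (by omega), ← FF_nat _ _ (by omega), ← FF_nat _ _ h1, ← FF_nat _ _ (by omega)]
  norm_cast
  have e1 := Nat.choose_mul_factorial_mul_factorial (n := M - a) (k := m - j) (by omega)
  have e2 := Nat.choose_mul_factorial_mul_factorial (n := M) (k := m) (by omega)
  have e3 := Nat.factorial_mul_descFactorial (n := M) (k := a) (by omega)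
  have e4 := Nat.factorial_mul_descFactorial h1
  have e5 := Nat.factorial_mul_descFactorial (n := M - m) (k := a - j) (by omega)
  have e6 : M - a - (m - j) = M - m - (a - j) := by omega
  rw [e6] at e1
  have p1 := Nat.factorial_pos (m - j)
  have p2 := Nat.factorial_pos (M - m - (a - j))
  apply Nat.eq_of_mul_eq_mul_left (Nat.mul_pos p1 p2)
  calc _ = ((M - a).choose (m - j) * (m - j).factorial * (M - m - (a - j)).factorial) * M.descFactorial a := by ring
    _ = M.choose m * m.factorial * (M - m).factorial := by rw [e1, e3, e2]
    _ = _ := by rw [← e4, ← e5]; ring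

lemma choose_FF (a k : ℕ) (h : k ≤ a) : (a.choose k : ℝ) = FF a k / k.factorial := by
  rw [← FF_nat a k h, Nat.descFactorial_eq_factorial_mul_choose]
  push_cast
  field_simp

lemma cnt2_eq (n m j k : ℕ) (h1 : j + k ≤ m) (h2 : j + k + 3 ≤ n) (h3 : m + 2 * n ≤ n.choose 2) :
    (cnt2 n m j k : ℝ) = ((n - 2).choose j * (n - 2).choose k * (n.choose 2 - (2 * n - 3)).choose (m - j - k) : ℕ) *
      (1 + j * k * ((n.choose 2 : ℝ) - (2 * n - 3) - m + j + k) / ((n - 1 - j) * (n - 1 - k) * (m - j - k + 1))) := by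
  unfold cnt2
  rcases j with _ | j
  · simp
  rcases k with _ | k
  · simp
  simp only [le_add_iff_nonneg_left, zero_le, and_self, if_true, Nat.add_sub_cancel]
  have e1 := Nat.choose_succ_right_eq (n - 2) j
  have e2 := Nat.choose_succ_right_eq (n - 2) k
  have e3 := Nat.choose_succ_right_eq (n.choose 2 - (2 * n - 3)) (m - (j + 1) - (k + 1))
  have e4 : m - (j + 1) - (k + 1) + 1 = m + 1 - (j + 1) - (k + 1) := by omega
  rw [e4] at e3
  have c1 : ((n - 2 - j : ℕ) : ℝ) = n - 1 - (j + 1) := by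
    rw [Nat.cast_sub (by omega), Nat.cast_sub (by omega)]; push_cast; ring
  have c2 : ((n - 2 - k : ℕ) : ℝ) = n - 1 - (k + 1) := by
    rw [Nat.cast_sub (by omega), Nat.cast_sub (by omega)]; push_cast; ring
  have c3 : ((m + 1 - (j + 1) - (k + 1) : ℕ) : ℝ) = m - (j + 1) - (k + 1) + 1 := by
    rw [Nat.cast_sub (by omega), Nat.cast_sub (by omega)]; push_cast; ring
  have c4 : ((n.choose 2 - (2 * n - 3) - (m - (j + 1) - (k + 1)) : ℕ) : ℝ) =
      (n.choose 2 : ℝ) - (2 * n - 3) - m + (j + 1) + (k + 1) := by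
    rw [Nat.cast_sub (by omega), Nat.cast_sub (by omega), Nat.cast_sub (by omega), Nat.cast_sub (by omega), Nat.cast_sub (by omega)]; push_cast; ring
  have p1 : (0 : ℝ) < n - 1 - (j + 1) := by rw [← c1]; exact_mod_cast (by omega)
  have p2 : (0 : ℝ) < n - 1 - (k + 1) := by rw [← c2]; exact_mod_cast (by omega)
  have p3 : (0 : ℝ) < m - (j + 1) - (k + 1) + 1 := by rw [← c3]; exact_mod_cast (by omega)
  have f1 : ((n - 2).choose j : ℝ) = (n - 2).choose (j + 1) * (j + 1) / (n - 1 - (j + 1)) := by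
    rw [eq_div_iff p1.ne', ← c1]; exact_mod_cast e1.symm
  have f2 : ((n - 2).choose k : ℝ) = (n - 2).choose (k + 1) * (k + 1) / (n - 1 - (k + 1)) := by
    rw [eq_div_iff p2.ne', ← c2]; exact_mod_cast e2.symm
  have f3 : ((n.choose 2 - (2 * n - 3)).choose (m + 1 - (j + 1) - (k + 1)) : ℝ) =
     (n.choose 2 - (2 * n - 3)).choose (m - (j + 1) - (k + 1)) * ((n.choose 2 : ℝ) - (2 * n - 3) - m + (j + 1) + (k + 1)) / (m - (j + 1) - (k + 1) + 1) := by
    rw [eq_div_iff p3.ne', ← c3, ← c4]; exact_mod_cast e3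
  have e5 : m + 1 - (j + 1) - (k + 1) = m - j - (k + 1) := by omega
  rw [e5] at f3
  simp only [Nat.add_sub_add_right]
  push_cast
  rw [f1, f2, f3]
  field_simp
lemma FF_succ (x : ℝ) (a : ℕ) : FF x (a + 1) = FF x a * (x - a) := by
  unfold FF
  rw [Finset.prod_range_succ]

lemma pk_eq (n m k : ℕ) (h1 : k ≤ m) (h2 : k + 3 ≤ n) (h3 : m + 2 * n ≤ n.choose 2) :
    pk n m k = (n - 1).choose k * FF m k * FF ((n.choose 2 : ℝ) - m) (n - 1 - k) / FF (n.choose 2) (n - 1) := by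
  have h := choose_ratio (n.choose 2) (n - 1) m k h1 (by omega) (by omega)
  have p1 : 0 < FF (n.choose 2) (n - 1) := by
    apply FF_pos
    exact_mod_cast (by omega)
  have p2 : (0 : ℝ) < (n.choose 2).choose m := by
    exact_mod_cast Nat.choose_pos (by omega)
  unfold pk
  rw [div_eq_div_iff p2.ne' p1.ne']
  push_cast
  linear_combination ((n - 1).choose k : ℝ) * h

lemma pjk_eq (n m j k : ℕ) (h1 : j + k ≤ m) (h2 : j + k + 3 ≤ n) (h3 : m + 2 * n ≤ n.choose 2) :
    pjk n m j k = (n - 2).choose j * (n - 2).choose k * FF m (j + k) *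
      FF ((n.choose 2 : ℝ) - m) (2 * n - 3 - (j + k)) / FF (n.choose 2) (2 * n - 3) *
      (1 + j * k * ((n.choose 2 : ℝ) - (2 * n - 3) - m + j + k) / ((n - 1 - j) * (n - 1 - k) * (m - j - k + 1))) := by
  have h := choose_ratio (n.choose 2) (2 * n - 3) m (j + k) h1 (by omega) (by omega)
  have p1 : 0 < FF (n.choose 2) (2 * n - 3) := by
    apply FF_pos
    exact_mod_cast (by omega)
  have p2 : (0 : ℝ) < (n.choose 2).choose m := by
    exact_mod_cast Nat.choose_pos (by omega)
  unfold pjk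
  rw [cnt2_eq n m j k h1 h2 h3, mul_div_right_comm]
  congr 1
  rw [div_eq_div_iff p2.ne' p1.ne', Nat.sub_sub m j k]
  push_cast
  linear_combination ((n - 2).choose j * (n - 2).choose k : ℝ) * h

lemma mean_ratio (n m k : ℕ) (M : ℝ) (hM : M = n * (n - 1) / 2) (h0 : 0 < m) (h1 : k ≤ m) (h2 : k + 3 ≤ n)
    (h3 : m + 2 * n ≤ n.choose 2) :
    pk n m k = poissonProb (2 * (m : ℝ) / n) k *
      ((∏ i ∈ Finset.range k, (((n : ℝ) - 1 - i) / (n - 1) * ((m - i) / m) * (M / (M - (n - 1) + k - i)))) *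
      ((∏ i ∈ Finset.range (n - 1 - k), (1 + ((1 - m / (M - i)) * Real.exp (2 * (m : ℝ) / n / n) - 1))) *
      Real.exp (2 * (m : ℝ) / n * (k + 1) / n))) := by
  have hMc : ((n.choose 2 : ℕ) : ℝ) = M := by rw [hM, Nat.cast_choose_two]
  rw [pk_eq n m k h1 h2 h3, hMc, choose_FF _ _ (by omega)]
  have h3r : (m : ℝ) + 2 * n ≤ M := by rw [← hMc]; exact_mod_cast h3
  obtain ⟨d, rfl⟩ : ∃ d, n = d + k + 1 := ⟨n - 1 - k, by omega⟩
  have s1 : d + k + 1 - 1 = d + k := by omega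
  have s2 : d + k - k = d := by omega
  rw [s1, s2, FF_add]
  have hm : (0 : ℝ) < m := by exact_mod_cast h0
  have hk : (k : ℝ) ≤ m := by exact_mod_cast h1
  have hd : (2 : ℝ) ≤ d := by exact_mod_cast (by omega)
  have hk0 : (0 : ℝ) ≤ k := by positivity
  push_cast at h3r hM ⊢
  have q1 : (∏ i ∈ Finset.range k, (((d : ℝ) + k + 1 - 1 - i) / (d + k + 1 - 1) * ((m - i) / m) * (M / (M - (d + k + 1 - 1) + k - i)))) = FF (d + k) k / (d + k) ^ k * (FF m k / m ^ k) * (M ^ k / FF (M - d) k) := by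
    rw [Finset.prod_mul_distrib, Finset.prod_mul_distrib, Finset.prod_div_distrib, Finset.prod_div_distrib, Finset.prod_div_distrib]
    simp only [Finset.prod_const, Finset.card_range, FF]
    congr 2
    · congr 1
      · exact Finset.prod_congr rfl fun i _ => by ring
      · ring
    · exact Finset.prod_congr rfl fun i _ => by ring
  have q2 : (∏ i ∈ Finset.range d, (1 + ((1 - m / (M - i)) * Real.exp (2 * (m : ℝ) / (d + k + 1) / (d + k + 1)) - 1))) =
      FF (M - m) d / FF M d * Real.exp (2 * (m : ℝ) / (d + k + 1) / (d + k + 1)) ^ d := by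
    have : ∀ i ∈ Finset.range d, (1 + ((1 - m / (M - i)) * Real.exp (2 * (m : ℝ) / (d + k + 1) / (d + k + 1)) - 1)) =
      ((M - m - i) / (M - i)) * Real.exp (2 * (m : ℝ) / (d + k + 1) / (d + k + 1)) := by
      intro i hi
      have : (i : ℝ) ≤ d := by exact_mod_cast (Finset.mem_range.1 hi).le
      have : M - i ≠ 0 := by apply ne_of_gt; linarith
      field_simp
      ring
    rw [Finset.prod_congr rfl this, Finset.prod_mul_distrib, Finset.prod_div_distrib, Finset.prod_const, Finset.card_range]
    rfl
  rw [q1, q2, ← Real.exp_nat_mul, poissonProb]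
  have p1 : FF M d ≠ 0 := (FF_pos (by linarith)).ne'
  have p2 : FF (M - d) k ≠ 0 := (FF_pos (by linarith)).ne'
  have hexp : Real.exp (-(2 * (m : ℝ) / (d + k + 1))) * (Real.exp (d * (2 * m / (d + k + 1) / (d + k + 1))) * Real.exp (2 * m / (d + k + 1) * (k + 1) / (d + k + 1))) = 1 := by
    rw [← Real.exp_add, ← Real.exp_add, Real.exp_eq_one_iff]
    field_simp
    ring
  have hpow : (2 * (m : ℝ) / (d + k + 1)) ^ k = (d + k) ^ k * m ^ k / M ^ k := by
    rw [← mul_pow, ← div_pow]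
    congr 1
    rw [hM, add_sub_cancel_right]
    have : (d : ℝ) + k ≠ 0 := by positivity
    field_simp
  have hM0 : M ≠ 0 := by apply ne_of_gt; linarith
  have hdk : (d : ℝ) + k ≠ 0 := by positivity
  rw [hpow]
  calc _ = FF (d + k) k * FF m k * FF (M - m) d / (k.factorial * FF M d * FF (M - d) k) * 1 := by field_simp
    _ = _ := by
      generalize Real.exp (-(2 * (m : ℝ) / (d + k + 1))) = E1 at hexp ⊢
      generalize Real.exp (d * (2 * (m : ℝ) / (d + k + 1) / (d + k + 1))) = E2 at hexp ⊢
      generalize Real.exp (2 * (m : ℝ) / (d + k + 1) * (k + 1) / (d + k + 1)) = E3 at hexp ⊢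
      rw [← hexp]
      field_simp

set_option maxHeartbeats 1000000 in
lemma pair_ratio (n m j k : ℕ) (M : ℝ) (hM : M = n * (n - 1) / 2) (h1 : j + k ≤ m) (h2 : j + k + 3 ≤ n)
    (h3 : m + 2 * n ≤ n.choose 2) :
    pjk n m j k = pk n m j * pk n m k *
      ((1 - j / ((n : ℝ) - 1)) * ((1 - k / ((n : ℝ) - 1)) *
      ((∏ i ∈ Finset.range k, ((m - j - i : ℝ) / (m - i))) *
      ((M - n + 2) / (M - m - n + 2 + k) *
      ((∏ i ∈ Finset.range (n - 2 - k), (1 + (j * (M - i) - (n - 1) * m) / ((M - i - m) * (M - i - (n - 1))))) *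
      ((∏ i ∈ Finset.range k, ((M - (n - 2 - k + i)) / (M - (n - 1) - (n - 2 - k + i)))) *
      (1 + j * k * (M - (2 * n - 3) - m + j + k) / ((n - 1 - j) * (n - 1 - k) * (m - j - k + 1)))))))))  := by
  have hMc : ((n.choose 2 : ℕ) : ℝ) = M := by rw [hM, Nat.cast_choose_two]
  rw [pjk_eq n m j k h1 h2 h3, pk_eq n m j (by omega) (by omega) h3, pk_eq n m k (by omega) (by omega) h3, hMc]
  have h3r : (m : ℝ) + 2 * n ≤ M := by rw [← hMc]; exact_mod_cast h3
  obtain ⟨d, rfl⟩ : ∃ d, n = d + k + 2 := ⟨n - 2 - k, by omega⟩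
  have cj := Nat.choose_mul_succ_eq (d + k) j
  have ck := Nat.choose_mul_succ_eq (d + k) k
  have hm : (j : ℝ) + k ≤ m := by exact_mod_cast h1
  have hjd : (j : ℝ) + 1 ≤ d := by exact_mod_cast (by omega)
  have hk0 : (0 : ℝ) ≤ k := by positivity
  have hj0 : (0 : ℝ) ≤ j := by positivity
  have s1 : 2 * (d + k + 2) - 3 - (j + k) = (d + k + 1 - j) + d := by omega
  have s2 : 2 * (d + k + 2) - 3 = (d + k + 1) + (d + k) := by omega
  have s3 : d + k + 2 - 1 = d + k + 1 := by omega
  have s4 : d + k + 2 - 2 = d + k := by omega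
  have s5 : d + k + 1 - k = d + 1 := by omega
  have s6 : d + k - k = d := by omega
  rw [s1, s2, s3, s4, s5, s6]
  rw [FF_add M (d + k + 1) (d + k), FF_add _ d k]
  have k1 : FF M (d + k + 1) = FF M d * FF (M - d) k * (M - (d + k : ℕ)) := by rw [FF_succ, FF_add]
  rw [FF_add (M - m), FF_add (m : ℝ) j k, FF_succ (M - m) d]
  have c1 : ((d + k + 1 - j : ℕ) : ℝ) = d + k + 1 - j := by
    rw [Nat.cast_sub (by omega)]; push_cast; ring
  have cj' : ((d + k).choose j : ℝ) = (d + k + 1).choose j * (1 - j / (d + k + 1)) := by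
    have : (((d + k).choose j * (d + k + 1) : ℕ) : ℝ) = ((d + k + 1).choose j * (d + k + 1 - j) : ℕ) := by rw [cj]
    rw [Nat.cast_mul, Nat.cast_mul, c1] at this
    push_cast at this
    field_simp
    linear_combination this
  have ck' : ((d + k).choose k : ℝ) = (d + k + 1).choose k * (1 - k / (d + k + 1)) := by
    have : (((d + k).choose k * (d + k + 1) : ℕ) : ℝ) = ((d + k + 1).choose k * (d + k + 1 - k) : ℕ) := by rw [ck]
    rw [Nat.cast_mul, Nat.cast_mul, s5] at this
    push_cast at this
    field_simp
    linear_combination this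
  rw [c1, cj', ck']
  have e1 : (∏ i ∈ Finset.range k, ((m - j - i : ℝ) / (m - i))) = FF (m - j) k / FF m k := by
    rw [Finset.prod_div_distrib]; rfl
  push_cast at h3r hM k1 ⊢
  have e2 : (∏ i ∈ Finset.range d, (1 + (j * (M - i) - ((d + k + 2 : ℝ) - 1) * m) / ((M - i - m) * (M - i - (d + k + 2 - 1))))) =
     (FF (M - m - (d + k + 1 - j)) d / FF (M - m) d) * (FF M d / FF (M - (d + k + 1)) d) := by
    unfold FF
    rw [← Finset.prod_div_distrib, ← Finset.prod_div_distrib, ← Finset.prod_mul_distrib]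
    refine Finset.prod_congr rfl fun i hi => ?_
    have : (i : ℝ) ≤ d := by exact_mod_cast (Finset.mem_range.1 hi).le
    have t1 : M - i - m ≠ 0 := by apply ne_of_gt; linarith
    have t2 : M - i - (d + k + 2 - 1) ≠ 0 := by apply ne_of_gt; linarith
    have t3 : M - m - i ≠ 0 := by apply ne_of_gt; linarith
    have t4 : M - (d + k + 1) - i ≠ 0 := by apply ne_of_gt; linarith
    rw [eq_comm, div_mul_div_comm, div_eq_iff (mul_ne_zero t3 t4), show M - m - (i : ℝ) = M - i - m by ring, show M - (d + k + 1) - (i : ℝ) = M - i - (d + k + 2 - 1) by ring]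
    field_simp
    ring
  have e3 : (∏ i ∈ Finset.range k, ((M - ((d + k + 2 : ℝ) - 2 - k + i)) / (M - (d + k + 2 - 1) - (d + k + 2 - 2 - k + i)))) = FF (M - d) k / FF (M - (d + k + 1) - d) k := by
    unfold FF
    rw [← Finset.prod_div_distrib]
    refine Finset.prod_congr rfl fun i hi => ?_
    congr 1 <;> ring
  rw [e1, e2, e3, k1]
  have p1 : FF M d ≠ 0 := (FF_pos (by linarith)).ne'
  have p2 : FF (M - d) k ≠ 0 := (FF_pos (by linarith)).ne'
  have p3 : FF (M - m) d ≠ 0 := (FF_pos (by linarith)).ne'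
  have p4 : FF (M - (d + k + 1)) d ≠ 0 := (FF_pos (by linarith)).ne'
  have p5 : FF (M - (d + k + 1) - d) k ≠ 0 := (FF_pos (by linarith)).ne'
  have p6 : FF m k ≠ 0 := (FF_pos (by linarith)).ne'
  have p7 : M - (d + k) ≠ 0 := by apply ne_of_gt; linarith
  have p8 : M - m - d ≠ 0 := by apply ne_of_gt; linarith
  rw [show M - m - ((d : ℝ) + k + 2) + 2 + k = M - m - d by ring, show M - ((d : ℝ) + k + 2) + 2 = M - (d + k) by ring,
    show (d : ℝ) + k + 2 - 1 = d + k + 1 by ring]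
  generalize (1 + (j : ℝ) * k * _ / _) = G
  generalize (1 - (j : ℝ) / _) = G1
  generalize (1 - (k : ℝ) / _) = G2
  generalize FF M d = x1 at *
  generalize FF (M - d) k = x2 at *
  generalize FF (M - m) d = x3 at *
  generalize FF (M - (d + k + 1)) d = x4 at *
  generalize FF (M - (d + k + 1) - d) k = x5 at *
  generalize FF m k = x6 at *
  generalize FF m j = x7 at *
  generalize FF (m - j) k = x8 at *
  generalize FF (M - m) _ = x9 at *
  generalize FF (M - m - _) _ = y9 at *
  generalize M - (d + k : ℝ) = x10 at *
  generalize M - m - (d : ℝ) = x11 at *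
  clear * - p1 p2 p3 p4 p5 p6 p7 p8
  field_simp
section limits

lemma ratlim {u x t : ℕ → ℝ} {l : ℝ} (hu : Tendsto u atTop (𝓝 0)) (hx : Tendsto x atTop (𝓝 l))
    (ht : Tendsto t atTop (𝓝 0)) (p : ℕ) {N D : ℕ → ℝ} (φ ψ : ℝ × ℝ × ℝ → ℝ)
    (hφ : Continuous φ) (hψ : Continuous ψ) (h0 : ψ (l, 0, 0) ≠ 0)
    (hN : ∀ n : ℕ, n ≠ 0 → N n = (n : ℝ) ^ p * φ (x n, u n, t n))
    (hD : ∀ n : ℕ, n ≠ 0 → D n = (n : ℝ) ^ p * ψ (x n, u n, t n)) :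
    Tendsto (fun n => N n / D n) atTop (𝓝 (φ (l, 0, 0) / ψ (l, 0, 0))) ∧ ∀ᶠ n in atTop, D n ≠ 0 := by
  have hp : Tendsto (fun n => (x n, u n, t n)) atTop (𝓝 (l, 0, 0)) :=
    hx.prodMk_nhds (hu.prodMk_nhds ht)
  have h1 := (hφ.tendsto _).comp hp
  have h2 := (hψ.tendsto _).comp hp
  constructor
  · refine (h1.div h2 h0).congr' ?_
    filter_upwards [eventually_ne_atTop 0] with n hn
    have : (n : ℝ) ^ p ≠ 0 := pow_ne_zero _ (by exact_mod_cast hn)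
    rw [hN n hn, hD n hn]
    simp only [Function.comp, Pi.div_apply]
    rw [mul_div_mul_left _ _ this]
  · filter_upwards [eventually_ne_atTop 0, h2.eventually_ne h0] with n hn hne
    rw [hD n hn]
    exact mul_ne_zero (pow_ne_zero _ (by exact_mod_cast hn)) hne

lemma asym_rat {u x t : ℕ → ℝ} {l : ℝ} (hu : Tendsto u atTop (𝓝 0)) (hx : Tendsto x atTop (𝓝 l))
    (ht : Tendsto t atTop (𝓝 0)) (p : ℕ) {f F G : ℕ → ℝ} {c : ℝ} (φ ψ : ℝ × ℝ × ℝ → ℝ)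
    (hφ : Continuous φ) (hψ : Continuous ψ) (h0 : ψ (l, 0, 0) ≠ 0)
    (hc : φ (l, 0, 0) / ψ (l, 0, 0) = c)
    (hN : ∀ n : ℕ, n ≠ 0 → n * (F n - G n) = (n : ℝ) ^ p * φ (x n, u n, t n))
    (hD : ∀ n : ℕ, n ≠ 0 → G n = (n : ℝ) ^ p * ψ (x n, u n, t n))
    (hf : ∀ n, G n ≠ 0 → f n = F n / G n) : AsymOne (fun n => (n : ℝ)) f c := by
  obtain ⟨h1, h2⟩ := ratlim hu hx ht p φ ψ hφ hψ h0 hN hD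
  rw [hc] at h1
  refine h1.congr' ?_
  filter_upwards [h2] with n hn
  rw [hf n hn]
  field_simp

lemma sqrt_atTop : Tendsto (fun n : ℕ => Real.sqrt n) atTop atTop :=
  Real.tendsto_sqrt_atTop.comp tendsto_natCast_atTop_atTop

lemma sqrt_inv : Tendsto (fun n : ℕ => (Real.sqrt n)⁻¹) atTop (𝓝 0) :=
  sqrt_atTop.inv_tendsto_atTop

lemma AsymOne.sqrt {f : ℕ → ℝ} {c : ℝ} (h : AsymOne (fun n => (n : ℝ)) f c) :
    AsymOne (fun n => Real.sqrt n) f 0 := by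
  have := sqrt_inv.mul h
  rw [zero_mul] at this
  refine this.congr fun n => ?_
  rcases Nat.eq_zero_or_pos n with rfl | hn
  · simp
  have hn' : (0 : ℝ) < n := by exact_mod_cast hn
  have h1 : Real.sqrt n ≠ 0 := (Real.sqrt_pos.2 hn').ne'
  have h2 : (n : ℝ) = Real.sqrt n * Real.sqrt n := (Real.mul_self_sqrt hn'.le).symm
  rw [← mul_assoc]
  congr 1
  show (Real.sqrt n)⁻¹ * (n : ℝ) = Real.sqrt n
  rw [inv_mul_eq_iff_eq_mul₀ h1]
  exact h2

variable {m : ℕ → ℕ} {lam : ℝ}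

lemma hu0 : Tendsto (fun n : ℕ => (n : ℝ)⁻¹) atTop (𝓝 0) := tendsto_inv_atTop_nhds_zero_nat

lemma hx0 (hconv : Tendsto (fun n => 2 * (m n : ℝ) / n) atTop (𝓝 lam)) :
    Tendsto (fun n => (m n : ℝ) / n) atTop (𝓝 (lam / 2)) := by
  refine (hconv.div_const 2).congr fun n => ?_
  ring

lemma ht0 (s : ℕ → ℕ) (hs : ∀ n, s n ≤ n) : Tendsto (fun n : ℕ => (s n : ℝ) / (n : ℝ) ^ 2) atTop (𝓝 0) := by
  refine squeeze_zero (fun n => by positivity) (fun n => ?_) hu0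
  rcases Nat.eq_zero_or_pos n with rfl | hn
  · simp
  have hn' : (0 : ℝ) < n := by exact_mod_cast hn
  have : (s n : ℝ) ≤ n := by exact_mod_cast hs n
  rw [div_le_iff₀ (by positivity)]
  field_simp
  exact this

lemma ht00 : Tendsto (fun _ : ℕ => (0 : ℝ)) atTop (𝓝 0) := tendsto_const_nhds

lemma asym_exp (z : ℕ → ℝ) (hz : Tendsto (fun n : ℕ => Real.sqrt n * z n) atTop (𝓝 0)) :
    AsymOne (fun n => Real.sqrt n) (fun n => Real.exp (z n)) 0 := by
  have hz0 : Tendsto z atTop (𝓝 0) := by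
    have := hz.mul sqrt_inv
    rw [mul_zero] at this
    refine this.congr' ?_
    filter_upwards [sqrt_atTop.eventually_gt_atTop 0] with n hn
    field_simp
  have h2 := (hz.abs).const_mul 2
  rw [abs_zero, mul_zero] at h2
  refine squeeze_zero_norm' ?_ h2
  have hz1 := hz0.abs
  rw [abs_zero] at hz1
  filter_upwards [hz1.eventually (gt_mem_nhds zero_lt_one)] with n hn
  rw [Real.norm_eq_abs, abs_mul, abs_mul]
  have := Real.abs_exp_sub_one_le hn.le
  have := abs_nonneg (Real.sqrt n)
  nlinarith

lemma sqrt_y (hconv : Tendsto (fun n => 2 * (m n : ℝ) / n) atTop (𝓝 lam)) :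
    Tendsto (fun n : ℕ => Real.sqrt n * (2 * (m n : ℝ) / n / n)) atTop (𝓝 0) := by
  have := hconv.mul sqrt_inv
  rw [mul_zero] at this
  refine this.congr fun n => ?_
  rcases Nat.eq_zero_or_pos n with rfl | hn
  · simp
  have hn' : (0 : ℝ) < n := by exact_mod_cast hn
  have h1 : Real.sqrt n ≠ 0 := (Real.sqrt_pos.2 hn').ne'
  have h2 : Real.sqrt n ^ 2 = n := Real.sq_sqrt hn'.le
  field_simp
  rw [h2]

lemma exp_second (hconv : Tendsto (fun n => 2 * (m n : ℝ) / n) atTop (𝓝 lam)) :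
    Tendsto (fun n : ℕ => Real.sqrt n * n * (Real.exp (2 * (m n : ℝ) / n / n) - 1 - 2 * (m n : ℝ) / n / n))
      atTop (𝓝 0) := by
  have h2 := (hconv.pow 2).mul sqrt_inv
  rw [mul_zero] at h2
  refine squeeze_zero_norm' ?_ h2
  have hz1 := (hconv.mul hu0).abs
  rw [mul_zero, abs_zero] at hz1
  filter_upwards [hz1.eventually (gt_mem_nhds zero_lt_one), eventually_gt_atTop 0] with n hn hn0
  rw [← div_eq_mul_inv] at hn
  have hn' : (0 : ℝ) < n := by exact_mod_cast hn0
  have h1 : 0 < Real.sqrt n := Real.sqrt_pos.2 hn'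
  have h2 : Real.sqrt n ^ 2 = n := Real.sq_sqrt hn'.le
  have := Real.abs_exp_sub_one_sub_id_le hn.le
  rw [Real.norm_eq_abs, abs_mul, abs_of_pos (by positivity)]
  calc _ ≤ Real.sqrt n * n * (2 * (m n : ℝ) / n / n) ^ 2 := by gcongr
    _ = _ := by
      field_simp
      rw [h2]

lemma N_lim (c : ℕ) : Tendsto (fun n : ℕ => ((n - c : ℕ) : ℝ) / n) atTop (𝓝 1) := by
  have := (hu0.const_mul (c : ℝ)).const_sub 1
  rw [mul_zero, sub_zero] at this
  refine this.congr' ?_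
  filter_upwards [eventually_gt_atTop c] with n hn
  have hn' : (n : ℝ) ≠ 0 := by exact_mod_cast (by omega)
  rw [Nat.cast_sub hn.le]
  field_simp

lemma q2_asym (hconv : Tendsto (fun n => 2 * (m n : ℝ) / n) atTop (𝓝 lam)) (k : ℕ) :
    AsymOne (fun n => Real.sqrt n) (fun n : ℕ => ∏ i ∈ Finset.range (n - 1 - k),
      (1 + ((1 - m n / ((n : ℝ) * (n - 1) / 2 - i)) * Real.exp (2 * (m n : ℝ) / n / n) - 1))) 0 := by
  refine AsymOne.bigprod sqrt_atTop (fun n i => (1 - m n / ((n : ℝ) * (n - 1) / 2 - i)) * Real.exp (2 * (m n : ℝ) / n / n) - 1) 0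
    (fun n => n - 1 - k) (fun n => by omega) ?_ ?_
  · simp_rw [Nat.sub_sub]
    exact N_lim _
  · intro s hs
    obtain ⟨h1, h2⟩ := ratlim hu0 (hx0 hconv) (ht0 s hs) 2 (N := fun n => (n : ℝ) * m n)
      (D := fun n => (n : ℝ) * (n - 1) / 2 - s n) (fun q => q.1) (fun q => (1 - q.2.1) / 2 - q.2.2)
      (by fun_prop) (by fun_prop) (by norm_num) (fun n hn => by field_simp) (fun n hn => by field_simp)
    have h3 : Tendsto (fun n : ℕ => (1 + 2 * (s n : ℝ) / n) * (Real.sqrt n)⁻¹) atTop (𝓝 0) := by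
      have h4 := sqrt_inv.const_mul 3
      rw [mul_zero] at h4
      refine squeeze_zero (fun n => by positivity) (fun n => ?_) h4
      gcongr
      rcases Nat.eq_zero_or_pos n with rfl | hn
      · simp
      have hn' : (0 : ℝ) < n := by exact_mod_cast hn
      have : 2 * (s n : ℝ) / n ≤ 2 := by
        rw [div_le_iff₀ hn']
        have : (s n : ℝ) ≤ n := by exact_mod_cast hs n
        linarith
      linarith
    have h5 := ((exp_second hconv).sub (h1.mul h3)).sub (h1.mul (asym_exp _ (sqrt_y hconv)))
    simp only [mul_zero, sub_zero] at h5
    refine h5.congr' ?_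
    filter_upwards [h2, eventually_gt_atTop 0] with n hD hn0
    have hn' : (0 : ℝ) < n := by exact_mod_cast hn0
    have g1 : 0 < Real.sqrt n := Real.sqrt_pos.2 hn'
    have g2 : Real.sqrt n ^ 2 = n := Real.sq_sqrt hn'.le
    have g3 : (Real.sqrt n)⁻¹ = Real.sqrt n / n := by
      field_simp
      exact g2.symm
    rw [g3]
    generalize Real.exp (2 * (m n : ℝ) / n / n) = E
    generalize Real.sqrt n = w
    have hD' : (n : ℝ) * (n - 1) - 2 * s n ≠ 0 := by
      intro h
      apply hD
      linarith
    field_simp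
    ring

lemma mean_asym (hlam : 0 < lam) (hconv : Tendsto (fun n => 2 * (m n : ℝ) / n) atTop (𝓝 lam)) (k : ℕ) :
    AsymOne (fun n => Real.sqrt n) (fun n : ℕ =>
      ((∏ i ∈ Finset.range k, (((n : ℝ) - 1 - i) / (n - 1) * ((m n - i) / m n) *
        ((n : ℝ) * (n - 1) / 2 / ((n : ℝ) * (n - 1) / 2 - (n - 1) + k - i)))) *
      ((∏ i ∈ Finset.range (n - 1 - k), (1 + ((1 - m n / ((n : ℝ) * (n - 1) / 2 - i)) * Real.exp (2 * (m n : ℝ) / n / n) - 1))) *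
      Real.exp (2 * (m n : ℝ) / n * (k + 1) / n)))) 0 := by
  have a1 : ∀ i : ℕ, AsymOne (fun n => (n : ℝ)) (fun n : ℕ => ((n : ℝ) - 1 - i) / (n - 1)) (-i) := by
    intro i
    refine asym_rat hu0 (hx0 hconv) ht00 1 (fun q => -i) (fun q => 1 - q.2.1)
      (by fun_prop) (by fun_prop) (by norm_num) (by norm_num) (fun n hn => by field_simp; ring)
      (fun n hn => by field_simp) (fun n hn => rfl)
  have a2 : ∀ i : ℕ, AsymOne (fun n => (n : ℝ)) (fun n : ℕ => ((m n : ℝ) - i) / m n) (-i / (lam / 2)) := by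
    intro i
    refine asym_rat hu0 (hx0 hconv) ht00 1 (fun q => -i) (fun q => q.1)
      (by fun_prop) (by fun_prop) (by positivity) (by norm_num) (fun n hn => by field_simp; ring)
      (fun n hn => by field_simp) (fun n hn => rfl)
  have a3 : ∀ i : ℕ, AsymOne (fun n => (n : ℝ)) (fun n : ℕ => ((n : ℝ) * (n - 1) / 2 / ((n : ℝ) * (n - 1) / 2 - (n - 1) + k - i))) 2 := by
    intro i
    refine asym_rat hu0 (hx0 hconv) ht00 2 (fun q => 1 - (1 + k - i) * q.2.1)
      (fun q => (1 - q.2.1) / 2 - q.2.1 + (1 + k - i) * q.2.1 ^ 2)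
      (by fun_prop) (by fun_prop) (by norm_num) (by norm_num) (fun n hn => by field_simp; ring)
      (fun n hn => by field_simp; ring) (fun n hn => rfl)
  have a4 := AsymOne.prod sqrt_atTop k (fun i => ((a1 i).sqrt.mul sqrt_atTop (a2 i).sqrt).mul sqrt_atTop (a3 i).sqrt)
  have a5 : AsymOne (fun n => Real.sqrt n) (fun n => Real.exp (2 * (m n : ℝ) / n * (k + 1) / n)) 0 := by
    apply asym_exp
    have := (sqrt_y hconv).mul_const ((k : ℝ) + 1)
    rw [zero_mul] at this
    refine this.congr fun n => ?_
    ring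
  have a6 := a4.mul sqrt_atTop ((q2_asym hconv k).mul sqrt_atTop a5)
  simpa using a6

lemma pair_asym (hlam : 0 < lam) (hconv : Tendsto (fun n => 2 * (m n : ℝ) / n) atTop (𝓝 lam)) (j k : ℕ) :
    AsymOne (fun n => (n : ℝ)) (fun n : ℕ =>
      ((1 - j / ((n : ℝ) - 1)) * ((1 - k / ((n : ℝ) - 1)) *
      ((∏ i ∈ Finset.range k, ((m n - j - i : ℝ) / (m n - i))) *
      (((n : ℝ) * (n - 1) / 2 - n + 2) / ((n : ℝ) * (n - 1) / 2 - m n - n + 2 + k) *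
      ((∏ i ∈ Finset.range (n - 2 - k), (1 + (j * ((n : ℝ) * (n - 1) / 2 - i) - (n - 1) * m n) /
        (((n : ℝ) * (n - 1) / 2 - i - m n) * ((n : ℝ) * (n - 1) / 2 - i - (n - 1))))) *
      ((∏ i ∈ Finset.range k, (((n : ℝ) * (n - 1) / 2 - (n - 2 - k + i)) / ((n : ℝ) * (n - 1) / 2 - (n - 1) - (n - 2 - k + i)))) *
      (1 + j * k * ((n : ℝ) * (n - 1) / 2 - (2 * n - 3) - m n + j + k) / ((n - 1 - j) * (n - 1 - k) * (m n - j - k + 1)))))))))) 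
      (-(((j : ℝ) - lam) * ((k : ℝ) - lam) / lam)) := by
  have hN : Tendsto (fun n : ℕ => (n : ℝ)) atTop atTop := tendsto_natCast_atTop_atTop
  have a1 : ∀ i : ℕ, AsymOne (fun n => (n : ℝ)) (fun n : ℕ => 1 - i / ((n : ℝ) - 1)) (-i) := by
    intro i
    refine asym_rat hu0 (hx0 hconv) ht00 1 (F := fun n => (n : ℝ) - 1 - i) (G := fun n => (n : ℝ) - 1) (fun q => -i) (fun q => 1 - q.2.1)
      (by fun_prop) (by fun_prop) (by norm_num) (by norm_num) (fun n hn => by field_simp; ring)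
      (fun n hn => by field_simp) (fun n hn => by field_simp)
  have a2 : ∀ i : ℕ, AsymOne (fun n => (n : ℝ)) (fun n : ℕ => ((m n : ℝ) - j - i) / (m n - i)) (-j / (lam / 2)) := by
    intro i
    refine asym_rat hu0 (hx0 hconv) ht00 1 (fun q => -j) (fun q => q.1 - i * q.2.1)
      (by fun_prop) (by fun_prop) (by simpa using hlam.ne') (by norm_num) (fun n hn => by field_simp; ring)
      (fun n hn => by field_simp) (fun n hn => rfl)
  have a3 : AsymOne (fun n => (n : ℝ)) (fun n : ℕ => (((n : ℝ) * (n - 1) / 2 - n + 2) / ((n : ℝ) * (n - 1) / 2 - m n - n + 2 + k))) lam := by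
    refine asym_rat hu0 (hx0 hconv) ht00 2 (fun q => q.1 - k * q.2.1)
      (fun q => (1 - q.2.1) / 2 - q.1 * q.2.1 - q.2.1 + (2 + k) * q.2.1 ^ 2)
      (by fun_prop) (by fun_prop) (by norm_num) (by norm_num; try ring) (fun n hn => by field_simp; ring)
      (fun n hn => by field_simp; ring) (fun n hn => rfl)
  have a4 : ∀ i : ℕ, AsymOne (fun n => (n : ℝ)) (fun n : ℕ => (((n : ℝ) * (n - 1) / 2 - (n - 2 - k + i)) / ((n : ℝ) * (n - 1) / 2 - (n - 1) - (n - 2 - k + i)))) 2 := by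
    intro i
    refine asym_rat hu0 (hx0 hconv) ht00 2 (fun q => 1 - q.2.1)
      (fun q => (1 - q.2.1) / 2 - (q.2.1 - q.2.1 ^ 2) - (q.2.1 - (2 + k - i) * q.2.1 ^ 2))
      (by fun_prop) (by fun_prop) (by norm_num) (by norm_num) (fun n hn => by field_simp; ring)
      (fun n hn => by field_simp; ring) (fun n hn => rfl)
  have a5 : AsymOne (fun n => (n : ℝ)) (fun n : ℕ => (1 + j * k * ((n : ℝ) * (n - 1) / 2 - (2 * n - 3) - m n + j + k) / ((n - 1 - j) * (n - 1 - k) * (m n - j - k + 1)))) (j * k / lam) := by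
    obtain ⟨h, -⟩ := ratlim hu0 (hx0 hconv) ht00 3
      (N := fun n => n * (j * k * ((n : ℝ) * (n - 1) / 2 - (2 * n - 3) - m n + j + k)))
      (D := fun n => ((n - 1 - j) * (n - 1 - k) * (m n - j - k + 1)))
      (fun q => j * k * ((1 - q.2.1) / 2 - 2 * q.2.1 + 3 * q.2.1 ^ 2 - q.1 * q.2.1 + (j + k) * q.2.1 ^ 2))
      (fun q => (1 - (1 + j) * q.2.1) * (1 - (1 + k) * q.2.1) * (q.1 - (j + k - 1) * q.2.1))
      (by fun_prop) (by fun_prop) (by simpa using hlam.ne') (fun n hn => by field_simp; ring)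
      (fun n hn => by field_simp; ring)
    unfold AsymOne
    convert h using 2
    · ring
    · norm_num
      field_simp
  have a6 : AsymOne (fun n => (n : ℝ)) (fun n : ℕ => (∏ i ∈ Finset.range (n - 2 - k), (1 + (j * ((n : ℝ) * (n - 1) / 2 - i) - (n - 1) * m n) /
        (((n : ℝ) * (n - 1) / 2 - i - m n) * ((n : ℝ) * (n - 1) / 2 - i - (n - 1)))))) (2 * (j - lam)) := by
    refine AsymOne.bigprod hN (fun n i => (j * ((n : ℝ) * (n - 1) / 2 - i) - (n - 1) * m n) /
        (((n : ℝ) * (n - 1) / 2 - i - m n) * ((n : ℝ) * (n - 1) / 2 - i - (n - 1)))) (2 * (j - lam))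
      (fun n => n - 2 - k) (fun n => by omega) ?_ ?_
    · simp_rw [Nat.sub_sub]
      exact N_lim _
    · intro s hs
      obtain ⟨h, -⟩ := ratlim hu0 (hx0 hconv) (ht0 s hs) 4
        (N := fun n => n * n * (j * ((n : ℝ) * (n - 1) / 2 - s n) - (n - 1) * m n))
        (D := fun n => (((n : ℝ) * (n - 1) / 2 - s n - m n) * ((n : ℝ) * (n - 1) / 2 - s n - (n - 1))))
        (fun q => j * ((1 - q.2.1) / 2 - q.2.2) - (1 - q.2.1) * q.1)
        (fun q => ((1 - q.2.1) / 2 - q.2.2 - q.1 * q.2.1) * ((1 - q.2.1) / 2 - q.2.2 - q.2.1 + q.2.1 ^ 2))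
        (by fun_prop) (by fun_prop) (by norm_num) (fun n hn => by field_simp)
        (fun n hn => by field_simp; ring)
      convert h using 2
      · ring
      · norm_num
        ring
  have h := (a1 j).mul hN ((a1 k).mul hN ((AsymOne.prod hN k a2).mul hN (a3.mul hN (a6.mul hN
    ((AsymOne.prod hN k a4).mul hN a5)))))
  convert h using 1
  field_simp
  ring

lemma eventually_good (hlam : 0 < lam) (hconv : Tendsto (fun n => 2 * (m n : ℝ) / n) atTop (𝓝 lam)) (K : ℕ) :
    ∀ᶠ n in atTop, 0 < m n ∧ K ≤ m n ∧ K + 3 ≤ n ∧ m n + 2 * n ≤ n.choose 2 := by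
  have h1 : Tendsto (fun n => (m n : ℝ)) atTop atTop := by
    have := (hx0 hconv).pos_mul_atTop (by positivity) (tendsto_natCast_atTop_atTop (R := ℝ))
    refine this.congr' ?_
    filter_upwards [eventually_gt_atTop 0] with n hn
    have : (n : ℝ) ≠ 0 := by exact_mod_cast hn.ne'
    field_simp
  have h2 := (hx0 hconv).mul hu0
  rw [mul_zero] at h2
  filter_upwards [h1.eventually_gt_atTop (K : ℝ), eventually_ge_atTop (K + 20),
    h2.eventually (gt_mem_nhds (show (0 : ℝ) < 1 / 8 by norm_num))] with n hm hn hq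
  have hm' : K < m n := by exact_mod_cast hm
  refine ⟨by omega, by omega, by omega, ?_⟩
  have hn' : (20 : ℝ) ≤ n := by exact_mod_cast (by omega)
  have hq' : (m n : ℝ) < n * n / 8 := by
    rw [← div_eq_mul_inv, div_div, div_lt_iff₀ (by positivity)] at hq
    linarith
  have : ((m n + 2 * n : ℕ) : ℝ) ≤ (n.choose 2 : ℕ) := by
    rw [Nat.cast_choose_two]
    push_cast
    nlinarith
  exact_mod_cast this

lemma poisson_lim (hconv : Tendsto (fun n => 2 * (m n : ℝ) / n) atTop (𝓝 lam)) (k : ℕ) :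
    Tendsto (fun n => poissonProb (2 * (m n : ℝ) / n) k) atTop (𝓝 (poissonProb lam k)) := by
  have : Continuous (fun x => poissonProb x k) := by
    unfold poissonProb
    fun_prop
  exact (this.tendsto lam).comp hconv

lemma pk_sqrt (hlam : 0 < lam) (hconv : Tendsto (fun n => 2 * (m n : ℝ) / n) atTop (𝓝 lam)) (k : ℕ) :
    Tendsto (fun n : ℕ => Real.sqrt n * (pk n (m n) k - poissonProb (2 * (m n : ℝ) / n) k)) atTop (𝓝 0) := by
  have h := (poisson_lim hconv k).mul (mean_asym hlam hconv k)
  rw [mul_zero] at h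
  refine h.congr' ?_
  filter_upwards [eventually_good hlam hconv k] with n ⟨g1, g2, g3, g4⟩
  rw [mean_ratio n (m n) k _ rfl g1 g2 g3 g4]
  ring

lemma pk_lim (hlam : 0 < lam) (hconv : Tendsto (fun n => 2 * (m n : ℝ) / n) atTop (𝓝 lam)) (k : ℕ) :
    Tendsto (fun n : ℕ => pk n (m n) k) atTop (𝓝 (poissonProb lam k)) := by
  have h := ((pk_sqrt hlam hconv k).mul sqrt_inv).add (poisson_lim hconv k)
  rw [mul_zero, zero_add] at h
  refine h.congr' ?_
  filter_upwards [sqrt_atTop.eventually_gt_atTop 0] with n hn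
  field_simp
  ring

lemma pjk_lim (hlam : 0 < lam) (hconv : Tendsto (fun n => 2 * (m n : ℝ) / n) atTop (𝓝 lam)) (j k : ℕ) :
    Tendsto (fun n : ℕ => n * (pjk n (m n) j k - pk n (m n) j * pk n (m n) k)) atTop
      (𝓝 (poissonProb lam j * poissonProb lam k * -(((j : ℝ) - lam) * ((k : ℝ) - lam) / lam))) := by
  have h := ((pk_lim hlam hconv j).mul (pk_lim hlam hconv k)).mul (pair_asym hlam hconv j k)
  refine h.congr' ?_
  filter_upwards [eventually_good hlam hconv (j + k)] with n ⟨g1, g2, g3, g4⟩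
  rw [pair_ratio n (m n) j k _ rfl g2 g3 g4]
  ring

end limits

/-- Remark 4.2: convergence of means and covariances of the degree counts in `G(n, m)`
with `λₙ := 2m/n → λ > 0`. -/
theorem gnm_degree_counts_mean_cov_convergence
    (m : ℕ → ℕ) (lam : ℝ) (hlam : 0 < lam)
    (hconv : Tendsto (fun n => 2 * (m n : ℝ) / n) atTop (𝓝 lam)) :
    ∀ j k : ℕ,
      Tendsto
        (fun n : ℕ => (Real.sqrt n)⁻¹ *
          ∫ S, ((degCount n k S : ℝ) - n * poissonProb (2 * (m n : ℝ) / n) k)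
            ∂(gnmMeasure n (m n)))
        atTop (𝓝 0) ∧
      Tendsto
        (fun n : ℕ => (n : ℝ)⁻¹ *
          covFn (gnmMeasure n (m n))
            (fun S => (degCount n j S : ℝ)) (fun S => (degCount n k S : ℝ)))
        atTop
        (𝓝 (poissonProb lam j * poissonProb lam k *
            (-(((j : ℝ) - lam) * ((k : ℝ) - lam) / lam) - 1) +
          poissonProb lam k * (if j = k then 1 else 0))) := by
  intro j k
  constructor
  · refine (pk_sqrt hlam hconv k).congr' ?_
    filter_upwards [eventually_good hlam hconv k, eventually_gt_atTop 0] with n ⟨g1, g2, g3, g4⟩ hn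
    rw [mean_sub_eq n (m n) k _ (by omega) g2]
    have hn' : (0 : ℝ) < n := by exact_mod_cast hn
    have h1 : 0 < Real.sqrt n := Real.sqrt_pos.2 hn'
    have h2 : Real.sqrt n ^ 2 = n := Real.sq_sqrt hn'.le
    rw [← mul_sub, ← mul_assoc]
    congr 1
    field_simp
    exact h2
  · have hj := pk_lim hlam hconv j
    have hk := pk_lim hlam hconv k
    have h1 := pjk_lim hlam hconv j k
    have hr : Tendsto (fun n : ℕ => ((n : ℝ) - 1) / n) atTop (𝓝 1) := by
      have := hu0.const_sub 1
      rw [sub_zero] at this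
      refine this.congr' ?_
      filter_upwards [eventually_gt_atTop 0] with n hn
      have hn' : (n : ℝ) ≠ 0 := by exact_mod_cast hn.ne'
      field_simp
    have h := ((hk.mul_const (if j = k then (1 : ℝ) else 0)).add (hr.mul h1)).sub (hj.mul hk)
    have e : poissonProb lam k * (if j = k then (1 : ℝ) else 0) +
        1 * (poissonProb lam j * poissonProb lam k * -(((j : ℝ) - lam) * ((k : ℝ) - lam) / lam)) -
        poissonProb lam j * poissonProb lam k =
        poissonProb lam j * poissonProb lam k *
            (-(((j : ℝ) - lam) * ((k : ℝ) - lam) / lam) - 1) +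
          poissonProb lam k * (if j = k then 1 else 0) := by ring
    rw [e] at h
    refine h.congr' ?_
    filter_upwards [eventually_good hlam hconv (j + k), eventually_gt_atTop 0] with n ⟨g1, g2, g3, g4⟩ hn
    rw [cov_eq n (m n) j k (by omega) g2]
    have hn' : (n : ℝ) ≠ 0 := by exact_mod_cast hn.ne'
    field_simp
    ring
end
end

section
/- For each n ≥ 1, let U_1,…,U_{n−1} be i.i.d. random variables uniformly distributed on (0,1), let 0 = U_{(0)} ≤ U_{(1)} ≤ ⋯ ≤ U_{(n−1)} ≤ U_{(n)} = 1 be their order statistics together with the endpoints, and let S_i := U_{(i)} − U_{(i−1)}, i = 1,…,n, be the n spacings they create in (0,1). Fix a > 0 and let N_a := #{1 ≤ i ≤ n : S_i > a/n}. Then n^{-1/2}(N_a − n e^{−a}) converges in distribution to the normal distribution N(0, e^{−a} − e^{−2a} − a² e^{−2a}), and moreover all moments of n^{-1/2}(N_a − n e^{−a}) converge to the corresponding moments of this normal distribution. -/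
open MeasureTheory ProbabilityTheory Filter Topology

noncomputable section

/-- The law of `n - 1` i.i.d. points, uniform on `(0,1)`. -/
def iidUniform01 (n : ℕ) : Measure (Fin (n - 1) → ℝ) :=
  Measure.pi fun _ => volume.restrict (Set.Ioo (0 : ℝ) 1)

/-- The number of spacings exceeding `c` among the spacings in `(0,1)` created by the
points `ω i` together with the endpoints `0` and `1`: for each point `x` (including `0`),
we test whether the distance from `x` to the next larger point (or to `1`) exceeds `c`.
(Almost surely the points are distinct and lie in `(0,1)`, and this is exactly the number
of spacings greater than `c`.) -/
def bigSpacings (n : ℕ) (ω : Fin (n - 1) → ℝ) (c : ℝ) : ℕ :=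
  Set.ncard {x ∈ insert (0 : ℝ) (Set.range ω) |
    sInf ((insert (0 : ℝ) (Set.range ω) ∪ {1}) ∩ Set.Ioi x) - x > c}


/-- the points, with `none` standing for the endpoint `0` -/
def spPts {m : ℕ} (ω : Fin m → ℝ) : Option (Fin m) → ℝ
  | none => 0
  | some i => ω i

/-- the gap to the right of point `x` exceeds `c`, in `(0,L)`. -/
def spGap {m : ℕ} (c L : ℝ) (ω : Fin m → ℝ) (x : Option (Fin m)) : Prop :=
  spPts ω x + c < L ∧ ∀ i, spPts ω x < ω i → spPts ω x + c < ω i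

def spGood {m : ℕ} (L : ℝ) : Set (Fin m → ℝ) :=
  {ω | 0 < L ∧ (∀ i, 0 < ω i ∧ ω i < L) ∧ ∀ i j, i ≠ j → ω i ≠ ω j}

def spE {m : ℕ} (c L : ℝ) (J : Finset (Option (Fin m))) : Set (Fin m → ℝ) :=
  {ω | ω ∈ spGood L ∧ ∀ x ∈ J, spGap c L ω x}

def spShear {m : ℕ} (c : ℝ) (j : Option (Fin m)) (ω : Fin m → ℝ) : Fin m → ℝ :=
  fun i => ω i + if spPts ω j < ω i then c else 0

lemma spPts_measurable {m : ℕ} (x : Option (Fin m)) :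
    Measurable (fun ω : Fin m → ℝ => spPts ω x) := by
  cases x with
  | none => exact measurable_const
  | some i => exact measurable_pi_apply i

lemma spPts_inj {m : ℕ} {L : ℝ} {ω : Fin m → ℝ} (h : ω ∈ spGood L) :
    Function.Injective (spPts ω) := by
  obtain ⟨_, h1, h2⟩ := h
  intro x y hxy
  cases x with
  | none => cases y with
    | none => rfl
    | some j => have := (h1 j).1; simp only [spPts] at hxy; linarith
  | some i => cases y with
    | none => have := (h1 i).1; simp only [spPts] at hxy; linarith
    | some j =>
      by_contra hne
      exact h2 i j (fun h => hne (by rw [h])) hxy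

lemma spGap_measurableSet {m : ℕ} (c L : ℝ) (x : Option (Fin m)) :
    MeasurableSet {ω : Fin m → ℝ | spGap c L ω x} := by
  have h := spPts_measurable x
  have e : {ω : Fin m → ℝ | spGap c L ω x} = {ω | spPts ω x + c < L} ∩
      ⋂ i, ({ω | spPts ω x < ω i}ᶜ ∪ {ω | spPts ω x + c < ω i}) := by
    ext ω
    simp only [spGap, Set.mem_inter_iff, Set.mem_iInter, Set.mem_union, Set.mem_compl_iff,
      Set.mem_ofPred_eq, imp_iff_not_or]
  rw [e]
  exact (measurableSet_lt (h.add_const c) measurable_const).inter <| MeasurableSet.iInter fun i =>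
    (measurableSet_lt h (measurable_pi_apply i)).compl.union
    (measurableSet_lt (h.add_const c) (measurable_pi_apply i))

lemma spGood_measurableSet {m : ℕ} (L : ℝ) : MeasurableSet (spGood L : Set (Fin m → ℝ)) := by
  have e : (spGood L : Set (Fin m → ℝ)) = {ω | 0 < L} ∩ ((⋂ i, ({ω | 0 < ω i} ∩ {ω | ω i < L})) ∩
      ⋂ i, ⋂ j, ⋂ (_ : i ≠ j), {ω | ω i = ω j}ᶜ) := by
    ext ω
    simp only [spGood, Set.mem_inter_iff, Set.mem_iInter, Set.mem_compl_iff, Set.mem_ofPred_eq]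
  rw [e]
  refine MeasurableSet.inter (MeasurableSet.const _) (MeasurableSet.inter ?_ ?_)
  · exact MeasurableSet.iInter fun i => (measurableSet_lt measurable_const (measurable_pi_apply i)).inter
      (measurableSet_lt (measurable_pi_apply i) measurable_const)
  · exact MeasurableSet.iInter fun i => MeasurableSet.iInter fun j => MeasurableSet.iInter fun _ =>
      (measurableSet_eq_fun (measurable_pi_apply i) (measurable_pi_apply j)).compl

lemma spE_measurableSet {m : ℕ} (c L : ℝ) (J : Finset (Option (Fin m))) :
    MeasurableSet (spE c L J) := by
  have e : spE c L J = spGood L ∩ ⋂ x, ⋂ (_ : x ∈ J), {ω | spGap c L ω x} := by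
    ext ω
    simp only [spE, Set.mem_inter_iff, Set.mem_iInter, Set.mem_ofPred_eq]
  rw [e]
  refine (spGood_measurableSet L).inter ?_
  exact MeasurableSet.iInter fun x => MeasurableSet.iInter fun _ => spGap_measurableSet c L x

lemma spPts_shear {m : ℕ} (c : ℝ) (j x : Option (Fin m)) {L : ℝ} {ω : Fin m → ℝ} (h : ω ∈ spGood L) :
    spPts (spShear c j ω) x = spPts ω x + if spPts ω j < spPts ω x then c else 0 := by
  cases x with
  | some i => rfl
  | none =>
    have : ¬ spPts ω j < spPts ω none := by
      cases j with
      | none => simp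
      | some k => have := (h.2.1 k).1; simp only [spPts]; linarith
    simp [this]; rfl

/-- Shears preserve volume. -/
lemma volume_shear {m : ℕ} (c : ℝ) (hc : 0 < c) (j : Option (Fin m)) (A : Set (Fin m → ℝ))
    (hA : MeasurableSet A) {L : ℝ} (hAL : A ⊆ spGood L) :
    volume (spShear c j '' A) = volume A := by
  classical
  let P : (Fin m → Bool) → Set (Fin m → ℝ) := fun r => {ω | ∀ i, r i = true ↔ spPts ω j < ω i}
  have hPm : ∀ r, MeasurableSet (P r) := by
    intro r
    have e : P r = ⋂ i, if r i = true then {ω | spPts ω j < ω i} else {ω | spPts ω j < ω i}ᶜ := by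
      ext ω
      simp only [P, Set.mem_ofPred_eq, Set.mem_iInter]
      refine forall_congr' fun i => ?_
      by_cases h : r i = true
      · simp [h]
      · simp [h]
    rw [e]
    refine MeasurableSet.iInter fun i => ?_
    have := measurableSet_lt (spPts_measurable j) (measurable_pi_apply i)
    split_ifs
    · exact this
    · exact this.compl
  have hPd : Pairwise (Function.onFun Disjoint fun r => A ∩ P r) := by
    intro r s hrs
    refine Set.disjoint_left.2 ?_
    rintro ω ⟨_, h1⟩ ⟨_, h2⟩
    apply hrs
    ext i
    have := (h1 i).trans (h2 i).symm
    exact Bool.eq_iff_iff.2 this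
  have hAU : A = ⋃ r, A ∩ P r := by
    ext ω
    simp only [Set.mem_iUnion, Set.mem_inter_iff, exists_and_left, iff_self_and]
    intro _
    exact ⟨fun i => decide (spPts ω j < ω i), fun i => by simp⟩
  have himg : ∀ r, spShear c j '' (A ∩ P r) = (fun ω => ω + fun i => if r i then c else 0) '' (A ∩ P r) := by
    intro r
    refine Set.image_congr ?_
    rintro ω ⟨_, h⟩
    ext i
    simp only [spShear, Pi.add_apply]
    congr 1
    by_cases hr : r i = true
    · rw [if_pos hr, if_pos ((h i).1 hr)]
    · rw [if_neg hr, if_neg (fun h' => hr ((h i).2 h'))]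
  have hinj : Set.InjOn (spShear c j) A := by
    intro ω hω ω' hω' he
    have e1 : spPts ω j = spPts ω' j := by
      have := congrArg (fun w => spPts w j) he
      simp only [spPts_shear c j j (hAL hω), spPts_shear c j j (hAL hω')] at this
      simpa using this
    ext i
    have := congrFun he i
    simp only [spShear] at this
    split_ifs at this <;> linarith
  have hvol : ∀ r, volume (spShear c j '' (A ∩ P r)) = volume (A ∩ P r) := by
    intro r
    rw [himg, Set.image_add_right, measure_preimage_add_right]
  have hmeas : ∀ r, MeasurableSet (spShear c j '' (A ∩ P r)) := by
    intro r
    rw [himg, Set.image_add_right]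
    exact (measurable_add_const _) (hA.inter (hPm r))
  have hd2 : Pairwise (Function.onFun Disjoint fun r => spShear c j '' (A ∩ P r)) := by
    intro r s hrs
    exact Set.disjoint_image_image (fun x hx y hy hxy => Set.disjoint_left.1 (hPd hrs) hx
      (by rw [hinj hx.1 hy.1 hxy]; exact hy))
  calc volume (spShear c j '' A) = volume (⋃ r, spShear c j '' (A ∩ P r)) := by
        rw [← Set.image_iUnion, ← hAU]
    _ = ∑' r, volume (spShear c j '' (A ∩ P r)) := measure_iUnion hd2 hmeas
    _ = ∑' r, volume (A ∩ P r) := by simp_rw [hvol]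
    _ = volume (⋃ r, A ∩ P r) := (measure_iUnion hPd fun r => hA.inter (hPm r)).symm
    _ = volume A := by rw [← hAU]

lemma spE_insert {m : ℕ} (c : ℝ) (hc : 0 < c) (L : ℝ) (J : Finset (Option (Fin m)))
    (j : Option (Fin m)) (hj : j ∉ J) :
    spE c L (insert j J) = spShear c j '' spE c (L - c) J := by
  ext w
  constructor
  · rintro ⟨hg, hw⟩
    have hinj := spPts_inj hg
    obtain ⟨hj1, hj2⟩ := hw j (Finset.mem_insert_self _ _)
    have hnn : ∀ x, 0 ≤ spPts w x := by
      intro x; cases x with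
      | none => exact le_rfl
      | some i => exact (hg.2.1 i).1.le
    let v : Fin m → ℝ := fun i => w i - if spPts w j < w i then c else 0
    have hpv : ∀ x, spPts v x = spPts w x - if spPts w j < spPts w x then c else 0 := by
      intro x; cases x with
      | some i => rfl
      | none =>
        have : ¬ spPts w j < spPts w none := not_lt.2 (hnn j)
        simp [this]; rfl
    have hjx : ∀ x, spPts w j < spPts w x → spPts w j + c < spPts w x := by
      intro x hx; cases x with
      | none => exact absurd hx (not_lt.2 (hnn j))
      | some i => exact hj2 i hx
    have hpj : spPts v j = spPts w j := by rw [hpv]; simp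
    have hvg : v ∈ spGood (L - c) := by
      refine ⟨by have := hnn j; linarith, fun i => ?_, fun i k hik => ?_⟩
      · have h1 := hg.2.1 i
        have h2 := hj2 i
        have h3 := hnn j
        simp only [v]
        split_ifs with h
        · have := h2 h; constructor <;> linarith
        · constructor <;> linarith
      · have h1 := hg.2.2 i k hik
        have h2 := hj2 i
        have h3 := hj2 k
        simp only [v]
        split_ifs with h h' h'
        · intro he; apply h1; linarith
        · intro he; have := h2 h; linarith
        · intro he; have := h3 h'; linarith
        · intro he; apply h1; linarith
    refine ⟨v, ⟨hvg, fun x hx => ?_⟩, ?_⟩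
    · obtain ⟨hx1, hx2⟩ := hw x (Finset.mem_insert_of_mem hx)
      have hne : spPts w x ≠ spPts w j := fun h => hj (hinj h ▸ hx)
      refine ⟨?_, fun i => ?_⟩
      · rw [hpv]
        split_ifs with h
        · linarith
        · have hlt : spPts w x < spPts w j := lt_of_le_of_ne (not_lt.1 h) hne
          have : spPts w x + c < spPts w j := by
            cases j with
            | none => exact absurd hlt (not_lt.2 (hnn x))
            | some k => exact hx2 k hlt
          linarith
      · rw [hpv]
        simp only [v]
        have h2 := hj2 i
        have h3 := hx2 i
        split_ifs with h h' h'
        · intro; have := h3 (by linarith); linarith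
        · intro; have := hjx x h; linarith
        · intro hh
          have hlt : spPts w x < spPts w j := lt_of_le_of_ne (not_lt.1 h) hne
          have : spPts w x + c < spPts w j := by
            cases j with
            | none => exact absurd hlt (not_lt.2 (hnn x))
            | some k => exact hx2 k hlt
          have := h2 h'
          linarith
        · intro; have := h3 (by linarith); linarith
    · ext i
      simp only [spShear, hpj]
      have h2 := hj2 i
      by_cases h : spPts w j < w i
      · have := h2 h
        have hv : v i = w i - c := by simp only [v]; rw [if_pos h]
        rw [hv, if_pos (by linarith)]; ring
      · have hv : v i = w i := by simp only [v]; rw [if_neg h, sub_zero]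
        rw [hv, if_neg h]; ring
  · rintro ⟨v, ⟨hg, hv⟩, rfl⟩
    have hinj := spPts_inj hg
    have hnn : ∀ x, 0 ≤ spPts v x ∧ spPts v x < L - c := by
      intro x; cases x with
      | none => exact ⟨le_rfl, hg.1⟩
      | some i => exact ⟨(hg.2.1 i).1.le, (hg.2.1 i).2⟩
    have hpv := fun x => spPts_shear c j x hg
    refine ⟨⟨by linarith [hg.1], fun i => ?_, fun i k hik => ?_⟩, fun x hx => ?_⟩
    · have h1 := hg.2.1 i
      simp only [spShear]
      split_ifs <;> constructor <;> linarith
    · have h1 := hg.2.2 i k hik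
      simp only [spShear]
      split_ifs with h h' h'
      · intro he; apply h1; linarith
      · intro he; linarith
      · intro he; linarith
      · intro he; apply h1; linarith
    · rcases Finset.mem_insert.1 hx with rfl | hx
      · unfold spGap
        rw [hpv]
        simp only [lt_self_iff_false, if_false, add_zero]
        refine ⟨by linarith [(hnn x).2], fun i => ?_⟩
        simp only [spShear]
        split_ifs with h
        · intro; linarith
        · intro; linarith
      · obtain ⟨hx1, hx2⟩ := hv x hx
        have hne : spPts v x ≠ spPts v j := fun h => hj (hinj h ▸ hx)
        unfold spGap
        rw [hpv]
        refine ⟨by split_ifs <;> linarith, fun i => ?_⟩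
        have h3 := hx2 i
        simp only [spShear]
        split_ifs with h h' h'
        · intro; have := h3 (by linarith); linarith
        · intro; linarith
        · intro hh
          have hlt : spPts v x < spPts v j := lt_of_le_of_ne (not_lt.1 h) hne
          have := h3 (by linarith); linarith
        · intro; have := h3 (by linarith); linarith

lemma volume_ne {m : ℕ} (i j : Fin m) (hij : i ≠ j) :
    volume {ω : Fin m → ℝ | ω i = ω j} = 0 := by
  let f : (Fin m → ℝ) →ₗ[ℝ] ℝ := (LinearMap.proj i : (Fin m → ℝ) →ₗ[ℝ] ℝ) - LinearMap.proj j
  have h : {ω : Fin m → ℝ | ω i = ω j} = (LinearMap.ker f : Set (Fin m → ℝ)) := by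
    ext ω; simp [f, sub_eq_zero]
  rw [h]
  apply Measure.addHaar_submodule
  intro htop
  have : f (Pi.single i 1) = 0 := by
    have : Pi.single i (1:ℝ) ∈ LinearMap.ker f := by rw [htop]; trivial
    exact this
  simp [f, hij.symm] at this

lemma spGood_ae {m : ℕ} : ∀ᵐ ω : Fin m → ℝ, ∀ i j, i ≠ j → ω i ≠ ω j := by
  rw [ae_all_iff]; intro i
  rw [ae_all_iff]; intro j
  by_cases h : i = j
  · simp [h]
  · rw [ae_iff]
    simpa [h] using volume_ne i j h

lemma volume_spGood {m : ℕ} (hm : m ≠ 0) (L : ℝ) :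
    volume (spGood L : Set (Fin m → ℝ)) = ENNReal.ofReal (max L 0 ^ m) := by
  have h1 : (spGood L : Set (Fin m → ℝ)) =ᵐ[volume] Set.pi Set.univ fun _ => Set.Ioo 0 L := by
    rw [eventuallyEq_set]
    filter_upwards [spGood_ae] with ω hω
    simp only [spGood, Set.mem_ofPred_eq, Set.mem_pi, Set.mem_univ, true_imp_iff, Set.mem_Ioo]
    constructor
    · exact fun h => h.2.1
    · intro h
      have := h ⟨0, Nat.pos_of_ne_zero hm⟩
      exact ⟨this.1.trans this.2, h, hω⟩
  rw [measure_congr h1, Real.volume_pi_Ioo]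
  simp only [sub_zero, Finset.prod_const, Finset.card_univ, Fintype.card_fin]
  rw [ENNReal.ofReal_pow (le_max_right _ _)]
  congr 1
  rcases le_total L 0 with h | h
  · simp [h, ENNReal.ofReal_of_nonpos]
  · simp [h]

lemma volume_spE {m : ℕ} (hm : m ≠ 0) (c : ℝ) (hc : 0 < c) (J : Finset (Option (Fin m))) :
    ∀ L, volume (spE c L J) = ENNReal.ofReal (max (L - J.card * c) 0 ^ m) := by
  classical
  induction J using Finset.induction_on with
  | empty => intro L; simpa [spE] using volume_spGood hm L
  | insert j J hj ih =>
    intro L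
    rw [spE_insert c hc L J j hj, volume_shear c hc j _ (spE_measurableSet _ _ _)
      (fun ω h => h.1), ih, Finset.card_insert_of_notMem hj]
    push_cast
    rw [show L - c - (J.card : ℝ) * c = L - (J.card + 1) * c by ring]

open Classical in
lemma bigSpacings_eq (n : ℕ) (ω : Fin (n - 1) → ℝ) (c : ℝ) (hω : ω ∈ spGood 1) :
    bigSpacings n ω c = (Finset.univ.filter fun x => spGap c 1 ω x).card := by
  have hinj := spPts_inj hω
  have hr : insert (0 : ℝ) (Set.range ω) = Set.range (spPts ω) := by
    ext x
    simp only [Set.mem_insert_iff, Set.mem_range, Option.exists, spPts, eq_comm]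
  have : {x ∈ insert (0 : ℝ) (Set.range ω) |
    sInf ((insert (0 : ℝ) (Set.range ω) ∪ {1}) ∩ Set.Ioi x) - x > c} =
      spPts ω '' (↑(Finset.univ.filter fun x => spGap c 1 ω x) : Set _) := by
    ext y
    simp only [hr, Set.mem_ofPred_eq, Set.mem_image, Finset.coe_filter, Finset.mem_univ, true_and]
    have key : ∀ x, sInf ((Set.range (spPts ω) ∪ {1}) ∩ Set.Ioi (spPts ω x)) - spPts ω x > c ↔
        spGap c 1 ω x := by
      intro x
      have hx1 : spPts ω x < 1 := by
        cases x with
        | none => simp [spPts]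
        | some i => exact (hω.2.1 i).2
      set S := (Set.range (spPts ω) ∪ {1}) ∩ Set.Ioi (spPts ω x) with hS
      have hfin : S.Finite := ((Set.finite_range _).union (Set.finite_singleton _)).inter_of_left _
      have hne : S.Nonempty := ⟨1, Or.inr rfl, hx1⟩
      have e : sInf S - spPts ω x > c ↔ ∀ s ∈ S, spPts ω x + c < s := by
        constructor
        · intro h s hs
          have := csInf_le hfin.bddBelow hs
          linarith
        · intro h
          have := h _ (hne.csInf_mem hfin)
          linarith
      rw [e]
      constructor
      · intro h
        exact ⟨h 1 ⟨Or.inr rfl, hx1⟩, fun i hi => h _ ⟨Or.inl ⟨some i, rfl⟩, hi⟩⟩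
      · rintro ⟨h1, h2⟩ s ⟨hs | hs, hs'⟩
        · obtain ⟨k, rfl⟩ := hs
          cases k with
          | some i => exact h2 i hs'
          | none =>
            exfalso
            have h0 : spPts ω x < 0 := hs'
            cases x with
            | none => exact lt_irrefl _ h0
            | some i => exact lt_asymm h0 (hω.2.1 i).1
        · rw [Set.mem_singleton_iff.1 hs]; exact h1
    constructor
    · rintro ⟨⟨x, rfl⟩, h⟩
      exact ⟨x, (key x).1 h, rfl⟩
    · rintro ⟨x, h, rfl⟩
      exact ⟨⟨x, rfl⟩, (key x).2 h⟩
  rw [bigSpacings, this, Set.ncard_image_of_injective _ hinj, Set.ncard_coe_finset]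



lemma iid_eq (n : ℕ) : iidUniform01 n =
    (volume : Measure (Fin (n-1) → ℝ)).restrict (Set.univ.pi fun _ => Set.Ioo 0 1) := by
  rw [iidUniform01, volume_pi, Measure.restrict_pi_pi]

instance iid_prob (n : ℕ) : IsProbabilityMeasure (iidUniform01 n) := by
  constructor
  rw [iid_eq, Measure.restrict_apply_univ, Real.volume_pi_Ioo]
  simp

lemma spGood_ae_eq {m : ℕ} :
    (Set.univ.pi fun _ => Set.Ioo 0 1 : Set (Fin m → ℝ)) =ᵐ[volume] spGood 1 := by
  rw [eventuallyEq_set]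
  filter_upwards [spGood_ae] with ω hω
  simp only [spGood, Set.mem_ofPred_eq, Set.mem_pi, Set.mem_univ, true_imp_iff, Set.mem_Ioo]
  exact ⟨fun h => ⟨one_pos, h, hω⟩, fun h => h.2.1⟩

lemma iid_eq' (n : ℕ) : iidUniform01 n =
    (volume : Measure (Fin (n-1) → ℝ)).restrict (spGood 1) := by
  rw [iid_eq, Measure.restrict_congr_set spGood_ae_eq]

lemma iid_ae (n : ℕ) : ∀ᵐ ω ∂(iidUniform01 n), ω ∈ spGood 1 := by
  rw [iid_eq']
  exact ae_restrict_mem (spGood_measurableSet _)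

open Classical in
lemma card_measurable {m : ℕ} (c : ℝ) :
    Measurable (fun ω : Fin m → ℝ => (Finset.univ.filter fun x => spGap c 1 ω x).card) := by
  simp_rw [Finset.card_filter]
  refine Finset.measurable_sum _ fun x _ => ?_
  exact Measurable.ite (spGap_measurableSet c 1 x) measurable_const measurable_const

lemma bigSpacings_aemeasurable (n : ℕ) (c : ℝ) :
    AEMeasurable (fun ω => bigSpacings n ω c) (iidUniform01 n) := by
  classical
  refine ⟨_, card_measurable c, ?_⟩
  filter_upwards [iid_ae n] with ω hω
  exact bigSpacings_eq n ω c hω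

lemma genfun (n : ℕ) (hn : 2 ≤ n) (c : ℝ) (hc : 0 < c) (z : ℂ) :
    ∫ ω, z ^ (bigSpacings n ω c) ∂(iidUniform01 n) =
      ∑ k ∈ Finset.range (n + 1), (n.choose k : ℂ) * (z - 1) ^ k *
        ((max (1 - k * c) 0 ^ (n - 1) : ℝ) : ℂ) := by
  classical
  have h1 : ∀ᵐ ω ∂(iidUniform01 n), z ^ (bigSpacings n ω c) =
      ∑ J ∈ (Finset.univ : Finset (Option (Fin (n-1)))).powerset,
        (spE c 1 J).indicator (fun _ => (z - 1) ^ J.card) ω := by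
    filter_upwards [iid_ae n] with ω hω
    rw [bigSpacings_eq n ω c hω, Finset.card_filter, ← Finset.prod_pow_eq_pow_sum]
    have : ∀ x, z ^ (if spGap c 1 ω x then 1 else 0) = 1 + if spGap c 1 ω x then z - 1 else 0 := by
      intro x; split_ifs <;> simp
    simp_rw [this]
    rw [Finset.prod_one_add]
    refine Finset.sum_congr rfl fun J _ => ?_
    by_cases h : ∀ x ∈ J, spGap c 1 ω x
    · rw [Set.indicator_of_mem (show ω ∈ spE c 1 J from ⟨hω, h⟩), Finset.prod_congr rfl
        (fun x hx => if_pos (h x hx)), Finset.prod_const]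
    · rw [Set.indicator_of_notMem (fun h' : ω ∈ spE c 1 J => h h'.2)]
      push Not at h
      obtain ⟨x, hx, hx'⟩ := h
      exact Finset.prod_eq_zero hx (if_neg hx')
  rw [integral_congr_ae h1, integral_finsetSum _ (fun J _ =>
    (integrable_const _).indicator (spE_measurableSet c 1 J))]
  have h2 : ∀ J : Finset (Option (Fin (n-1))), ∫ ω, (spE c 1 J).indicator (fun _ => (z - 1) ^ J.card) ω ∂(iidUniform01 n)
      = (z - 1) ^ J.card * ((max (1 - J.card * c) 0 ^ (n - 1) : ℝ) : ℂ) := by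
    intro J
    rw [integral_indicator (spE_measurableSet c 1 J), setIntegral_const, measureReal_def, iid_eq',
      Measure.restrict_apply (spE_measurableSet c 1 J),
      Set.inter_eq_left.2 (fun ω (h : ω ∈ spE c 1 J) => h.1), volume_spE (by omega) c hc J 1,
      ENNReal.toReal_ofReal (by positivity), Complex.real_smul, mul_comm]
  simp_rw [h2]
  rw [Finset.sum_powerset_apply_card (fun k => (z - 1) ^ k * ((max (1 - (k:ℝ) * c) 0 ^ (n - 1) : ℝ) : ℂ))]
  have : (Finset.univ : Finset (Option (Fin (n-1)))).card = n := by
    simp; omega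
  rw [this]
  refine Finset.sum_congr rfl fun k _ => ?_
  rw [nsmul_eq_mul]; ring



lemma pow_exp_integrable (k : ℕ) (s : ℂ) (hs : 0 < s.re) :
    IntegrableOn (fun t : ℝ => (t : ℂ) ^ k * Complex.exp (-(s * t))) (Set.Ioi 0) := by
  have h := integrableOn_rpow_mul_exp_neg_mul_rpow (p := 1) (s := k) (b := s.re)
    (by have : (0:ℝ) ≤ k := Nat.cast_nonneg k
        linarith) one_pos hs
  refine (integrable_norm_iff (by fun_prop)).1 ?_
  refine (integrableOn_congr_fun (fun t ht => ?_) measurableSet_Ioi).1 h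
  have ht : (0:ℝ) < t := ht
  simp only [norm_mul, norm_pow, Complex.norm_exp, Complex.norm_real, Real.norm_eq_abs,
    abs_of_pos ht, Real.rpow_natCast, Real.rpow_one]
  congr 2
  simp

lemma pow_exp_tendsto (k : ℕ) (s : ℂ) (hs : 0 < s.re) :
    Tendsto (fun t : ℝ => (t : ℂ) ^ k * Complex.exp (-(s * t))) atTop (𝓝 0) := by
  rw [tendsto_zero_iff_norm_tendsto_zero]
  have h := tendsto_rpow_mul_exp_neg_mul_atTop_nhds_zero k s.re hs
  refine h.congr' ?_
  filter_upwards [eventually_gt_atTop 0] with t ht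
  simp only [norm_mul, norm_pow, Complex.norm_exp, Complex.norm_real, Real.norm_eq_abs,
    abs_of_pos ht, Real.rpow_natCast]
  congr 2
  simp

lemma pow_exp_integral (k : ℕ) (s : ℂ) (hs : 0 < s.re) :
    ∫ t : ℝ in Set.Ioi 0, (t : ℂ) ^ k * Complex.exp (-(s * t)) = (k.factorial : ℂ) / s ^ (k + 1) := by
  have hs0 : s ≠ 0 := by rintro rfl; simp at hs
  have hexp : ∀ t : ℝ, HasDerivAt (fun t : ℝ => Complex.exp (-(s * t))) (-s * Complex.exp (-(s * t))) t := by
    intro t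
    have h1 : HasDerivAt (fun t : ℝ => -(s * (t : ℂ))) (-s) t := by
      simpa using! ((Complex.ofRealCLM.hasDerivAt (x := t)).const_mul s).neg
    simpa [mul_comm] using h1.cexp
  induction k with
  | zero =>
    have h := integral_Ioi_of_hasDerivAt_of_tendsto' (a := 0) (m := 0)
      (f := fun t : ℝ => Complex.exp (-(s * t))) (f' := fun t : ℝ => -s * Complex.exp (-(s * t)))
      (fun t _ => hexp t) (by
        have := (pow_exp_integrable 0 s hs).const_mul (-s)
        simpa using! this) (by simpa using pow_exp_tendsto 0 s hs)
    rw [integral_const_mul] at h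
    simp only [pow_zero, one_mul, Nat.factorial_zero, Nat.cast_one, zero_add, pow_one]
    field_simp
    simp at h
    linear_combination h
  | succ k ih =>
    have hd : ∀ t : ℝ, HasDerivAt (fun t : ℝ => (t : ℂ) ^ (k+1) * Complex.exp (-(s * t)))
        ((k + 1) * ((t : ℂ) ^ k * Complex.exp (-(s * t))) + -s * ((t : ℂ) ^ (k+1) * Complex.exp (-(s * t)))) t := by
      intro t
      have h1 : HasDerivAt (fun t : ℝ => (t : ℂ) ^ (k+1)) ((k + 1) * (t : ℂ) ^ k) t := by
        simpa using! (Complex.ofRealCLM.hasDerivAt (x := t)).pow (k+1)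
      have h2 := h1.mul (hexp t)
      have e : (k + 1) * ((t : ℂ) ^ k * Complex.exp (-(s * t))) + -s * ((t : ℂ) ^ (k+1) * Complex.exp (-(s * t))) =
        (k + 1) * (t : ℂ) ^ k * Complex.exp (-(s * t)) + (t : ℂ) ^ (k+1) * (-s * Complex.exp (-(s * t))) := by ring
      rw [e]
      exact h2
    have h := integral_Ioi_of_hasDerivAt_of_tendsto' (a := 0) (m := 0)
      (fun t _ => hd t) (((pow_exp_integrable k s hs).const_mul _).add
        ((pow_exp_integrable (k+1) s hs).const_mul _)) (pow_exp_tendsto (k+1) s hs)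
    rw [integral_add ((pow_exp_integrable k s hs).const_mul _)
        ((pow_exp_integrable (k+1) s hs).const_mul _), integral_const_mul, integral_const_mul, ih] at h
    simp only [Complex.ofReal_zero, ne_eq, Nat.add_eq_zero_iff, one_ne_zero, and_false,
      not_false_eq_true, zero_pow, zero_mul, sub_zero] at h
    rw [Nat.factorial_succ]
    push_cast
    field_simp at h ⊢
    linear_combination (-1) * h

lemma norm_one_add_I (y : ℝ) : ‖(1 : ℂ) + Complex.I * y‖ ^ 2 = 1 + y ^ 2 := by
  rw [← Complex.normSq_eq_norm_sq]
  simp [Complex.normSq_apply]; ring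

lemma one_add_I_ne (y : ℝ) : (1 : ℂ) + Complex.I * y ≠ 0 := by
  intro h
  have := norm_one_add_I y
  rw [h] at this
  simp at this
  nlinarith [sq_nonneg y]

lemma inv_pow_integrable (n : ℕ) (hn : 2 ≤ n) :
    Integrable (fun y : ℝ => 1 / ((1 : ℂ) + Complex.I * y) ^ n) := by
  refine integrable_inv_one_add_sq.mono' ?_ (ae_of_all _ fun y => ?_)
  · refine Continuous.aestronglyMeasurable ?_
    exact continuous_const.div (by fun_prop) (fun y => pow_ne_zero _ (one_add_I_ne y))
  · rw [norm_div, norm_pow, norm_one, one_div]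
    rw [← norm_one_add_I]
    gcongr ?_⁻¹
    · have := one_add_I_ne y
      positivity
    · refine pow_le_pow_right₀ ?_ hn
      have := norm_one_add_I y
      nlinarith [sq_nonneg y, norm_nonneg ((1 : ℂ) + Complex.I * y)]

open FourierTransform in
lemma gamma_inversion (n : ℕ) (hn : 2 ≤ n) (x : ℝ) :
    ∫ y : ℝ, Complex.exp (x * (1 + Complex.I * y)) / (1 + Complex.I * y) ^ n =
      2 * Real.pi / ((n - 1).factorial : ℂ) * ((max x 0 ^ (n - 1) : ℝ) : ℂ) := by
  obtain ⟨k, rfl⟩ : ∃ k, n = k + 1 := ⟨n - 1, by omega⟩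
  have hk : k ≠ 0 := by omega
  simp only [Nat.add_sub_cancel]
  let g : ℝ → ℂ := fun t => ((max t 0 : ℝ) : ℂ) ^ k * Complex.exp (-t)
  have hgi : ∀ t, g t = (Set.Ioi (0:ℝ)).indicator (fun t : ℝ => (t : ℂ) ^ k * Complex.exp (-(1 * t))) t := by
    intro t
    by_cases h : 0 < t
    · simp [g, Set.indicator, h, h.le]
    · simp [g, Set.indicator, h, not_lt.1 h, hk]
  have hgi' : g = (Set.Ioi (0:ℝ)).indicator (fun t : ℝ => (t : ℂ) ^ k * Complex.exp (-(1 * t))) := funext hgi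
  have hgc : Continuous g := by fun_prop
  have hint : Integrable g := by
    rw [hgi', integrable_indicator_iff measurableSet_Ioi]
    exact pow_exp_integrable k 1 (by simp)
  have hF : 𝓕 g = fun ξ : ℝ => (k.factorial : ℂ) * (1 / (1 + Complex.I * ((2 * Real.pi * ξ : ℝ) : ℂ)) ^ (k + 1)) := by
    ext ξ
    rw [Real.fourier_real_eq_integral_exp_smul]
    have : ∀ v : ℝ, Complex.exp (↑(-2 * Real.pi * v * ξ) * Complex.I) • g v =
        (Set.Ioi (0:ℝ)).indicator (fun t : ℝ => (t : ℂ) ^ k *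
          Complex.exp (-((1 + Complex.I * ((2 * Real.pi * ξ : ℝ) : ℂ)) * t))) v := by
      intro v
      rw [hgi]
      by_cases h : 0 < v
      · simp only [Set.indicator, Set.mem_Ioi, h, if_true, smul_eq_mul]
        rw [mul_left_comm, ← Complex.exp_add]
        congr 2
        push_cast
        ring
      · simp [Set.indicator, h]
    simp_rw [this]
    rw [integral_indicator measurableSet_Ioi, pow_exp_integral k _ (by simp)]
    ring
  have hFi : Integrable (𝓕 g) := by
    rw [hF]
    have := (inv_pow_integrable (k+1) hn).comp_mul_left' (R := 2 * Real.pi) (by positivity)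
    exact this.const_mul _
  have hinv := congrFun (hgc.fourierInv_fourier_eq hint hFi) x
  rw [Real.fourierInv_eq_fourier_neg, Real.fourier_real_eq_integral_exp_smul, hF] at hinv
  have hcomp := Measure.integral_comp_mul_left (fun y : ℝ => Complex.exp (x * (1 + Complex.I * y)) / (1 + Complex.I * y) ^ (k+1)) (2 * Real.pi)
  have e : ∀ v : ℝ, Complex.exp (↑(-2 * Real.pi * v * -x) * Complex.I) •
      ((k.factorial : ℂ) * (1 / (1 + Complex.I * ((2 * Real.pi * v : ℝ) : ℂ)) ^ (k + 1))) =
      (k.factorial * Complex.exp (-x)) * (Complex.exp (x * (1 + Complex.I * ((2 * Real.pi * v : ℝ) : ℂ))) / (1 + Complex.I * ((2 * Real.pi * v : ℝ) : ℂ)) ^ (k+1)) := by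
    intro v
    rw [smul_eq_mul, show Complex.exp (↑(-2 * Real.pi * v * -x) * Complex.I) = Complex.exp (-x) * Complex.exp (x * (1 + Complex.I * ((2 * Real.pi * v : ℝ) : ℂ))) by
      rw [← Complex.exp_add]; congr 1; push_cast; ring]
    ring
  simp_rw [e] at hinv
  rw [integral_const_mul, hcomp] at hinv
  have hpi : (0:ℝ) < 2 * Real.pi := by positivity
  rw [abs_of_pos (inv_pos.2 hpi), Complex.real_smul] at hinv
  have hgx : g x = ((max x 0 ^ k : ℝ) : ℂ) * Complex.exp (-x) := by simp [g]
  rw [hgx] at hinv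
  have he : Complex.exp (-(x:ℂ)) ≠ 0 := Complex.exp_ne_zero _
  have hf : (k.factorial : ℂ) ≠ 0 := by exact_mod_cast k.factorial_ne_zero
  have hpi' : (Real.pi : ℂ) ≠ 0 := by exact_mod_cast Real.pi_ne_zero
  push_cast at hinv ⊢
  set Q := ∫ y : ℝ, Complex.exp (x * (1 + Complex.I * y)) / (1 + Complex.I * y) ^ (k+1)
  field_simp at hinv ⊢
  linear_combination hinv



/-- The basic one-summand transform. -/
def spH (a : ℝ) (τ : ℂ) (y : ℝ) : ℂ :=
  Complex.exp (Complex.I * y) *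
    ((1 + (Complex.exp τ - 1) * (Real.exp (-a) * Complex.exp (Complex.I * ((-(a * y) : ℝ) : ℂ)))) *
      Complex.exp (-(τ * Real.exp (-a)))) / (1 + Complex.I * y)

lemma exp_div_integrable (n : ℕ) (hn : 2 ≤ n) (x : ℝ) :
    Integrable (fun y : ℝ => Complex.exp (x * (1 + Complex.I * y)) / (1 + Complex.I * y) ^ n) := by
  have h := (inv_pow_integrable n hn).bdd_mul (c := Real.exp x)
    (f := fun y : ℝ => Complex.exp (x * (1 + Complex.I * y)))
    (by fun_prop) (ae_of_all _ fun y => by rw [Complex.norm_exp]; simp)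
  simpa [div_eq_mul_inv] using! h

lemma mgf_formula (a : ℝ) (ha : 0 < a) (n : ℕ) (hn : 2 ≤ n) :
    ∃ K : ℂ, ∀ θ : ℂ, ∫ ω, Complex.exp (θ * (((Real.sqrt n)⁻¹ *
          ((bigSpacings n ω (a / n) : ℝ) - n * Real.exp (-a)) : ℝ) : ℂ)) ∂(iidUniform01 n) =
        K * ∫ u : ℝ, spH a (θ / Real.sqrt n) (u / Real.sqrt n) ^ n := by
  have hn0 : (0:ℝ) < n := by exact_mod_cast (by omega : 0 < n)
  have hnC : (n : ℂ) ≠ 0 := by exact_mod_cast hn0.ne'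
  have hs0 : 0 < Real.sqrt n := Real.sqrt_pos.2 hn0
  have hsC : (Real.sqrt n : ℂ) ≠ 0 := by exact_mod_cast hs0.ne'
  have hsq : (Real.sqrt n : ℂ) * Real.sqrt n = n := by
    exact_mod_cast Real.mul_self_sqrt hn0.le
  have hpi' : (Real.pi : ℂ) ≠ 0 := by exact_mod_cast Real.pi_ne_zero
  have hfac : (((n-1).factorial : ℕ) : ℂ) ≠ 0 := by exact_mod_cast (n-1).factorial_ne_zero
  let K0 : ℂ := ((n-1).factorial : ℂ) / (2 * Real.pi * (n : ℂ) ^ (n - 1))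
  refine ⟨K0 * Complex.exp 1 ^ n * (Real.sqrt n : ℂ)⁻¹, fun θ => ?_⟩
  set τ : ℂ := θ / Real.sqrt n with hτ
  have h1 : ∀ ω : Fin (n-1) → ℝ, Complex.exp (θ * (((Real.sqrt n)⁻¹ *
          ((bigSpacings n ω (a / n) : ℝ) - n * Real.exp (-a)) : ℝ) : ℂ)) =
      Complex.exp (-(τ * Real.exp (-a))) ^ n * Complex.exp τ ^ (bigSpacings n ω (a / n)) := by
    intro ω
    rw [← Complex.exp_nat_mul, ← Complex.exp_nat_mul, ← Complex.exp_add]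
    congr 1
    rw [hτ]
    push_cast
    field_simp
    ring
  simp_rw [h1]
  rw [integral_const_mul, genfun n hn (a / n) (by positivity)]
  have h2 : ∀ k : ℕ, ((max (1 - k * (a / n)) 0 ^ (n - 1) : ℝ) : ℂ) =
      K0 * ∫ y : ℝ, Complex.exp (((n - k * a : ℝ) : ℂ) * (1 + Complex.I * y)) / (1 + Complex.I * y) ^ n := by
    intro k
    rw [gamma_inversion n hn]
    have e : max (1 - k * (a / n)) 0 = max (n - k * a) 0 / n := by
      rw [← max_div_div_right hn0.le, zero_div]
      congr 1
      field_simp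
    rw [e, div_pow]
    simp only [K0]
    push_cast
    field_simp
  simp_rw [h2]
  have h3 : ∀ k : ℕ, (n.choose k : ℂ) * (Complex.exp τ - 1) ^ k *
      (K0 * ∫ y : ℝ, Complex.exp (((n - k * a : ℝ) : ℂ) * (1 + Complex.I * y)) / (1 + Complex.I * y) ^ n) =
      K0 * ∫ y : ℝ, (n.choose k : ℂ) * (Complex.exp τ - 1) ^ k *
        (Complex.exp (((n - k * a : ℝ) : ℂ) * (1 + Complex.I * y)) / (1 + Complex.I * y) ^ n) := by
    intro k
    rw [integral_const_mul]; ring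
  simp_rw [h3]
  rw [← Finset.mul_sum, ← integral_finsetSum _ (fun k _ => (exp_div_integrable n hn _).const_mul _)]
  have h4 : ∀ y : ℝ, Complex.exp (-(τ * Real.exp (-a))) ^ n * ∑ k ∈ Finset.range (n+1), (n.choose k : ℂ) * (Complex.exp τ - 1) ^ k *
        (Complex.exp (((n - k * a : ℝ) : ℂ) * (1 + Complex.I * y)) / (1 + Complex.I * y) ^ n) =
      Complex.exp 1 ^ n * spH a τ y ^ n := by
    intro y
    have hsum : ∑ k ∈ Finset.range (n+1), (n.choose k : ℂ) * (Complex.exp τ - 1) ^ k *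
        (Complex.exp (((n - k * a : ℝ) : ℂ) * (1 + Complex.I * y)) / (1 + Complex.I * y) ^ n) =
        (Complex.exp (1 + Complex.I * y) * (1 + (Complex.exp τ - 1) * Complex.exp (-a * (1 + Complex.I * y)))
          / (1 + Complex.I * y)) ^ n := by
      rw [add_comm (1:ℂ) ((Complex.exp τ - 1) * _), div_pow, mul_pow,
        add_pow ((Complex.exp τ - 1) * Complex.exp (-a * (1 + Complex.I * y))) 1 n, Finset.mul_sum, Finset.sum_div]
      refine Finset.sum_congr rfl fun k _ => ?_
      have : Complex.exp (((n - k * a : ℝ) : ℂ) * (1 + Complex.I * y)) =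
        Complex.exp (1 + Complex.I * y) ^ n * Complex.exp (-a * (1 + Complex.I * y)) ^ k := by
        rw [← Complex.exp_nat_mul, ← Complex.exp_nat_mul, ← Complex.exp_add]
        congr 1
        push_cast; ring
      rw [this, mul_pow, one_pow]
      ring
    rw [hsum, ← mul_pow, ← mul_pow]
    congr 1
    have e1 : Complex.exp (-a * (1 + Complex.I * y)) =
        Real.exp (-a) * Complex.exp (Complex.I * ((-(a * y) : ℝ) : ℂ)) := by
      rw [Complex.ofReal_exp, ← Complex.exp_add]; congr 1; push_cast; ring
    rw [spH, e1, Complex.exp_add]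
    ring
  have hcomp := Measure.integral_comp_div (fun y : ℝ => spH a τ y ^ n) (Real.sqrt n)
  rw [hcomp, abs_of_pos hs0, Complex.real_smul]
  rw [mul_left_comm, ← integral_const_mul]
  simp_rw [h4]
  rw [integral_const_mul]
  field_simp

lemma exp_second_order (α : ℂ) :
    Tendsto (fun n : ℕ => (n : ℂ) * (Complex.exp (α / Real.sqrt n) - 1 - α / Real.sqrt n)) atTop
      (𝓝 (α ^ 2 / 2)) := by
  rw [tendsto_iff_norm_sub_tendsto_zero]
  have hlim : Tendsto (fun n : ℕ => ‖α‖ ^ 3 * Real.exp ‖α‖ * (Real.sqrt n)⁻¹) atTop (𝓝 0) := by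
    have : Tendsto (fun n : ℕ => (Real.sqrt n)⁻¹) atTop (𝓝 0) :=
      tendsto_inv_atTop_zero.comp (Real.tendsto_sqrt_atTop.comp tendsto_natCast_atTop_atTop)
    simpa using this.const_mul (‖α‖ ^ 3 * Real.exp ‖α‖)
  refine squeeze_zero' (Eventually.of_forall fun n => norm_nonneg _) ?_ hlim
  filter_upwards [eventually_ge_atTop 1] with n hn
  have hn0 : (1:ℝ) ≤ n := by exact_mod_cast hn
  have hs1 : 1 ≤ Real.sqrt n := Real.one_le_sqrt.2 hn0
  have hs0 : 0 < Real.sqrt n := by linarith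
  have hsC : (Real.sqrt n : ℂ) ≠ 0 := by exact_mod_cast hs0.ne'
  have hsqR : Real.sqrt n * Real.sqrt n = n := Real.mul_self_sqrt (by linarith)
  have hsq : (Real.sqrt n : ℂ) * Real.sqrt n = n := by
    exact_mod_cast hsqR
  have hb := Complex.norm_exp_sub_sum_le_norm_mul_exp (α / Real.sqrt n) 3
  have e : (n : ℂ) * (Complex.exp (α / Real.sqrt n) - 1 - α / Real.sqrt n) - α ^ 2 / 2 =
      n * (Complex.exp (α / Real.sqrt n) - ∑ m ∈ Finset.range 3, (α / Real.sqrt n) ^ m / m.factorial) := by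
    generalize (Real.sqrt n : ℂ) = s at hsC hsq
    simp only [Finset.sum_range_succ, Finset.sum_range_zero, Nat.factorial]
    push_cast
    rw [← hsq]
    field_simp
    ring
  rw [e, norm_mul, Complex.norm_natCast]
  have hnorm : ‖α / Real.sqrt n‖ = ‖α‖ / Real.sqrt n := by
    rw [norm_div, Complex.norm_real, Real.norm_of_nonneg hs0.le]
  rw [hnorm] at hb
  have hle : ‖α‖ / Real.sqrt n ≤ ‖α‖ := div_le_self (norm_nonneg _) hs1
  calc (n:ℝ) * ‖Complex.exp (α / Real.sqrt n) - ∑ m ∈ Finset.range 3, (α / Real.sqrt n) ^ m / m.factorial‖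
      ≤ n * ((‖α‖ / Real.sqrt n) ^ 3 * Real.exp (‖α‖ / Real.sqrt n)) := by gcongr
    _ ≤ n * ((‖α‖ / Real.sqrt n) ^ 3 * Real.exp ‖α‖) := by gcongr
    _ = ‖α‖ ^ 3 * Real.exp ‖α‖ * (Real.sqrt n)⁻¹ := by
      generalize Real.sqrt n = s at hs0 hsqR
      rw [← hsqR]; field_simp

lemma spH_tendsto (a : ℝ) (θ : ℂ) (u : ℝ) :
    Tendsto (fun n : ℕ => spH a (θ / Real.sqrt n) (u / Real.sqrt n) ^ n) atTop
      (𝓝 (Complex.exp (-(1/2) * (u:ℂ) ^ 2 + (-(Complex.I * θ * a * Real.exp (-a))) * u +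
        θ ^ 2 * (Real.exp (-a) * (1 - Real.exp (-a))) / 2))) := by
  set p : ℂ := (Real.exp (-a) : ℂ) with hp
  set α : ℂ := Complex.I * u - θ * p with hα
  set β : ℂ := α + θ - Complex.I * a * u with hβ
  set γ : ℂ := α - Complex.I * a * u with hγ
  have hw : Tendsto (fun n : ℕ => (1 : ℂ) + Complex.I * ((u / Real.sqrt n : ℝ) : ℂ)) atTop (𝓝 1) := by
    have : Tendsto (fun n : ℕ => u / Real.sqrt n) atTop (𝓝 0) :=
      tendsto_const_nhds.div_atTop (Real.tendsto_sqrt_atTop.comp tendsto_natCast_atTop_atTop)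
    have := ((Complex.continuous_ofReal.tendsto 0).comp this).const_mul Complex.I
    simpa using this.const_add 1
  have hN := (((exp_second_order α).add ((exp_second_order β).const_mul p)).sub
    ((exp_second_order γ).const_mul p)).div hw one_ne_zero
  have hmain : Tendsto (fun n : ℕ => (n : ℂ) * (spH a (θ / Real.sqrt n) (u / Real.sqrt n) - 1)) atTop
      (𝓝 (-(1/2) * (u:ℂ) ^ 2 + (-(Complex.I * θ * a * p)) * u + θ ^ 2 * (p * (1 - p)) / 2)) := by
    have hval : (α ^ 2 / 2 + p * (β ^ 2 / 2) - p * (γ ^ 2 / 2)) / 1 =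
        -(1/2) * (u:ℂ) ^ 2 + (-(Complex.I * θ * a * p)) * u + θ ^ 2 * (p * (1 - p)) / 2 := by
      rw [hβ, hγ, hα]
      linear_combination (u:ℂ)^2 / 2 * Complex.I_sq
    rw [← hval]
    refine hN.congr fun n => ?_
    have hne := one_add_I_ne (u / Real.sqrt n)
    have eβ : Complex.exp (β / Real.sqrt n) = Complex.exp (α / Real.sqrt n) * Complex.exp (θ / Real.sqrt n) *
        Complex.exp (Complex.I * ((-(a * (u / Real.sqrt n)) : ℝ) : ℂ)) := by
      rw [← Complex.exp_add, ← Complex.exp_add]; congr 1; rw [hβ]; push_cast; ring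
    have eγ : Complex.exp (γ / Real.sqrt n) = Complex.exp (α / Real.sqrt n) *
        Complex.exp (Complex.I * ((-(a * (u / Real.sqrt n)) : ℝ) : ℂ)) := by
      rw [← Complex.exp_add]; congr 1; rw [hγ]; push_cast; ring
    have eα : Complex.exp (α / Real.sqrt n) = Complex.exp (Complex.I * ((u / Real.sqrt n : ℝ) : ℂ)) *
        Complex.exp (-(θ / Real.sqrt n * p)) := by
      rw [← Complex.exp_add]; congr 1; rw [hα]; push_cast; ring
    rw [spH, ← hp, div_sub_one hne, ← mul_div_assoc]
    simp only [Pi.div_apply]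
    congr 1
    rw [eβ, eγ, eα]
    have hlin : β / Real.sqrt n = α / Real.sqrt n + θ / Real.sqrt n - Complex.I * a * (u / Real.sqrt n) := by
      rw [hβ]; ring
    have hlin2 : γ / Real.sqrt n = α / Real.sqrt n - Complex.I * a * (u / Real.sqrt n) := by
      rw [hγ]; ring
    have hlin3 : α / Real.sqrt n = Complex.I * ((u / Real.sqrt n : ℝ) : ℂ) - θ / Real.sqrt n * p := by
      rw [hα]; push_cast; ring
    rw [hlin, hlin2, hlin3]
    ring
  have := Complex.tendsto_one_add_pow_exp_of_tendsto hmain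
  simpa using this



lemma spW_norm_le (a : ℝ) (ha : 0 < a) (τ : ℂ) (hτ : ‖τ‖ ≤ 1) (y : ℝ) :
    ‖(1 + (Complex.exp τ - 1) * (Real.exp (-a) * Complex.exp (Complex.I * ((-(a * y) : ℝ) : ℂ)))) *
      Complex.exp (-(τ * Real.exp (-a)))‖ ≤
      Real.exp (6 * ‖τ‖ ^ 2 + 6 * ‖τ‖ * ‖Complex.exp (Complex.I * ((-(a * y) : ℝ) : ℂ)) - 1‖) := by
  set E := Complex.exp (Complex.I * ((-(a * y) : ℝ) : ℂ)) with hE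
  have hp0 : 0 ≤ Real.exp (-a) := (Real.exp_pos _).le
  have hp1 : Real.exp (-a) ≤ 1 := by rw [Real.exp_le_one_iff]; linarith
  generalize Real.exp (-a) = p at hp0 hp1
  have hpn : ‖(p:ℂ)‖ = p := by rw [Complex.norm_real, Real.norm_of_nonneg hp0]
  have hτp : ‖-(τ * p)‖ ≤ ‖τ‖ := by
    rw [norm_neg, norm_mul, hpn]; exact mul_le_of_le_one_right (norm_nonneg _) hp1
  set q := Complex.exp (-(τ * p)) with hq
  have hr1 : ‖q - 1 - (-(τ * p))‖ ≤ ‖τ‖ ^ 2 := by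
    refine (Complex.norm_exp_sub_one_sub_id_le (hτp.trans hτ)).trans ?_
    gcongr
  have hr2 : ‖Complex.exp τ - 1 - τ‖ ≤ ‖τ‖ ^ 2 := Complex.norm_exp_sub_one_sub_id_le hτ
  have he1 : ‖Complex.exp τ - 1‖ ≤ 2 * ‖τ‖ := Complex.norm_exp_sub_one_le hτ
  have hqn : ‖q‖ ≤ 3 := by
    have : ‖q - 1‖ ≤ 2 * ‖-(τ * p)‖ := Complex.norm_exp_sub_one_le (hτp.trans hτ)
    have h2 : ‖q‖ ≤ ‖q - 1‖ + 1 := by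
      simpa using norm_add_le (q - 1) 1
    linarith
  have key : (1 + (Complex.exp τ - 1) * (p * E)) * q =
      1 + ((q * p * (Complex.exp τ - 1 - τ)) + (-(τ ^ 2 * p ^ 2)) + ((q - 1 - (-(τ * p))) * (1 + p * τ))
        + q * (Complex.exp τ - 1) * p * (E - 1)) := by ring
  rw [key]
  have b1 : ‖q * p * (Complex.exp τ - 1 - τ)‖ ≤ 3 * 1 * ‖τ‖ ^ 2 := by
    rw [norm_mul, norm_mul, hpn]; gcongr
  have b2 : ‖-(τ ^ 2 * (p:ℂ) ^ 2)‖ ≤ ‖τ‖ ^ 2 := by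
    rw [norm_neg, norm_mul, norm_pow, norm_pow, hpn]
    exact mul_le_of_le_one_right (by positivity) (pow_le_one₀ hp0 hp1)
  have b3 : ‖(q - 1 - (-(τ * p))) * (1 + p * τ)‖ ≤ ‖τ‖ ^ 2 * 2 := by
    rw [norm_mul]
    gcongr
    refine (norm_add_le _ _).trans ?_
    rw [norm_mul, hpn, norm_one]
    nlinarith [norm_nonneg τ]
  have b4 : ‖q * (Complex.exp τ - 1) * p * (E - 1)‖ ≤ 3 * (2 * ‖τ‖) * 1 * ‖E - 1‖ := by
    rw [norm_mul, norm_mul, norm_mul, hpn]; gcongr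
  refine le_trans ?_ (Real.add_one_le_exp _)
  refine (norm_add_le _ _).trans ?_
  have c1 := norm_add₃_le (a := q * p * (Complex.exp τ - 1 - τ)) (b := (-(τ ^ 2 * p ^ 2))) (c := ((q - 1 - (-(τ * p))) * (1 + p * τ)))
  have c2 := norm_add_le ((q * p * (Complex.exp τ - 1 - τ)) + (-(τ ^ 2 * p ^ 2)) + ((q - 1 - (-(τ * p))) * (1 + p * τ)))
     (q * (Complex.exp τ - 1) * p * (E - 1))
  rw [norm_one]
  linarith

/-- `(1+y²) ^ n ≥ exp (n y² / 2)` for `|y| ≤ 1`. -/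
lemma one_add_sq_ge (t : ℝ) (h0 : 0 ≤ t) (h1 : t ≤ 1) : Real.exp (t / 2) ≤ 1 + t := by
  have h := Real.exp_bound_div_one_sub_of_interval (x := t / 2) (by linarith) (by linarith)
  refine h.trans ?_
  rw [div_le_iff₀ (by linarith)]
  nlinarith

lemma spH_norm_le (a : ℝ) (ha : 0 < a) (θ : ℂ) (n : ℕ) (hn : 2 ≤ n) (hT : ‖θ‖ ≤ Real.sqrt n)
    (hbig : 12 * ‖θ‖ * Real.sqrt n + 2 * Real.sqrt n ≤ ((n:ℝ) - 2) / 4) (u : ℝ) :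
    ‖spH a (θ / Real.sqrt n) (u / Real.sqrt n) ^ n‖ ≤
      Real.exp (6 * ‖θ‖ ^ 2) * (Real.exp (2 * (6 * ‖θ‖ * a) ^ 2) * Real.exp (-(1/8) * u ^ 2) + (1 + u ^ 2)⁻¹) := by
  have hn0 : (2:ℝ) ≤ n := by exact_mod_cast hn
  set s := Real.sqrt n with hs
  have hs0 : 0 < s := Real.sqrt_pos.2 (by linarith)
  have hss : s ^ 2 = n := Real.sq_sqrt (by linarith)
  set T := ‖θ‖ with hTdef
  have hT0 : 0 ≤ T := norm_nonneg _
  have hτn : ‖θ / (s:ℂ)‖ = T / s := by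
    rw [norm_div, Complex.norm_real, Real.norm_of_nonneg hs0.le]
  set y := u / s with hy
  have hτ1 : ‖θ / (s:ℂ)‖ ≤ 1 := by rw [hτn]; exact div_le_one_of_le₀ hT hs0.le
  have hW := spW_norm_le a ha (θ / s) hτ1 y
  set m := ‖Complex.exp (Complex.I * ((-(a * y) : ℝ) : ℂ)) - 1‖ with hm
  have hm0 : 0 ≤ m := norm_nonneg _
  have hm1 : m ≤ a * |y| := by
    refine (Real.norm_exp_I_mul_ofReal_sub_one_le).trans ?_
    rw [norm_neg, norm_mul, Real.norm_of_nonneg ha.le, Real.norm_eq_abs]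
  have hm2 : m ≤ 2 := by
    refine (norm_sub_le _ _).trans ?_
    rw [mul_comm, Complex.norm_exp_ofReal_mul_I, norm_one]; norm_num
  have hEn : ‖Complex.exp (Complex.I * (y:ℂ))‖ = 1 := by
    rw [mul_comm, Complex.norm_exp_ofReal_mul_I]
  set D := ‖(1:ℂ) + Complex.I * y‖ with hD
  have hD2 : D ^ 2 = 1 + y ^ 2 := norm_one_add_I y
  have hD1 : 1 ≤ D := by
    have : 0 ≤ D := norm_nonneg _
    nlinarith [sq_nonneg y]
  have hy2 : (n:ℝ) * y ^ 2 = u ^ 2 := by rw [hy, ← hss]; field_simp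
  have hmain : ‖spH a (θ / s) y ^ n‖ ≤ Real.exp (6 * T ^ 2 + 6 * T * s * m) / D ^ n := by
    rw [spH, norm_pow, norm_div, norm_mul, hEn, one_mul, div_pow]
    refine div_le_div_of_nonneg_right ?_ (by positivity)
    refine (pow_le_pow_left₀ (norm_nonneg _) hW n).trans ?_
    rw [← Real.exp_nat_mul, hτn, ← hss]
    refine (Real.exp_le_exp.2 (le_of_eq ?_))
    field_simp
  refine hmain.trans ?_
  rw [Real.exp_add, mul_div_assoc]
  refine mul_le_mul_of_nonneg_left ?_ (Real.exp_pos _).le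
  rcases le_total |y| 1 with hle | hge
  · have hy1 : y ^ 2 ≤ 1 := by rw [← sq_abs]; exact pow_le_one₀ (abs_nonneg _) hle
    have hDn : Real.exp (u ^ 2 / 4) ≤ D ^ n := by
      have h1 := one_add_sq_ge (y^2) (sq_nonneg _) hy1
      rw [← hD2] at h1
      have h2 : Real.exp (y ^ 2 / 4) ≤ D := by
        refine (pow_le_pow_iff_left₀ (Real.exp_pos _).le (by linarith) two_ne_zero).1 ?_
        rw [← Real.exp_nat_mul]
        refine le_trans (le_of_eq ?_) h1
        congr 1; push_cast; ring
      refine le_trans (le_of_eq ?_) (pow_le_pow_left₀ (Real.exp_pos _).le h2 n)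
      rw [← Real.exp_nat_mul, ← hy2]; congr 1; ring
    have hsm : s * m ≤ a * |u| := by
      have : s * |y| = |u| := by
        rw [hy, abs_div, abs_of_pos hs0]; field_simp
      calc s * m ≤ s * (a * |y|) := by gcongr
        _ = a * |u| := by rw [← this]; ring
    refine le_trans ?_ (le_add_of_nonneg_right (by positivity))
    rw [div_le_iff₀ (by positivity), ← Real.exp_add]
    refine le_trans ?_ (mul_le_mul_of_nonneg_left hDn (Real.exp_pos _).le)
    rw [← Real.exp_add]
    apply Real.exp_le_exp.2
    have h3 : 6 * T * s * m ≤ (6 * T * a) * |u| := by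
      have := mul_le_mul_of_nonneg_left hsm (by positivity : 0 ≤ 6 * T)
      nlinarith
    have h4 : u ^ 2 = |u| ^ 2 := (sq_abs u).symm
    rw [h4]
    nlinarith [sq_nonneg (|u| - 4 * (6 * T * a))]
  · have hy1 : 1 ≤ y ^ 2 := by rw [← sq_abs]; exact one_le_pow₀ hge
    have hDn : (1 + y ^ 2) * Real.exp ((n - 2) / 4) ≤ D ^ n := by
      have h1 := one_add_sq_ge 1 zero_le_one le_rfl
      have h2 : Real.exp (1 / 4) ≤ D := by
        refine (pow_le_pow_iff_left₀ (Real.exp_pos _).le (by linarith) two_ne_zero).1 ?_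
        rw [← Real.exp_nat_mul, hD2]
        refine le_trans (le_of_eq ?_) (h1.trans (by linarith))
        congr 1; push_cast; ring
      obtain ⟨k, rfl⟩ := Nat.exists_eq_add_of_le hn
      rw [pow_add, hD2]
      refine mul_le_mul_of_nonneg_left ?_ (by positivity)
      refine le_trans (le_of_eq ?_) (pow_le_pow_left₀ (Real.exp_pos _).le h2 k)
      rw [← Real.exp_nat_mul]; congr 1; push_cast; ring
    refine le_trans ?_ (le_add_of_nonneg_left (by positivity))
    rw [div_le_iff₀ (by positivity), ← div_eq_inv_mul, le_div_iff₀ (by positivity)]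
    refine le_trans ?_ hDn
    have h5 : (n:ℝ) ≤ Real.exp (2 * s) := by
      have : s ≤ Real.exp s := by linarith [Real.add_one_le_exp s]
      calc (n:ℝ) = s ^ 2 := hss.symm
        _ ≤ Real.exp s ^ 2 := by gcongr
        _ = _ := by rw [← Real.exp_nat_mul]; norm_num
    have h6 : 1 + u ^ 2 ≤ n * (1 + y ^ 2) := by rw [← hy2]; linarith
    calc Real.exp (6 * T * s * m) * (1 + u ^ 2) ≤ Real.exp (6 * T * s * 2) * (Real.exp (2 * s) * (1 + y ^ 2)) := by
          gcongr
          exact h6.trans (by gcongr)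
      _ = (1 + y ^ 2) * Real.exp (12 * T * s + 2 * s) := by rw [Real.exp_add]; ring_nf
      _ ≤ _ := by gcongr



lemma spH_eventually (T : ℝ) : ∀ᶠ n : ℕ in atTop, 2 ≤ n ∧ T ≤ Real.sqrt n ∧
    12 * T * Real.sqrt n + 2 * Real.sqrt n ≤ ((n:ℝ) - 2) / 4 := by
  have h := (Real.tendsto_sqrt_atTop.comp tendsto_natCast_atTop_atTop).eventually_ge_atTop
    (max T (4 * (12 * T + 2) + 2))
  filter_upwards [h, eventually_ge_atTop 2] with n hn h2
  have hn' : max T (4 * (12 * T + 2) + 2) ≤ Real.sqrt n := hn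
  have h1 := (le_max_left _ _).trans hn'
  have h3 := (le_max_right _ _).trans hn'
  have hn0 : (2:ℝ) ≤ n := by exact_mod_cast h2
  have hss : Real.sqrt n ^ 2 = n := Real.sq_sqrt (by linarith)
  have hs1 : 1 ≤ Real.sqrt n := Real.one_le_sqrt.2 (by linarith)
  refine ⟨h2, h1, ?_⟩
  nlinarith

lemma spI_tendsto (a : ℝ) (ha : 0 < a) (θ : ℂ) :
    Tendsto (fun n : ℕ => ∫ u : ℝ, spH a (θ / Real.sqrt n) (u / Real.sqrt n) ^ n) atTop
      (𝓝 (((Real.pi : ℂ) / -(-(1/2))) ^ (1 / 2 : ℂ) *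
        Complex.exp (θ ^ 2 * ((Real.exp (-a) - Real.exp (-2 * a) - a ^ 2 * Real.exp (-2 * a) : ℝ) : ℂ) / 2))) := by
  have hI := integral_cexp_quadratic (b := -(1/2 : ℂ)) (by norm_num) (-(Complex.I * θ * a * Real.exp (-a)))
    (θ ^ 2 * (Real.exp (-a) * (1 - Real.exp (-a))) / 2)
  have hval : θ ^ 2 * (Real.exp (-a) * (1 - Real.exp (-a))) / 2 -
      (-(Complex.I * θ * a * Real.exp (-a))) ^ 2 / (4 * -(1/2 : ℂ)) =
      θ ^ 2 * ((Real.exp (-a) - Real.exp (-2 * a) - a ^ 2 * Real.exp (-2 * a) : ℝ) : ℂ) / 2 := by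
    have e2 : Real.exp (-2 * a) = Real.exp (-a) ^ 2 := by
      rw [← Real.exp_nat_mul]; congr 1; push_cast; ring
    rw [e2]
    push_cast
    generalize (Complex.exp (-(a:ℂ))) = p
    linear_combination (θ ^ 2 * a ^ 2 * p ^ 2 / 2) * Complex.I_sq
  rw [hval] at hI
  rw [← hI]
  refine tendsto_integral_filter_of_dominated_convergence
    (fun u => Real.exp (6 * ‖θ‖ ^ 2) * (Real.exp (2 * (6 * ‖θ‖ * a) ^ 2) * Real.exp (-(1/8) * u ^ 2) + (1 + u ^ 2)⁻¹))
    ?_ ?_ ?_ ?_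
  · refine Eventually.of_forall fun n => ?_
    have : Continuous fun u : ℝ => spH a (θ / Real.sqrt n) (u / Real.sqrt n) ^ n := by
      unfold spH
      refine Continuous.pow (Continuous.div (by fun_prop) (by fun_prop) fun u => one_add_I_ne _) _
    exact this.aestronglyMeasurable
  · filter_upwards [spH_eventually ‖θ‖] with n hn
    exact ae_of_all _ fun u => spH_norm_le a ha θ n hn.1 hn.2.1 hn.2.2 u
  · refine Integrable.const_mul (Integrable.add (Integrable.const_mul ?_ _) integrable_inv_one_add_sq) _
    exact integrable_exp_neg_mul_sq (by norm_num)
  · exact ae_of_all _ fun u => spH_tendsto a θ u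

lemma mgf_tendsto (a : ℝ) (ha : 0 < a) (θ : ℂ) :
    Tendsto (fun n : ℕ => ∫ ω, Complex.exp (θ * (((Real.sqrt n)⁻¹ *
          ((bigSpacings n ω (a / n) : ℝ) - n * Real.exp (-a)) : ℝ) : ℂ)) ∂(iidUniform01 n)) atTop
      (𝓝 (Complex.exp (θ ^ 2 * ((Real.exp (-a) - Real.exp (-2 * a) - a ^ 2 * Real.exp (-2 * a) : ℝ) : ℂ) / 2))) := by
  have h0 := spI_tendsto a ha 0
  have hθ := spI_tendsto a ha θ
  have hc : ((Real.pi : ℂ) / -(-(1/2))) ^ (1 / 2 : ℂ) ≠ 0 := by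
    rw [Ne, Complex.cpow_eq_zero_iff, not_and_or]
    left
    simp [Real.pi_ne_zero]
  set c := ((Real.pi : ℂ) / -(-(1/2))) ^ (1 / 2 : ℂ) with hcdef
  have hlim := hθ.div h0 (by simpa using hc)
  have hv : c * Complex.exp (θ ^ 2 * ((Real.exp (-a) - Real.exp (-2 * a) - a ^ 2 * Real.exp (-2 * a) : ℝ) : ℂ) / 2) /
    (c * Complex.exp (0 ^ 2 * ((Real.exp (-a) - Real.exp (-2 * a) - a ^ 2 * Real.exp (-2 * a) : ℝ) : ℂ) / 2)) =
    Complex.exp (θ ^ 2 * ((Real.exp (-a) - Real.exp (-2 * a) - a ^ 2 * Real.exp (-2 * a) : ℝ) : ℂ) / 2) := by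
    rw [mul_div_mul_left _ _ hc]
    simp
  rw [hv] at hlim
  refine hlim.congr' ?_
  filter_upwards [eventually_ge_atTop 2] with n hn
  obtain ⟨K, hK⟩ := mgf_formula a ha n hn
  have hK0 := hK 0
  rw [hK θ]
  simp only [zero_mul, Complex.exp_zero, integral_const, probReal_univ, one_smul] at hK0
  simp only [Pi.div_apply]
  have hne : (∫ u : ℝ, spH a (0 / Real.sqrt n) (u / Real.sqrt n) ^ n) ≠ 0 := by
    intro h; rw [h] at hK0; simp at hK0
  rw [div_eq_iff hne]
  linear_combination (∫ u : ℝ, spH a (θ / Real.sqrt n) (u / Real.sqrt n) ^ n) * hK0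



lemma iteratedDeriv_circle (f : ℂ → ℂ) (hf : Differentiable ℂ f) (k : ℕ) :
    iteratedDeriv k f 0 = k.factorial • (2 * Real.pi * Complex.I : ℂ)⁻¹ •
      ∮ z in C(0, 1), (z - 0)⁻¹ ^ (k + 1) • f z := by
  have : (2 * Real.pi * Complex.I / k.factorial : ℂ) ≠ 0 := by simp [Nat.factorial_ne_zero, Real.pi_ne_zero]
  rw [← inv_smul_smul₀ this (iteratedDeriv k f 0), inv_div, div_eq_inv_mul, mul_comm,
      ← nsmul_eq_mul, smul_assoc]
  have h := DiffContOnCl.circleIntegral_one_div_sub_center_pow_smul (c := 0) one_pos k (hf.diffContOnCl (s := Metric.ball 0 1))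
  rw [← h]
  simp

lemma differentiable_complexMGF_of (μ : Measure ℝ) (h : integrableExpSet id μ = Set.univ) :
    Differentiable ℂ (complexMGF id μ) := fun z =>
  (hasDerivAt_complexMGF (by rw [h]; simp)).differentiableAt

lemma moment_eq_circle (μ : Measure ℝ) (h : integrableExpSet id μ = Set.univ) (k : ℕ) :
    ((∫ x, x ^ k ∂μ : ℝ) : ℂ) = k.factorial • (2 * Real.pi * Complex.I : ℂ)⁻¹ •
      ∮ z in C(0, 1), (z - 0)⁻¹ ^ (k + 1) • complexMGF id μ z := by
  rw [← iteratedDeriv_circle _ (differentiable_complexMGF_of μ h), iteratedDeriv_complexMGF (by rw [h]; simp),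
    ← integral_complex_ofReal]
  simp

lemma mgf_le_of (μ : Measure ℝ) (h : integrableExpSet id μ = Set.univ) (x : ℝ) (hx : |x| ≤ 1) :
    mgf id μ x ≤ mgf id μ 1 + mgf id μ (-1) := by
  have hi : ∀ t : ℝ, Integrable (fun y : ℝ => Real.exp (t * id y)) μ := fun t => by
    have : t ∈ integrableExpSet id μ := by rw [h]; trivial
    exact this
  unfold mgf
  rw [← integral_add (hi _) (hi _)]
  refine integral_mono (hi _) ((hi _).add (hi _)) fun y => ?_
  have h1 : x * y ≤ |y| := by
    calc x * y ≤ |x * y| := le_abs_self _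
      _ = |x| * |y| := abs_mul _ _
      _ ≤ |y| := mul_le_of_le_one_left (abs_nonneg _) hx
  simp only [id]
  rcases le_total 0 y with hy | hy
  · rw [abs_of_nonneg hy] at h1
    have := Real.exp_le_exp.2 h1
    have h2 := (Real.exp_pos (-1 * y)).le
    rw [one_mul]; linarith
  · rw [abs_of_nonpos hy] at h1
    have := Real.exp_le_exp.2 h1
    have h2 := (Real.exp_pos (1 * y)).le
    rw [neg_one_mul]; linarith

lemma moments_tendsto (μs : ℕ → Measure ℝ) (μ : Measure ℝ)
    (hs : ∀ n, integrableExpSet id (μs n) = Set.univ) (h : integrableExpSet id μ = Set.univ)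
    (hlim : ∀ z : ℂ, Tendsto (fun n => complexMGF id (μs n) z) atTop (𝓝 (complexMGF id μ z))) (k : ℕ) :
    Tendsto (fun n => ∫ x, x ^ k ∂(μs n)) atTop (𝓝 (∫ x, x ^ k ∂μ)) := by
  have hreal : ∀ x : ℝ, Tendsto (fun n => mgf id (μs n) x) atTop (𝓝 (mgf id μ x)) := fun x => by
    have := (Complex.continuous_re.tendsto _).comp (hlim x)
    simpa [re_complexMGF_ofReal, Function.comp_def] using! this
  suffices H : Tendsto (fun n => ((∫ x, x ^ k ∂(μs n) : ℝ) : ℂ)) atTop (𝓝 ((∫ x, x ^ k ∂μ : ℝ) : ℂ)) by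
    have := (Complex.continuous_re.tendsto _).comp H
    simpa [Function.comp_def] using! this
  simp_rw [fun n => moment_eq_circle (μs n) (hs n) k]
  rw [moment_eq_circle μ h k]
  refine Tendsto.const_smul (Tendsto.const_smul ?_ _) _
  unfold circleIntegral
  set B := mgf id μ 1 + mgf id μ (-1) + 1 with hB
  have hev : ∀ᶠ n in atTop, mgf id (μs n) 1 + mgf id (μs n) (-1) ≤ B := by
    have := ((hreal 1).add (hreal (-1))).eventually_le_const (u := B) (by linarith)
    exact this
  refine intervalIntegral.tendsto_integral_filter_of_dominated_convergence (fun _ => B) ?_ ?_ ?_ ?_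
  · refine Eventually.of_forall fun n => Continuous.aestronglyMeasurable ?_
    have hc := (differentiable_complexMGF_of (μs n) (hs n)).continuous
    have hne : ∀ θ : ℝ, circleMap 0 1 θ - 0 ≠ 0 := fun θ => by simp
    simp only [deriv_circleMap]
    have : Continuous fun θ : ℝ => (circleMap 0 1 θ - 0)⁻¹ := Continuous.inv₀ (by fun_prop) hne
    have hcm : Continuous (circleMap 0 1) := continuous_circleMap 0 1
    exact Continuous.smul (hcm.mul continuous_const) (Continuous.smul (this.pow _) (hc.comp hcm))
  · filter_upwards [hev] with n hn
    refine ae_of_all _ fun θ _ => ?_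
    have h1 : ‖circleMap 0 1 θ‖ = 1 := by simp
    rw [deriv_circleMap, norm_smul, norm_smul, norm_mul, sub_zero, norm_pow, norm_inv, h1]
    simp only [Complex.norm_I, inv_one, one_pow, one_mul]
    refine norm_complexMGF_le_mgf.trans ((mgf_le_of _ (hs n) _ ?_).trans hn)
    exact (Complex.abs_re_le_norm _).trans h1.le
  · exact intervalIntegrable_const
  · exact ae_of_all _ fun θ _ => Tendsto.const_smul (Tendsto.const_smul (hlim _) _) _

lemma weak_tendsto (μs : ℕ → Measure ℝ) (μ : Measure ℝ) [hP : ∀ n, IsProbabilityMeasure (μs n)] [IsProbabilityMeasure μ]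
    (hlim : ∀ z : ℂ, Tendsto (fun n => complexMGF id (μs n) z) atTop (𝓝 (complexMGF id μ z)))
    (f : BoundedContinuousFunction ℝ ℝ) :
    Tendsto (fun n => ∫ x, f x ∂(μs n)) atTop (𝓝 (∫ x, f x ∂μ)) := by
  let P : ℕ → ProbabilityMeasure ℝ := fun n => ⟨μs n, hP n⟩
  let Q : ProbabilityMeasure ℝ := ⟨μ, inferInstance⟩
  have hPQ : Tendsto P atTop (𝓝 Q) := by
    rw [ProbabilityMeasure.tendsto_iff_tendsto_charFun]
    intro t
    have := hlim (t * Complex.I)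
    simp only [complexMGF_id_mul_I] at this
    exact this
  exact ProbabilityMeasure.tendsto_iff_forall_integral_tendsto.1 hPQ f

lemma bigSpacings_le (n : ℕ) (ω : Fin (n - 1) → ℝ) (c : ℝ) : bigSpacings n ω c ≤ n - 1 + 1 := by
  unfold bigSpacings
  refine (Set.ncard_le_ncard (Set.sep_subset _ _) ((Set.finite_range ω).insert 0)).trans ?_
  refine (Set.ncard_insert_le _ _).trans ?_
  gcongr
  rw [← Set.image_univ]
  refine (Set.ncard_image_le Set.finite_univ).trans ?_
  simp [Set.ncard_univ]

lemma spX_aemeasurable (a : ℝ) (n : ℕ) : AEMeasurable (fun ω => (Real.sqrt n)⁻¹ *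
          ((bigSpacings n ω (a / n) : ℝ) - n * Real.exp (-a))) (iidUniform01 n) := by
  have h : AEMeasurable (fun ω => (bigSpacings n ω (a / n) : ℝ)) (iidUniform01 n) :=
    (measurable_from_nat (f := fun k : ℕ => (k : ℝ))).comp_aemeasurable (bigSpacings_aemeasurable n (a / n))
  exact (h.sub_const _).const_mul _

lemma spX_integrableExpSet (a : ℝ) (n : ℕ) : integrableExpSet id ((iidUniform01 n).map (fun ω => (Real.sqrt n)⁻¹ *
          ((bigSpacings n ω (a / n) : ℝ) - n * Real.exp (-a)))) = Set.univ := by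
  refine Set.eq_univ_of_forall fun t => ?_
  change Integrable (fun x : ℝ => Real.exp (t * id x)) _
  have hX := spX_aemeasurable a n
  rw [integrable_map_measure (by fun_prop) hX]
  refine Integrable.of_bound (C := Real.exp (|t| * ((Real.sqrt n)⁻¹ * ((n - 1 + 1 : ℕ) + n * Real.exp (-a))))) ?_ (ae_of_all _ fun ω => ?_)
  · exact (Real.measurable_exp.comp_aemeasurable (hX.const_mul t)).aestronglyMeasurable
  · have hb : (bigSpacings n ω (a / n) : ℝ) ≤ ((n - 1 + 1 : ℕ) : ℝ) := by exact_mod_cast bigSpacings_le n ω _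
    simp only [Function.comp_apply, id]
    rw [Real.norm_of_nonneg (Real.exp_pos _).le]
    refine Real.exp_le_exp.2 ((le_abs_self _).trans ?_)
    rw [abs_mul, abs_mul, abs_of_nonneg (by positivity : 0 ≤ (Real.sqrt n)⁻¹)]
    gcongr
    refine (abs_sub _ _).trans ?_
    rw [abs_of_nonneg (by positivity), abs_of_nonneg (by positivity)]
    gcongr

lemma sigma_nonneg (a : ℝ) (ha : 0 < a) :
    0 ≤ Real.exp (-a) - Real.exp (-2 * a) - a ^ 2 * Real.exp (-2 * a) := by
  have e2 : Real.exp (-2 * a) = Real.exp (-a) * Real.exp (-a) := by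
    rw [← Real.exp_add]; congr 1; ring
  have h1 : 1 + a ^ 2 ≤ Real.exp a := by
    have := Real.sum_le_exp_of_nonneg ha.le 4
    simp [Finset.sum_range_succ, Nat.factorial] at this
    nlinarith [mul_nonneg ha.le (sq_nonneg (a - 3/2))]
  have h2 : Real.exp a * Real.exp (-a) = 1 := by rw [← Real.exp_add]; simp
  have hp := Real.exp_pos (-a)
  rw [e2]
  have : Real.exp (-a) * ((1 + a ^ 2) * Real.exp (-a)) ≤ Real.exp (-a) * 1 := by
    refine mul_le_mul_of_nonneg_left ?_ hp.le
    nlinarith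
  nlinarith

lemma spX_complexMGF (a : ℝ) (ha : 0 < a) (z : ℂ) :
    Tendsto (fun n : ℕ => complexMGF id ((iidUniform01 n).map (fun ω => (Real.sqrt n)⁻¹ *
          ((bigSpacings n ω (a / n) : ℝ) - n * Real.exp (-a)))) z) atTop
      (𝓝 (complexMGF id (gaussianReal 0 (Real.toNNReal
          (Real.exp (-a) - Real.exp (-2 * a) - a ^ 2 * Real.exp (-2 * a)))) z)) := by
  rw [complexMGF_id_gaussianReal]
  simp_rw [fun n : ℕ => complexMGF_id_map (spX_aemeasurable a n)]
  refine (mgf_tendsto a ha z).congr' ?_ |>.trans (le_of_eq ?_)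
  · exact Eventually.of_forall fun n => rfl
  · congr 2
    rw [Real.coe_toNNReal _ (sigma_nonneg a ha)]
    push_cast; ring


/-- Asymptotic normality, with convergence of all moments, of the number of spacings
greater than `a/n` (Le Cam; Section 5). -/
theorem spacings_clt (a : ℝ) (ha : 0 < a) :
    TendstoInDistribution
      (fun n => (iidUniform01 n).map
        (fun ω => (Real.sqrt n)⁻¹ *
          ((bigSpacings n ω (a / n) : ℝ) - n * Real.exp (-a))))
      (gaussianReal 0
        (Real.toNNReal
          (Real.exp (-a) - Real.exp (-2 * a) - a ^ 2 * Real.exp (-2 * a)))) ∧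
    ∀ k : ℕ,
      Tendsto
        (fun n => ∫ x, x ^ k
          ∂((iidUniform01 n).map
            (fun ω => (Real.sqrt n)⁻¹ *
              ((bigSpacings n ω (a / n) : ℝ) - n * Real.exp (-a)))))
        atTop
        (𝓝 (∫ x, x ^ k
          ∂(gaussianReal 0
            (Real.toNNReal
              (Real.exp (-a) - Real.exp (-2 * a) - a ^ 2 * Real.exp (-2 * a)))))) := by
  have hP : ∀ n : ℕ, IsProbabilityMeasure ((iidUniform01 n).map
      (fun ω => (Real.sqrt n)⁻¹ * ((bigSpacings n ω (a / n) : ℝ) - n * Real.exp (-a)))) :=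
    fun n => Measure.isProbabilityMeasure_map (spX_aemeasurable a n)
  refine ⟨fun f => ?_, fun k => ?_⟩
  · exact weak_tendsto _ _ (fun z => spX_complexMGF a ha z) f
  · exact moments_tendsto _ _ (fun n => spX_integrableExpSet a n) integrableExpSet_id_gaussianReal
      (fun z => spX_complexMGF a ha z) k
end
end

section
/- Let X^{(n)} = (X_1^{(n)},…,X_d^{(n)}), n ≥ 1, and X = (X_1,…,X_d) be random vectors in ℝ^d, d ≥ 1, such that Σ_{i=1}^d t_i X_i^{(n)} converges in distribution to Σ_{i=1}^d t_i X_i for all real numbers t_1,…,t_d ≥ 0. Suppose further that the distribution of X is determined by its moments. Then X^{(n)} converges in distribution to X (and hence Σ_i t_i X_i^{(n)} →_d Σ_i t_i X_i for all real t_1,…,t_d, of arbitrary signs). -/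
open MeasureTheory ProbabilityTheory Filter Topology

noncomputable section

/-- A probability law on `ℝ^d` is determined by its moments: all mixed moments are finite,
and any law with the same mixed moments coincides with it. -/
def DeterminedByMoments {d : ℕ} (μ : Measure (Fin d → ℝ)) : Prop :=
  (∀ α : Fin d → ℕ, Integrable (fun x => ∏ i, x i ^ α i) μ) ∧
  ∀ ν : Measure (Fin d → ℝ), IsProbabilityMeasure ν →
    (∀ α : Fin d → ℕ, Integrable (fun x => ∏ i, x i ^ α i) ν) →
    (∀ α : Fin d → ℕ, (∫ x, ∏ i, x i ^ α i ∂ν) = ∫ x, ∏ i, x i ^ α i ∂μ) →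
    ν = μ

/-- Monomials are integrable as soon as all coordinate powers are. -/
lemma integrable_monomial_of_coord {d : ℕ} (hd : 0 < d) (ν : Measure (Fin d → ℝ))
    (h : ∀ i, ∀ N : ℕ, Integrable (fun x : Fin d → ℝ => x i ^ N) ν) (α : Fin d → ℕ) :
    Integrable (fun x : Fin d → ℝ => ∏ i, x i ^ α i) ν := by
  have hg : Integrable (fun x : Fin d → ℝ => ∑ j, ‖x j ^ (∑ i, α i)‖) ν :=
    integrable_finsetSum _ fun j _ => (h j _).norm
  refine hg.mono' (Continuous.aestronglyMeasurable (by fun_prop)) (Eventually.of_forall fun x => ?_)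
  have : Nonempty (Fin d) := ⟨⟨0, hd⟩⟩
  obtain ⟨j, hj⟩ := Finite.exists_max fun i => |x i|
  calc ‖∏ i, x i ^ α i‖ = ∏ i, |x i| ^ α i := by
        rw [Real.norm_eq_abs, Finset.abs_prod]; simp [abs_pow]
    _ ≤ ∏ i, |x j| ^ α i := by
        refine Finset.prod_le_prod (fun i _ => by positivity) fun i _ => ?_
        exact pow_le_pow_left₀ (abs_nonneg _) (hj i) _
    _ = ‖x j ^ (∑ i, α i)‖ := by
        rw [Finset.prod_pow_eq_pow_sum, Real.norm_eq_abs, abs_pow]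
    _ ≤ ∑ j, ‖x j ^ (∑ i, α i)‖ :=
        Finset.single_le_sum (f := fun j => ‖x j ^ (∑ i, α i)‖)
          (fun _ _ => norm_nonneg _) (Finset.mem_univ j)

/-- The polynomial in `t` giving the `N`-th moment of `∑ t i * x i`. -/
lemma exists_moment_poly {d : ℕ} (ν : Measure (Fin d → ℝ))
    (h : ∀ α : Fin d → ℕ, Integrable (fun x : Fin d → ℝ => ∏ i, x i ^ α i) ν) (N : ℕ) :
    ∃ p : MvPolynomial (Fin d) ℝ,
      (∀ t : Fin d → ℝ, MvPolynomial.eval t p = ∫ x, (∑ i, t i * x i) ^ N ∂ν) ∧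
      ∀ α : Fin d → ℕ, ∑ i, α i = N →
        p.coeff (Finsupp.equivFunOnFinite.symm α) =
          Nat.multinomial Finset.univ α * ∫ x, ∏ i, x i ^ α i ∂ν := by
  refine ⟨∑ k ∈ Finset.piAntidiag Finset.univ N,
    MvPolynomial.monomial (Finsupp.equivFunOnFinite.symm k)
      ((Nat.multinomial Finset.univ k : ℝ) * ∫ x, ∏ i, x i ^ k i ∂ν), fun t => ?_, fun α hα => ?_⟩
  · have : ∀ x : Fin d → ℝ, (∑ i, t i * x i) ^ N =
        ∑ k ∈ Finset.piAntidiag Finset.univ N,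
          ((Nat.multinomial Finset.univ k : ℝ) * ∏ i, t i ^ k i) * ∏ i, x i ^ k i := by
      intro x
      rw [Finset.sum_pow_eq_sum_piAntidiag]
      refine Finset.sum_congr rfl fun k _ => ?_
      simp only [mul_pow, Finset.prod_mul_distrib, mul_assoc]
    simp_rw [this]
    rw [integral_finsetSum _ fun k _ => (h k).const_mul _, map_sum]
    refine Finset.sum_congr rfl fun k _ => ?_
    rw [integral_const_mul, MvPolynomial.eval_monomial, Finsupp.prod_fintype _ _ (by simp)]
    simp only [Finsupp.equivFunOnFinite_symm_apply_apply]
    ring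
  · rw [MvPolynomial.coeff_sum, Finset.sum_eq_single α]
    · rw [MvPolynomial.coeff_monomial, if_pos rfl]
    · intro b _ hb
      rw [MvPolynomial.coeff_monomial, if_neg]
      exact fun h' => hb (Finsupp.equivFunOnFinite.symm.injective h')
    · intro hn
      exact absurd (by simpa [Finset.mem_piAntidiag] using hα) hn

lemma continuous_lin {d : ℕ} (t : Fin d → ℝ) :
    Continuous fun x : Fin d → ℝ => ∑ i, t i * x i := by fun_prop

/-- A law with the same nonnegative linear combinations as a moment-determined one equals it. -/
lemma eq_of_nonneg_comb {d : ℕ} (hd : 0 < d) (μ ν : Measure (Fin d → ℝ))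
    (hν : IsProbabilityMeasure ν) (hdet : DeterminedByMoments μ)
    (h : ∀ t : Fin d → ℝ, (∀ i, 0 ≤ t i) →
      ν.map (fun x => ∑ i, t i * x i) = μ.map (fun x => ∑ i, t i * x i)) : ν = μ := by
  have hνint : ∀ α : Fin d → ℕ, Integrable (fun x : Fin d → ℝ => ∏ i, x i ^ α i) ν := by
    refine integrable_monomial_of_coord hd ν fun i N => ?_
    have h1 := h (Pi.single i 1) fun j => by
      by_cases hj : j = i
      · subst hj; simp
      · simp [hj]
    simp only [Pi.single_apply, ite_mul, one_mul, zero_mul, Finset.sum_ite_eq',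
      Finset.mem_univ, if_true] at h1
    have hμi : Integrable (fun x : Fin d → ℝ => x i ^ N) μ := by
      have := hdet.1 (Pi.single i N)
      refine this.congr (Eventually.of_forall fun x => ?_)
      change ∏ j, x j ^ (Pi.single i N : Fin d → ℕ) j = x i ^ N
      rw [Finset.prod_eq_single i]
      · simp
      · intro j _ hj; simp [hj]
      · simp
    have h2 : Integrable (fun y : ℝ => y ^ N) (μ.map fun x => x i) :=
      (integrable_map_measure (f := fun x : Fin d → ℝ => x i) (g := fun y : ℝ => y ^ N)
        (continuous_pow N).aestronglyMeasurable (measurable_pi_apply i).aemeasurable).2 hμi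
    rw [← h1] at h2
    exact (integrable_map_measure (f := fun x : Fin d → ℝ => x i) (g := fun y : ℝ => y ^ N)
        (continuous_pow N).aestronglyMeasurable (measurable_pi_apply i).aemeasurable).1 h2
  refine hdet.2 ν hν hνint fun α => ?_
  obtain ⟨p, hp, hpc⟩ := exists_moment_poly ν hνint (∑ i, α i)
  obtain ⟨q, hq, hqc⟩ := exists_moment_poly μ hdet.1 (∑ i, α i)
  have hpq : p = q := by
    refine MvPolynomial.funext_set (fun _ => Set.Ici (0 : ℝ)) (fun _ => Set.Ici_infinite 0) ?_
    intro t ht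
    have ht' : ∀ i, 0 ≤ t i := fun i => ht i (Set.mem_univ i)
    rw [hp, hq]
    have e : ∀ ρ : Measure (Fin d → ℝ), ∫ x, (∑ i, t i * x i) ^ (∑ i, α i) ∂ρ =
        ∫ y, y ^ (∑ i, α i) ∂(ρ.map fun x => ∑ i, t i * x i) := fun ρ =>
      (integral_map (continuous_lin t).measurable.aemeasurable
        (continuous_pow _).aestronglyMeasurable).symm
    rw [e, e, h t ht']
  have := (hpc α rfl).symm.trans (hpq ▸ hqc α rfl)
  have hm : (Nat.multinomial Finset.univ α : ℝ) ≠ 0 :=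
    Nat.cast_ne_zero.2 (Nat.multinomial_pos _ _).ne'
  exact mul_left_cancel₀ hm this

lemma tight_of_marginals {d : ℕ} (S : Set (Measure (Fin d → ℝ)))
    (h : ∀ i, IsTightMeasureSet ((fun ρ : Measure (Fin d → ℝ) => ρ.map fun x => x i) '' S)) :
    IsTightMeasureSet S := by
  simp only [isTightMeasureSet_iff_exists_isCompact_measure_compl_le] at h ⊢
  intro ε hε
  obtain ⟨δ, hδ, hδε⟩ := ENNReal.exists_pos_sum_of_countable' hε.ne' (Fin d)
  choose K hK hKS using fun i => h i (δ i) (hδ i)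
  refine ⟨Set.univ.pi K, isCompact_univ_pi hK, fun ρ hρ => ?_⟩
  have hsub : (Set.univ.pi K)ᶜ ⊆ ⋃ i, (fun x : Fin d → ℝ => x i) ⁻¹' (K i)ᶜ := by
    intro x hx
    simpa [Set.mem_pi] using hx
  refine (measure_mono hsub).trans ((measure_iUnion_le _).trans (le_trans ?_ hδε.le))
  refine ENNReal.tsum_le_tsum fun i => ?_
  have := hKS i _ ⟨ρ, hρ, rfl⟩
  rwa [Measure.map_apply (measurable_pi_apply i) (hK i).isClosed.measurableSet.compl] at this

/-- Theorem 6.1: the one-sided Cramér–Wold theorem. If all nonnegative linear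
combinations converge in distribution and the limit is determined by its moments, then
the random vectors converge in distribution (and hence all linear combinations
converge). -/
theorem one_sided_cramer_wold
    (d : ℕ) (hd : 0 < d)
    (μs : ℕ → Measure (Fin d → ℝ)) (hμs : ∀ n, IsProbabilityMeasure (μs n))
    (μ : Measure (Fin d → ℝ)) (hμ : IsProbabilityMeasure μ)
    (hconv : ∀ t : Fin d → ℝ, (∀ i, 0 ≤ t i) →
      TendstoInDistribution (fun n => (μs n).map (fun x => ∑ i, t i * x i))
        (μ.map (fun x => ∑ i, t i * x i)))
    (hdet : DeterminedByMoments μ) :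
    TendstoInDistribution μs μ ∧
    ∀ t : Fin d → ℝ,
      TendstoInDistribution (fun n => (μs n).map (fun x => ∑ i, t i * x i))
        (μ.map (fun x => ∑ i, t i * x i)) := by
  have := hμs
  have := hμ
  let P : ℕ → ProbabilityMeasure (Fin d → ℝ) := fun n => ⟨μs n, hμs n⟩
  let Q : ProbabilityMeasure (Fin d → ℝ) := ⟨μ, hμ⟩
  have hlin : ∀ t : Fin d → ℝ, (∀ i, 0 ≤ t i) →
      Tendsto (fun n => (P n).map (continuous_lin t).measurable.aemeasurable) atTop
        (𝓝 (Q.map (continuous_lin t).measurable.aemeasurable)) := by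
    intro t ht
    rw [ProbabilityMeasure.tendsto_iff_forall_integral_tendsto]
    exact hconv t ht
  have htight : IsTightMeasureSet
      {((ρ : ProbabilityMeasure (Fin d → ℝ)) : Measure (Fin d → ℝ)) | ρ ∈ Set.range P} := by
    refine tight_of_marginals _ fun i => ?_
    have h1 := hlin (Pi.single i 1) fun j => by
      by_cases hj : j = i
      · subst hj; simp
      · simp [hj]
    have hc := h1.isCompact_insert_range
    have := isTightMeasureSet_of_isCompact_closure (hc.closure_of_subset (Set.subset_insert _ _))
    refine this.subset ?_
    rintro _ ⟨_, ⟨_, ⟨n, rfl⟩, rfl⟩, rfl⟩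
    refine ⟨_, ⟨n, rfl⟩, ?_⟩
    simp [Pi.single_apply]
  have hcomp := isCompact_closure_of_isTightMeasureSet htight
  have hmain : Tendsto P atTop (𝓝 Q) := by
    rw [tendsto_iff_ultrafilter]
    intro U hU
    obtain ⟨R, -, hR⟩ := hcomp.ultrafilter_le_nhds (U.map P) (by
      rw [le_principal_iff]
      exact Filter.mem_of_superset (Filter.range_mem_map) subset_closure)
    have hR' : Tendsto P U (𝓝 R) := hR
    suffices hRQ : R = Q by rwa [hRQ] at hR'
    refine Subtype.ext (eq_of_nonneg_comb hd μ R R.2 hdet fun t ht => ?_)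
    have a := ProbabilityMeasure.tendsto_map_of_tendsto_of_continuous P R hR' (continuous_lin t)
    have b := tendsto_nhds_unique a ((hlin t ht).mono_left hU)
    exact congrArg (fun ρ : ProbabilityMeasure ℝ => (ρ : Measure ℝ)) b
  refine ⟨ProbabilityMeasure.tendsto_iff_forall_integral_tendsto.1 hmain, fun t => ?_⟩
  exact ProbabilityMeasure.tendsto_iff_forall_integral_tendsto.1
    (ProbabilityMeasure.tendsto_map_of_tendsto_of_continuous P Q hmain (continuous_lin t))
end
end

section
/- Let X = (X_1,…,X_d) and Y = (Y_1,…,Y_d) be random vectors in ℝ^d, d ≥ 1, whose characteristic functions satisfy φ_X(t_1,…,t_d) = φ_Y(t_1,…,t_d) for all t_1,…,t_d ≥ 0. Suppose further that the distribution of X is determined by its moments. Then X and Y have the same distribution (equivalently, φ_X = φ_Y on all of ℝ^d). -/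
open MeasureTheory ProbabilityTheory Filter Topology

noncomputable section

/-- The characteristic function of a law on `ℝ^d`. -/
def charFunD {d : ℕ} (μ : Measure (Fin d → ℝ)) (t : Fin d → ℝ) : ℂ :=
  ∫ x, Complex.exp (Complex.I * ((∑ i, t i * x i : ℝ) : ℂ)) ∂μ

theorem octant_marginal {d : ℕ} (μX μY : Measure (Fin d → ℝ))
    [IsProbabilityMeasure μX] [IsProbabilityMeasure μY]
    (heq : ∀ t : Fin d → ℝ, (∀ i, 0 ≤ t i) → charFunD μX t = charFunD μY t) (i : Fin d) :
    μX.map (fun x => x i) = μY.map (fun x => x i) := by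
  have key : ∀ (μ : Measure (Fin d → ℝ)) (t : ℝ),
      charFun (μ.map (fun x => x i)) t = charFunD μ (Pi.single i t) := by
    intro μ t
    rw [charFun_apply_real, integral_map (measurable_pi_apply i).aemeasurable (by fun_prop)]
    unfold charFunD
    congr 1
    ext x
    have : ∑ j, (Pi.single i t : Fin d → ℝ) j * x j = t * x i := by
      rw [Finset.sum_eq_single i]
      · simp
      · intro b _ hb
        simp [Pi.single_eq_of_ne hb]
      · simp
    rw [this]
    push_cast
    ring_nf
  have hpos : ∀ t : ℝ, 0 ≤ t →
      charFun (μX.map (fun x => x i)) t = charFun (μY.map (fun x => x i)) t := by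
    intro t ht
    rw [key, key]
    apply heq
    intro j
    by_cases h : j = i
    · subst h
      simpa using ht
    · simp [Pi.single_eq_of_ne h]
  have : IsProbabilityMeasure (μX.map (fun x => x i)) :=
    Measure.isProbabilityMeasure_map (measurable_pi_apply i).aemeasurable
  have : IsProbabilityMeasure (μY.map (fun x => x i)) :=
    Measure.isProbabilityMeasure_map (measurable_pi_apply i).aemeasurable
  apply Measure.ext_of_charFun
  ext t
  rcases le_total 0 t with ht | ht
  · exact hpos t ht
  · have h := hpos (-t) (by linarith)
    rw [charFun_neg, charFun_neg] at h
    exact (starRingEnd ℂ).injective h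

theorem octant_prod_le {d : ℕ} (α : Fin d → ℕ) (x : Fin d → ℝ) :
    ∏ i, |x i| ^ α i ≤ 1 + ∑ j, |x j| ^ (∑ i, α i) := by
  have hs : 0 ≤ ∑ j, |x j| ^ (∑ i, α i) := Finset.sum_nonneg fun _ _ => by positivity
  by_cases h : ∀ i, |x i| ≤ 1
  · have : ∏ i, |x i| ^ α i ≤ 1 :=
      Finset.prod_le_one (fun _ _ => by positivity) fun i _ => pow_le_one₀ (abs_nonneg _) (h i)
    linarith
  · push Not at h
    obtain ⟨i₀, hi₀⟩ := h
    obtain ⟨k, -, hk⟩ := Finset.exists_max_image Finset.univ (fun i => |x i|) ⟨i₀, Finset.mem_univ _⟩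
    have h1 : ∏ i, |x i| ^ α i ≤ ∏ i, |x k| ^ α i :=
      Finset.prod_le_prod (fun _ _ => by positivity) fun i _ =>
        pow_le_pow_left₀ (abs_nonneg _) (hk i (Finset.mem_univ _)) _
    rw [Finset.prod_pow_eq_pow_sum] at h1
    have h2 : |x k| ^ (∑ i, α i) ≤ ∑ j, |x j| ^ (∑ i, α i) :=
      Finset.single_le_sum (f := fun j => |x j| ^ (∑ i, α i))
        (fun _ _ => by positivity) (Finset.mem_univ k)
    linarith

theorem octant_integrable {d : ℕ} (μX μY : Measure (Fin d → ℝ))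
    [IsProbabilityMeasure μX] [IsProbabilityMeasure μY]
    (hm : ∀ i, μX.map (fun x => x i) = μY.map (fun x => x i))
    (hint : ∀ α : Fin d → ℕ, Integrable (fun x => ∏ i, x i ^ α i) μX) (α : Fin d → ℕ) :
    Integrable (fun x => ∏ i, x i ^ α i) μY := by
  have h1 : ∀ (j : Fin d) (n : ℕ), Integrable (fun x => |x j| ^ n) μY := by
    intro j n
    have hX : Integrable (fun x : Fin d → ℝ => x j ^ n) μX := by
      have := hint (Pi.single j n)
      refine this.congr (Eventually.of_forall fun x => ?_)
      simp only
      rw [Finset.prod_eq_single j]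
      · simp
      · intro b _ hb
        simp [Pi.single_eq_of_ne hb]
      · simp
    have hX' : Integrable (fun y : ℝ => y ^ n) (μX.map (fun x => x j)) := by
      rw [integrable_map_measure (by fun_prop) (by exact (measurable_pi_apply j).aemeasurable)]
      exact hX
    rw [hm j, integrable_map_measure (by fun_prop) (by exact (measurable_pi_apply j).aemeasurable)] at hX'
    refine hX'.norm.congr (Eventually.of_forall fun x => ?_)
    simp
  have h2 : Integrable (fun x : Fin d → ℝ => 1 + ∑ j, |x j| ^ (∑ i, α i)) μY :=
    (integrable_const _).add (integrable_finsetSum _ fun j _ => h1 j _)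
  refine h2.mono' (Continuous.aestronglyMeasurable (by fun_prop)) (Eventually.of_forall fun x => ?_)
  rw [Real.norm_eq_abs, Finset.abs_prod]
  simpa only [abs_pow] using octant_prod_le α x

/-- exponentials -/
def octExp {d : ℕ} (t : Fin d → ℝ) (x : Fin d → ℝ) : ℂ :=
  Complex.exp (Complex.I * ((∑ i, t i * x i : ℝ) : ℂ))

theorem octExp_add {d : ℕ} (s t : Fin d → ℝ) :
    octExp (s + t) = octExp s * octExp t := by
  ext x
  simp only [octExp, Pi.mul_apply, ← Complex.exp_add, Pi.add_apply, add_mul,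
    Finset.sum_add_distrib, Complex.ofReal_add, mul_add]

/-- the monoid of exponentials with frequency in the octant -/
def octMonoid (d : ℕ) : Submonoid ((Fin d → ℝ) → ℂ) where
  carrier := {F | ∃ t : Fin d → ℝ, (∀ i, 0 ≤ t i) ∧ F = octExp t}
  one_mem' := ⟨0, by simp, by ext x; simp [octExp]⟩
  mul_mem' := by
    rintro _ _ ⟨s, hs, rfl⟩ ⟨t, ht, rfl⟩
    exact ⟨s + t, fun i => add_nonneg (hs i) (ht i), (octExp_add s t).symm⟩

theorem octExp_integrable {d : ℕ} (μ : Measure (Fin d → ℝ)) [IsProbabilityMeasure μ]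
    (t : Fin d → ℝ) : Integrable (octExp t) μ := by
  refine (integrable_const (1 : ℝ)).mono' ?_ (Eventually.of_forall fun x => ?_)
  · unfold octExp
    exact Continuous.aestronglyMeasurable (by fun_prop)
  · rw [octExp, mul_comm, Complex.norm_exp_ofReal_mul_I]

theorem octant_span {d : ℕ} (μX μY : Measure (Fin d → ℝ))
    [IsProbabilityMeasure μX] [IsProbabilityMeasure μY]
    (heq : ∀ t : Fin d → ℝ, (∀ i, 0 ≤ t i) → charFunD μX t = charFunD μY t)
    (F : (Fin d → ℝ) → ℂ) (hF : F ∈ Algebra.adjoin ℂ (octMonoid d : Set ((Fin d → ℝ) → ℂ))) :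
    Integrable F μX ∧ Integrable F μY ∧ ∫ x, F x ∂μX = ∫ x, F x ∂μY := by
  rw [← Subalgebra.mem_toSubmodule, Algebra.adjoin_eq_span, Submonoid.closure_eq] at hF
  induction hF using Submodule.span_induction with
  | mem F h =>
    obtain ⟨t, ht, rfl⟩ := h
    exact ⟨octExp_integrable _ _, octExp_integrable _ _, heq t ht⟩
  | zero => exact ⟨integrable_zero _ _ _, integrable_zero _ _ _, by simp⟩
  | add F G _ _ hF hG =>
    refine ⟨hF.1.add hG.1, hF.2.1.add hG.2.1, ?_⟩
    simp only [Pi.add_apply]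
    rw [integral_add hF.1 hG.1, integral_add hF.2.1 hG.2.1, hF.2.2, hG.2.2]
  | smul c F _ hF =>
    refine ⟨hF.1.smul c, hF.2.1.smul c, ?_⟩
    simp only [Pi.smul_apply]
    rw [integral_smul, integral_smul, hF.2.2]

/-- difference quotient -/
def octQ (h y : ℝ) : ℂ := (Complex.I * h)⁻¹ * (Complex.exp (Complex.I * ((h * y : ℝ) : ℂ)) - 1)

theorem octQ_norm_le (h y : ℝ) (hh : 0 < h) : ‖octQ h y‖ ≤ |y| := by
  have := Real.norm_exp_I_mul_ofReal_sub_one_le (x := h * y)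
  rw [octQ, norm_mul, norm_inv, norm_mul, Complex.norm_I, one_mul, Complex.norm_real,
    Real.norm_eq_abs, abs_of_pos hh, inv_mul_le_iff₀ hh]
  rwa [Real.norm_eq_abs, abs_mul, abs_of_pos hh] at this

theorem octQ_tendsto (y : ℝ) : Tendsto (fun h => octQ h y) (𝓝[>] 0) (𝓝 (y : ℂ)) := by
  have hd : HasDerivAt (fun h : ℝ => Complex.exp (Complex.I * ((h * y : ℝ) : ℂ)))
      (Complex.I * y) 0 := by
    have h1 : HasDerivAt (fun h : ℝ => Complex.I * ((h * y : ℝ) : ℂ)) (Complex.I * y) 0 := by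
      have := ((hasDerivAt_id (0 : ℝ)).mul_const y).ofReal_comp.const_mul Complex.I
      simpa using this
    simpa using h1.cexp
  have h2 := hd.tendsto_slope_zero_right
  have h3 := h2.const_mul (Complex.I⁻¹)
  have e : Complex.I⁻¹ * (Complex.I * (y : ℂ)) = y := by
    rw [inv_mul_cancel_left₀ Complex.I_ne_zero]
  rw [e] at h3
  refine h3.congr fun h => ?_
  simp only [octQ, zero_add, zero_mul, Complex.ofReal_zero, mul_zero, Complex.exp_zero,
    mul_inv, Complex.real_smul, Complex.ofReal_inv, mul_assoc]

theorem octF_mem {d : ℕ} (α : Fin d → ℕ) (h : ℝ) (hh : 0 < h) :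
    (fun x : Fin d → ℝ => ∏ i, octQ h (x i) ^ α i) ∈
      Algebra.adjoin ℂ (octMonoid d : Set ((Fin d → ℝ) → ℂ)) := by
  have : (fun x : Fin d → ℝ => ∏ i, octQ h (x i) ^ α i) =
      ∏ i, ((Complex.I * h)⁻¹ • (octExp (Pi.single i h) - 1)) ^ α i := by
    ext x
    rw [Finset.prod_apply]
    refine Finset.prod_congr rfl fun i _ => ?_
    have e : ∑ j, (Pi.single i h : Fin d → ℝ) j * x j = h * x i := by
      rw [Finset.sum_eq_single i]
      · simp
      · intro b _ hb
        simp [Pi.single_eq_of_ne hb]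
      · simp
    simp only [Pi.pow_apply, Pi.smul_apply, Pi.sub_apply, Pi.one_apply, smul_eq_mul, octExp, e,
      octQ]
  rw [this]
  refine Subalgebra.prod_mem _ fun i _ => ?_
  have hmem : octExp (Pi.single i h) ∈ (octMonoid d : Set ((Fin d → ℝ) → ℂ)) := by
    refine ⟨_, ?_, rfl⟩
    intro j
    by_cases hj : j = i
    · subst hj
      simpa using hh.le
    · simp [Pi.single_eq_of_ne hj]
  exact Subalgebra.pow_mem _ (Subalgebra.smul_mem _
    (Subalgebra.sub_mem _ (Algebra.subset_adjoin hmem) (Subalgebra.one_mem _)) _) _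

theorem octF_tendsto {d : ℕ} (μ : Measure (Fin d → ℝ)) (α : Fin d → ℕ)
    (hint : Integrable (fun x => ∏ i, x i ^ α i) μ) :
    Tendsto (fun h => ∫ x, ∏ i, octQ h (x i) ^ α i ∂μ) (𝓝[>] 0)
      (𝓝 ((∫ x, ∏ i, x i ^ α i ∂μ : ℝ) : ℂ)) := by
  rw [← integral_complex_ofReal]
  refine tendsto_integral_filter_of_dominated_convergence
    (fun x => ‖∏ i, x i ^ α i‖) ?_ ?_ hint.norm ?_
  · refine Eventually.of_forall fun h => ?_
    unfold octQ
    exact Continuous.aestronglyMeasurable (by fun_prop)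
  · filter_upwards [self_mem_nhdsWithin] with h hh
    refine Eventually.of_forall fun x => ?_
    rw [norm_prod, norm_prod]
    refine Finset.prod_le_prod (fun _ _ => norm_nonneg _) fun i _ => ?_
    rw [norm_pow, norm_pow]
    exact pow_le_pow_left₀ (norm_nonneg _) (octQ_norm_le h (x i) hh) _
  · refine Eventually.of_forall fun x => ?_
    push_cast
    exact tendsto_finsetProd _ fun i _ => (octQ_tendsto (x i)).pow _

/-- Lemma 6.3: if two laws on `ℝ^d` have characteristic functions agreeing on the first
octant and one of them is determined by its moments, then they coincide. -/
theorem charFun_eq_on_octant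
    (d : ℕ) (hd : 0 < d)
    (μX μY : Measure (Fin d → ℝ))
    (hX : IsProbabilityMeasure μX) (hY : IsProbabilityMeasure μY)
    (heq : ∀ t : Fin d → ℝ, (∀ i, 0 ≤ t i) → charFunD μX t = charFunD μY t)
    (hdet : DeterminedByMoments μX) :
    μX = μY ∧ ∀ t : Fin d → ℝ, charFunD μX t = charFunD μY t := by
  have hm := octant_marginal μX μY heq
  have hintY := octant_integrable μX μY hm hdet.1
  have hYX : μY = μX := by
    refine hdet.2 μY hY hintY fun α => ?_
    have h1 := octF_tendsto μX α (hdet.1 α)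
    have h2 := octF_tendsto μY α (hintY α)
    have h3 : (fun h => ∫ x, ∏ i, octQ h (x i) ^ α i ∂μX) =ᶠ[𝓝[>] 0]
        (fun h => ∫ x, ∏ i, octQ h (x i) ^ α i ∂μY) := by
      filter_upwards [self_mem_nhdsWithin] with h hh
      exact (octant_span μX μY heq _ (octF_mem α h hh)).2.2
    exact_mod_cast tendsto_nhds_unique h2 (h1.congr' h3)
  subst hYX
  exact ⟨rfl, fun _ => rfl⟩
end
end

section
/- There exist random vectors X = (X_1, X_2) and Y = (Y_1, Y_2) in ℝ² such that for all real t_1, t_2 ≥ 0 the random variables t_1 X_1 + t_2 X_2 and t_1 Y_1 + t_2 Y_2 have the same distribution (in particular, the characteristic functions satisfy φ_X(t_1, t_2) = φ_Y(t_1, t_2) for all t_1, t_2 ≥ 0), yet X and Y do not have the same distribution. Consequently, the one-sided Cramér–Wold theorem fails without the assumption that the limit is determined by its moments: with X^{(n)} := Y for all n, one has Σ_i t_i X_i^{(n)} →_d Σ_i t_i X_i for all t_1, t_2 ≥ 0 but X^{(n)} does not converge in distribution to X. -/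
open MeasureTheory ProbabilityTheory Filter Topology

noncomputable section

open FourierTransform in
lemma exF : ∃ F : ℝ → ℂ, Continuous F ∧ Integrable F ∧ (∃ x, F x ≠ 0) ∧
    ∀ s : ℝ, s ≤ 0 → ∫ x, Complex.exp (Complex.I * ((s * x : ℝ) : ℂ)) * F x = 0 := by
  let b : ContDiffBump (2 : ℝ) := ⟨1, 2, by norm_num, by norm_num⟩
  let a : SchwartzMap ℝ ℂ := HasCompactSupport.toSchwartzMap (f := fun x => ((b x : ℝ) : ℂ))
    (b.hasCompactSupport.comp_left (g := fun y : ℝ => (y : ℂ)) (by simp))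
    (Complex.ofRealCLM.contDiff.comp b.contDiff)
  have ha : ∀ x, a x = ((b x : ℝ) : ℂ) := fun x => rfl
  refine ⟨fun x => (𝓕 a) x, (𝓕 a).continuous, (𝓕 a).integrable, ?_, ?_⟩
  · by_contra! h
    have h0 : 𝓕 a = 0 := by ext x; exact h x
    have h1 : a = 0 := by
      have : 𝓕⁻ (𝓕 a) = a := FourierTransform.fourierInv_fourier_eq a
      rw [h0] at this
      rw [← this]; simp
    have h2 := ha 2
    rw [h1, b.one_of_mem_closedBall] at h2
    · simp at h2
    · simp [b]
  · intro s hs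
    have h1 : (𝓕⁻ (𝓕 a)) (s / (2 * Real.pi)) = 0 := by
      rw [FourierTransform.fourierInv_fourier_eq a, ha, b.zero_of_le_dist]
      · simp
      · have : s / (2 * Real.pi) ≤ 0 := div_nonpos_of_nonpos_of_nonneg hs (by positivity)
        rw [Real.dist_eq, abs_of_nonpos (by linarith)]
        simp only [b]; linarith
    rw [SchwartzMap.fourierInv_coe, Real.fourierInv_eq'] at h1
    rw [← h1]
    congr 1; ext x
    simp only [smul_eq_mul]
    congr 2
    simp
    field_simp

lemma exH : ∃ h : (Fin 2 → ℝ) → ℝ, Continuous h ∧ Integrable h ∧ (∃ x, 0 < h x) ∧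
    ∀ t : Fin 2 → ℝ, ((∀ i, 0 ≤ t i) ∨ (∀ i, t i ≤ 0)) →
      ∫ x, Complex.exp (Complex.I * ((∑ i, t i * x i : ℝ) : ℂ)) * (h x : ℂ) = 0 := by
  obtain ⟨F, Fc, Fi, ⟨x0, hx0⟩, hF⟩ := exF
  let G : ℝ → ℂ := fun x => (starRingEnd ℂ) (F x)
  have Gc : Continuous G := Complex.continuous_conj.comp Fc
  have Gi : Integrable G := Complex.conjCLE.toContinuousLinearMap.integrable_comp Fi
  have hG : ∀ s : ℝ, 0 ≤ s → ∫ x, Complex.exp (Complex.I * ((s * x : ℝ) : ℂ)) * G x = 0 := by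
    intro s hs
    have h1 := congrArg (starRingEnd ℂ) (hF (-s) (by linarith))
    rw [← integral_conj, map_zero] at h1
    rw [← h1]
    congr 1; ext x
    simp [G, ← Complex.exp_conj]
  let H : (Fin 2 → ℝ) → ℝ := fun x => 2 * (F (x 0) * G (x 1)).re
  have hH : ∀ x, (H x : ℂ) = (∏ i, (![F, G] i) (x i)) + ∏ i, (![G, F] i) (x i) := by
    intro x
    have := Complex.add_conj (F (x 0) * G (x 1))
    simp only [H, Fin.prod_univ_two, Matrix.cons_val_zero, Matrix.cons_val_one]
    rw [← this]; simp [G]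
  have ei : ∀ (s : ℝ) (K : ℝ → ℂ), Integrable K →
      Integrable (fun x : ℝ => Complex.exp (Complex.I * ((s * x : ℝ) : ℂ)) * K x) := by
    intro s K hK
    refine hK.bdd_mul (c := 1) (Continuous.aestronglyMeasurable (by fun_prop)) ?_
    refine Eventually.of_forall fun x => ?_
    rw [mul_comm, Complex.norm_exp_ofReal_mul_I]
  have i1 : Integrable (fun x : Fin 2 → ℝ => ∏ i, (![F, G] i) (x i)) := by
    refine Integrable.fintype_prod (f := ![F, G]) ?_
    intro i; fin_cases i <;> simpa
  have i2 : Integrable (fun x : Fin 2 → ℝ => ∏ i, (![G, F] i) (x i)) := by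
    refine Integrable.fintype_prod (f := ![G, F]) ?_
    intro i; fin_cases i <;> simpa
  refine ⟨H, by fun_prop, ?_, ⟨fun _ => x0, ?_⟩, ?_⟩
  · have := (i1.add i2).re
    refine this.congr (Eventually.of_forall fun x => ?_)
    have h := congrArg Complex.re (hH x)
    simpa using h.symm
  · simp only [H, G, Complex.mul_conj, Complex.ofReal_re]
    have := Complex.normSq_pos.2 hx0
    linarith
  · intro t ht
    have key : ∀ K : Fin 2 → ℝ → ℂ, (∀ i, Integrable (K i)) →
        Integrable (fun x : Fin 2 → ℝ =>
          Complex.exp (Complex.I * ((∑ i, t i * x i : ℝ) : ℂ)) * ∏ i, K i (x i)) ∧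
        ∫ x : Fin 2 → ℝ, Complex.exp (Complex.I * ((∑ i, t i * x i : ℝ) : ℂ)) * ∏ i, K i (x i)
          = ∏ i, ∫ y : ℝ, Complex.exp (Complex.I * ((t i * y : ℝ) : ℂ)) * K i y := by
      intro K hK
      have e : (fun x : Fin 2 → ℝ =>
          Complex.exp (Complex.I * ((∑ i, t i * x i : ℝ) : ℂ)) * ∏ i, K i (x i)) =
          fun x => ∏ i, (fun y : ℝ => Complex.exp (Complex.I * ((t i * y : ℝ) : ℂ)) * K i y) (x i) := by
        ext x
        simp only [Finset.prod_mul_distrib, ← Complex.exp_sum, ← Finset.mul_sum, Complex.ofReal_sum]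
      rw [e]
      exact ⟨Integrable.fintype_prod
        (f := fun i y => Complex.exp (Complex.I * ((t i * y : ℝ) : ℂ)) * K i y)
        (fun i => ei _ _ (hK i)), integral_fintype_prod_volume_eq_prod
          (f := fun i y => Complex.exp (Complex.I * ((t i * y : ℝ) : ℂ)) * K i y)⟩
    obtain ⟨a1, b1⟩ := key ![F, G] (by intro i; fin_cases i <;> simpa)
    obtain ⟨a2, b2⟩ := key ![G, F] (by intro i; fin_cases i <;> simpa)
    simp_rw [hH, mul_add]
    rw [integral_add a1 a2, b1, b2]
    simp only [Fin.prod_univ_two, Matrix.cons_val_zero, Matrix.cons_val_one]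
    rcases ht with ht | ht
    · rw [hG _ (ht 0), hG _ (ht 1)]; simp
    · rw [hF _ (ht 0), hF _ (ht 1)]; simp

/-- Example 6.4: the one-sided Cramér–Wold device fails in general. There are two
distinct laws on `ℝ²` all of whose nonnegative linear combinations agree (so their
characteristic functions agree on the first octant); taking the constant sequence equal
to the second law, all nonnegative linear combinations converge in distribution to those
of the first law, yet the sequence does not converge in distribution to it. -/
theorem one_sided_cramer_wold_fails :
    ∃ μX μY : Measure (Fin 2 → ℝ),
      IsProbabilityMeasure μX ∧ IsProbabilityMeasure μY ∧
      (∀ t : Fin 2 → ℝ, (∀ i, 0 ≤ t i) →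
        μX.map (fun x => ∑ i, t i * x i) = μY.map (fun x => ∑ i, t i * x i)) ∧
      (∀ t : Fin 2 → ℝ, (∀ i, 0 ≤ t i) → charFunD μX t = charFunD μY t) ∧
      μX ≠ μY ∧
      (∀ t : Fin 2 → ℝ, (∀ i, 0 ≤ t i) →
        TendstoInDistribution (fun _ : ℕ => μY.map (fun x => ∑ i, t i * x i))
          (μX.map (fun x => ∑ i, t i * x i))) ∧
      ¬ TendstoInDistribution (fun _ : ℕ => μY) μX := by
  obtain ⟨h, hc, hi, ⟨x0, hx0⟩, hz⟩ := exH
  have m1 : Measurable fun x => ENNReal.ofReal (h x) := hc.measurable.ennreal_ofReal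
  have m2 : Measurable fun x => ENNReal.ofReal (-h x) := hc.neg.measurable.ennreal_ofReal
  set c : ENNReal := ∫⁻ x, ENNReal.ofReal (h x) with hcdef
  have f1 : c ≠ ⊤ := hi.lintegral_lt_top.ne
  have f2 : ∫⁻ x, ENNReal.ofReal (-h x) ≠ ⊤ := hi.neg.lintegral_lt_top.ne
  have h0 : ∫ x, h x = 0 := by
    have := hz 0 (Or.inl (by simp))
    simp only [Pi.zero_apply, zero_mul, Finset.sum_const_zero, Complex.ofReal_zero, mul_zero,
      Complex.exp_zero, one_mul] at this
    rw [integral_complex_ofReal] at this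
    exact_mod_cast this
  have hcc : ∫⁻ x, ENNReal.ofReal (-h x) = c := by
    rw [integral_eq_lintegral_pos_part_sub_lintegral_neg_part hi] at h0
    exact ((ENNReal.toReal_eq_toReal_iff' f1 f2).1 (by linarith)).symm
  have c0 : c ≠ 0 := by
    intro e
    rw [hcdef, lintegral_eq_zero_iff m1] at e
    have hop : IsOpen {x | 0 < h x} := isOpen_lt continuous_const hc
    have hpos := hop.measure_pos volume ⟨x0, hx0⟩
    refine hpos.ne' (measure_mono_null ?_ (ae_iff.1 e))
    intro x hx
    simpa using hx
  let μX : Measure (Fin 2 → ℝ) := c⁻¹ • volume.withDensity fun x => ENNReal.ofReal (h x)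
  let μY : Measure (Fin 2 → ℝ) := c⁻¹ • volume.withDensity fun x => ENNReal.ofReal (-h x)
  have pX : IsProbabilityMeasure μX := ⟨by
    simp only [μX, Measure.smul_apply, withDensity_apply _ MeasurableSet.univ, Measure.restrict_univ,
      smul_eq_mul]
    exact ENNReal.inv_mul_cancel c0 f1⟩
  have pY : IsProbabilityMeasure μY := ⟨by
    simp only [μY, Measure.smul_apply, withDensity_apply _ MeasurableSet.univ, Measure.restrict_univ,
      smul_eq_mul, hcc]
    exact ENNReal.inv_mul_cancel c0 f1⟩
  have hch : ∀ t : Fin 2 → ℝ, ((∀ i, 0 ≤ t i) ∨ (∀ i, t i ≤ 0)) →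
      charFunD μX t = charFunD μY t := by
    intro t ht
    have bd : ∀ g : (Fin 2 → ℝ) → ℝ, Integrable g → Integrable (fun x =>
        (ENNReal.ofReal (g x)).toReal • Complex.exp (Complex.I * ((∑ i, t i * x i : ℝ) : ℂ))) := by
      intro g hg
      have hg' : Integrable (fun x => (((max (g x) 0 : ℝ)) : ℂ)) := hg.pos_part.ofReal
      have := hg'.bdd_mul (c := 1)
        (f := fun x => Complex.exp (Complex.I * ((∑ i, t i * x i : ℝ) : ℂ)))
        (Continuous.aestronglyMeasurable (by fun_prop))
        (Eventually.of_forall fun x => by rw [mul_comm, Complex.norm_exp_ofReal_mul_I])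
      refine this.congr (Eventually.of_forall fun x => ?_)
      simp only [ENNReal.toReal_ofReal', Complex.real_smul]
      ring
    simp only [charFunD, μX, μY, integral_smul_measure]
    congr 1
    rw [integral_withDensity_eq_integral_toReal_smul m1 (by simp),
      integral_withDensity_eq_integral_toReal_smul m2 (by simp), ← sub_eq_zero,
      ← integral_sub (bd _ hi) (bd (fun x => -h x) hi.neg), ← hz t ht]
    congr 1; ext x
    simp only [ENNReal.toReal_ofReal', Complex.real_smul, ← sub_mul]
    rw [mul_comm, ← Complex.ofReal_sub]
    congr 2
    exact max_zero_sub_max_neg_zero_eq_self (h x)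
  have hne : μX ≠ μY := by
    intro e
    have hS : MeasurableSet {x | 0 < h x} := measurableSet_lt measurable_const hc.measurable
    have a1 : μX {x | 0 < h x}ᶜ = 0 := by
      simp only [μX, Measure.smul_apply, withDensity_apply _ hS.compl, smul_eq_mul]
      rw [setLIntegral_congr_fun (g := fun _ => 0) hS.compl]
      · simp
      · intro x hx
        simpa using hx
    have a2 : μY {x | 0 < h x} = 0 := by
      simp only [μY, Measure.smul_apply, withDensity_apply _ hS, smul_eq_mul]
      rw [setLIntegral_congr_fun (g := fun _ => 0) hS]
      · simp
      · intro x hx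
        simpa using (le_of_lt hx : 0 ≤ h x)
    rw [← e] at a2
    have a3 := prob_add_prob_compl (μ := μX) hS
    rw [a1, a2] at a3
    simp at a3
  have hmap : ∀ t : Fin 2 → ℝ, (∀ i, 0 ≤ t i) →
      μX.map (fun x => ∑ i, t i * x i) = μY.map (fun x => ∑ i, t i * x i) := by
    intro t ht
    have hm : Measurable (fun x : Fin 2 → ℝ => ∑ i, t i * x i) := by fun_prop
    have : IsProbabilityMeasure (μX.map (fun x => ∑ i, t i * x i)) :=
      Measure.isProbabilityMeasure_map hm.aemeasurable
    have : IsProbabilityMeasure (μY.map (fun x => ∑ i, t i * x i)) :=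
      Measure.isProbabilityMeasure_map hm.aemeasurable
    have hcf : ∀ (μ : Measure (Fin 2 → ℝ)) (u : ℝ),
        charFun (μ.map (fun x => ∑ i, t i * x i)) u = charFunD μ (fun i => u * t i) := by
      intro μ u
      rw [charFun_apply_real, integral_map hm.aemeasurable
        (Continuous.aestronglyMeasurable (by fun_prop)), charFunD]
      congr 1; ext x
      simp only [mul_assoc, ← Finset.mul_sum]
      push_cast
      ring_nf
    apply Measure.ext_of_charFun
    ext u
    rw [hcf, hcf]
    apply hch
    rcases le_total 0 u with hu | hu
    · exact Or.inl fun i => mul_nonneg hu (ht i)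
    · exact Or.inr fun i => mul_nonpos_of_nonpos_of_nonneg hu (ht i)
  refine ⟨μX, μY, pX, pY, hmap, fun t ht => hch t (Or.inl ht), hne, ?_, ?_⟩
  · intro t ht f
    rw [hmap t ht]
    exact tendsto_const_nhds
  · intro hT
    apply hne
    apply ext_of_forall_integral_eq_of_IsFiniteMeasure
    intro f
    exact tendsto_nhds_unique (hT f) tendsto_const_nhds |>.symm ▸ rfl
end
end
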